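/- Every integer n ≥ 10 with n not congruent to 1 modulo 4 can be written as n = p² + k where p is prime and k is a square-free positive integer. -/

import Mathlib

/-- The primes `5 ≤ p ≤ P` not dividing `n` for which `q ^ 2` divides `n - p ^ 2`. -/
def badPrimes (n P q : ℕ) : Finset ℕ :=
  (Finset.Icc 5 P).filter fun p => p.Prime ∧ ¬ p ∣ n ∧ q ^ 2 ∣ n - p ^ 2

open Classical in
/-- The primes `p` that occur in a solution of `p ^ 2 + m * q ^ 2 = n` with `q ≥ 5` prime. -/
noncomputable def formPrimes (n m : ℕ) : Finset ℕ :=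
  (Finset.Icc 5 n).filter fun p => p.Prime ∧ ¬ p ∣ n ∧ ∃ q, q.Prime ∧ 5 ≤ q ∧ ¬ q ∣ n ∧
    p ^ 2 + m * q ^ 2 = n

lemma sq_mod_twentyfour {p : ℕ} (hp : p.Prime) (h5 : 5 ≤ p) : p ^ 2 % 24 = 1 := by
  have h2 : p % 2 ≠ 0 := fun h => by
    have := (Nat.prime_dvd_prime_iff_eq Nat.prime_two hp).1 (Nat.dvd_of_mod_eq_zero h); omega
  have h3 : p % 3 ≠ 0 := fun h => by
    have := (Nat.prime_dvd_prime_iff_eq Nat.prime_three hp).1 (Nat.dvd_of_mod_eq_zero h); omega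
  have h : ∀ r < 24, r % 2 ≠ 0 → r % 3 ≠ 0 → r ^ 2 % 24 = 1 := by decide
  rw [Nat.pow_mod]
  exact h _ (Nat.mod_lt _ (by norm_num)) (by omega) (by omega)

lemma exists_prime_sq_dvd {n p : ℕ} (h4 : n % 4 ≠ 1) (hp : p.Prime) (h5 : 5 ≤ p) (hpn : ¬ p ∣ n)
    (hlt : p ^ 2 < n) (hns : ¬ Squarefree (n - p ^ 2)) :
    ∃ q, q.Prime ∧ 3 ≤ q ∧ ¬ q ∣ n ∧ q ^ 2 ∣ n - p ^ 2 := by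
  rw [Nat.squarefree_iff_prime_squarefree] at hns
  push Not at hns
  obtain ⟨q, hq, hd⟩ := hns
  rw [← pow_two] at hd
  have hp24 := sq_mod_twentyfour hp h5
  refine ⟨q, hq, ?_, ?_, hd⟩
  · rcases hq.two_le.lt_or_eq with h | h
    · exact h
    · subst h
      omega
  · intro hqn
    have h1 : q ∣ p ^ 2 := by
      have h2 : q ∣ n - p ^ 2 := (dvd_pow_self q two_ne_zero).trans hd
      exact (Nat.dvd_sub_iff_right hlt.le hqn).1 h2
    have h2 := (Nat.prime_dvd_prime_iff_eq hq hp).1 (hq.dvd_of_dvd_pow h1)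
    exact hpn (h2 ▸ hqn)

/-- Every prime `5 ≤ p ≤ P` such that `n - p ^ 2` is not square-free divides `n`, is bad for a
small prime `q`, or occurs in a representation of `n` by one of few binary forms. -/
lemma cover {n P Q j : ℕ} (h4 : n % 4 ≠ 1) (hP : P ^ 2 < n) (hQ : 3 ≤ Q)
    (hj : n ≤ 24 * j * (Q + 1) ^ 2)
    (hns : ∀ p, p.Prime → p ^ 2 < n → ¬ Squarefree (n - p ^ 2)) :
    (Finset.Icc 5 P).filter Nat.Prime ⊆
      (n.primeFactors.filter (5 ≤ ·) ∪
        ((Finset.Icc 3 Q).filter fun q => q.Prime ∧ ¬ q ∣ n).biUnion (badPrimes n P)) ∪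
      ((Finset.Ico 1 (24 * j)).filter fun m => m % 24 = (n - 1) % 24).biUnion (formPrimes n) := by
  intro p hp
  simp only [Finset.mem_filter, Finset.mem_Icc] at hp
  obtain ⟨⟨h5, hpP⟩, hpp⟩ := hp
  have hlt : p ^ 2 < n := lt_of_le_of_lt (Nat.pow_le_pow_left hpP 2) hP
  by_cases hpn : p ∣ n
  · simp only [Finset.mem_union, Finset.mem_filter, Nat.mem_primeFactors]
    exact Or.inl (Or.inl ⟨⟨hpp, hpn, by omega⟩, h5⟩)
  obtain ⟨q, hq, hq3, hqn, hd⟩ := exists_prime_sq_dvd h4 hpp h5 hpn hlt (hns p hpp hlt)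
  by_cases hqQ : q ≤ Q
  · simp only [Finset.mem_union, Finset.mem_biUnion, Finset.mem_filter, Finset.mem_Icc, badPrimes]
    exact Or.inl (Or.inr ⟨q, ⟨⟨hq3, hqQ⟩, hq, hqn⟩, ⟨h5, hpP⟩, hpp, hpn, hd⟩)
  · push Not at hqQ
    obtain ⟨m, hm⟩ := hd
    have hq5 : 5 ≤ q := by
      by_contra! h
      have h' : q = 4 := by omega
      subst h'; revert hq; norm_num
    have hsum : p ^ 2 + m * q ^ 2 = n := by rw [mul_comm m, ← hm]; omega
    have hp24 := sq_mod_twentyfour hpp h5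
    have hq24 := sq_mod_twentyfour hq hq5
    have hm1 : m * q ^ 2 % 24 = m % 24 := by rw [Nat.mul_mod, hq24]; simp
    have hmpos : 1 ≤ m := by
      rcases Nat.eq_zero_or_pos m with h | h
      · subst h; omega
      · exact h
    have hmlt : m < 24 * j := by
      by_contra! h
      have h1 : 24 * j * (Q + 1) ^ 2 ≤ m * q ^ 2 :=
        Nat.mul_le_mul h (Nat.pow_le_pow_left hqQ 2)
      have : 0 < p ^ 2 := by positivity
      omega
    simp only [Finset.mem_union, Finset.mem_biUnion, Finset.mem_filter, Finset.mem_Icc,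
      Finset.mem_Ico, formPrimes]
    refine Or.inr ⟨m, ⟨⟨hmpos, hmlt⟩, by omega⟩, ⟨h5, ?_⟩, hpp, hpn, q, hq, hq5, hqn, hsum⟩
    nlinarith

lemma card_mod_twentyfour_le (j r : ℕ) :
    ((Finset.Ico 1 (24 * j)).filter fun m => m % 24 = r).card ≤ j := by
  calc _ ≤ (Finset.range j).card := by
        apply Finset.card_le_card_of_injOn (fun m => m / 24)
        · intro m hm
          simp only [Finset.coe_filter, Finset.mem_Ico, Set.mem_ofPred_eq] at hm
          simp only [Finset.coe_range, Set.mem_Iio]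
          omega
        · intro a ha b hb hab
          simp only [Finset.coe_filter, Finset.mem_Ico, Set.mem_ofPred_eq] at ha hb
          dsimp only at hab
          omega
    _ = j := Finset.card_range j

/-- Two members of `badPrimes n P q` are congruent up to sign modulo `q ^ 2`. -/
lemma badPrimes_congr {n P q p p' : ℕ} (hP : P ^ 2 < n) (hq : q.Prime) (hq3 : 3 ≤ q)
    (hqn : ¬ q ∣ n) (hp : p ∈ badPrimes n P q) (hp' : p' ∈ badPrimes n P q) :
    p ≡ p' [MOD q ^ 2] ∨ q ^ 2 ∣ p + p' := by
  simp only [badPrimes, Finset.mem_filter, Finset.mem_Icc] at hp hp'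
  obtain ⟨⟨h5, hpP⟩, hpp, hpn, hd⟩ := hp
  obtain ⟨⟨h5', hpP'⟩, hpp', hpn', hd'⟩ := hp'
  have hlt : p ^ 2 < n := lt_of_le_of_lt (Nat.pow_le_pow_left hpP 2) hP
  have hlt' : p' ^ 2 < n := lt_of_le_of_lt (Nat.pow_le_pow_left hpP' 2) hP
  zify [hlt.le] at hd
  zify [hlt'.le] at hd'
  have hprod : (q : ℤ) ^ 2 ∣ ((p' : ℤ) - p) * (p + p') := by
    have := dvd_sub hd hd'
    rwa [show (n : ℤ) - p ^ 2 - (n - p' ^ 2) = (p' - p) * (p + p') by ring] at this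
  have hqi : Prime (q : ℤ) := Nat.prime_iff_prime_int.1 hq
  by_cases hA : (q : ℤ) ∣ (p' : ℤ) - p
  · left
    have hB : ¬ (q : ℤ) ∣ (p : ℤ) + p' := by
      intro hB
      have h2 : (q : ℤ) ∣ 2 * p := by
        have := dvd_sub hB hA
        rwa [show (p : ℤ) + p' - (p' - p) = 2 * p by ring] at this
      rcases hqi.dvd_or_dvd h2 with h | h
      · have h : q ∣ 2 := by exact_mod_cast h
        have := Nat.le_of_dvd (by norm_num) h; omega
      · have h : q ∣ p := by exact_mod_cast h
        have hnn : (q : ℤ) ∣ n := by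
          have h1 : (q : ℤ) ∣ (n : ℤ) - p ^ 2 := (dvd_pow_self _ two_ne_zero).trans hd
          have h2 : (q : ℤ) ∣ (p : ℤ) ^ 2 :=
            (Int.natCast_dvd_natCast.2 h).trans (dvd_pow_self _ two_ne_zero)
          have := dvd_add h1 h2
          simpa using this
        exact hqn (by exact_mod_cast hnn)
    have hco : IsCoprime ((q : ℤ) ^ 2) ((p : ℤ) + p') :=
      ((Prime.coprime_iff_not_dvd hqi).2 hB).pow_left
    have := hco.dvd_of_dvd_mul_right hprod
    exact (Nat.modEq_iff_dvd).2 (by exact_mod_cast this)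
  · right
    have hco : IsCoprime ((q : ℤ) ^ 2) ((p' : ℤ) - p) :=
      ((Prime.coprime_iff_not_dvd hqi).2 hA).pow_left
    have := hco.dvd_of_dvd_mul_left hprod
    exact_mod_cast this

lemma card_badPrimes_le {n P q : ℕ} (hP : P ^ 2 < n) (hq : q.Prime) (hq3 : 3 ≤ q)
    (hqn : ¬ q ∣ n) : (badPrimes n P q).card ≤ P / q ^ 2 + 1 := by
  have hpos : 0 < q ^ 2 := by positivity
  calc _ ≤ (Finset.range (P / q ^ 2 + 1)).card := by
        apply Finset.card_le_card_of_injOn (fun m => m / q ^ 2)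
        · intro p hp
          have hp := Finset.mem_coe.1 hp
          simp only [badPrimes, Finset.mem_filter, Finset.mem_Icc] at hp
          simp only [Finset.coe_range, Set.mem_Iio]
          exact Nat.lt_succ_of_le (Nat.div_le_div_right hp.1.2)
        · intro a ha b hb hab
          dsimp only at hab
          have ha := Finset.mem_coe.1 ha
          have hb := Finset.mem_coe.1 hb
          have ea := Nat.div_add_mod a (q ^ 2)
          have eb := Nat.div_add_mod b (q ^ 2)
          have hq2 : q ^ 2 % 2 = 1 := by
            have := hq.eq_two_or_odd
            rw [Nat.pow_mod]; rcases this with h | h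
            · omega
            · rw [h]
          rcases badPrimes_congr hP hq hq3 hqn ha hb with h | h
          · rw [hab, h] at ea; omega
          · exfalso
            simp only [badPrimes, Finset.mem_filter, Finset.mem_Icc] at ha hb
            have oa := sq_mod_twentyfour ha.2.1 ha.1.1
            have ob := sq_mod_twentyfour hb.2.1 hb.1.1
            have oa : a % 2 = 1 := by rcases ha.2.1.eq_two_or_odd with h | h <;> omega
            have ob : b % 2 = 1 := by rcases hb.2.1.eq_two_or_odd with h | h <;> omega
            have hla := Nat.mod_lt a hpos
            have hlb := Nat.mod_lt b hpos
            rw [hab] at ea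
            generalize hw : q ^ 2 = w at *
            generalize a % w = r at *
            generalize b % w = s at *
            generalize b / w = c at *
            have h1 : w ∣ r + s := by
              have : a + b = w * (2 * c) + (r + s) := by rw [← ea, ← eb]; ring
              rw [this] at h
              exact (Nat.dvd_add_right (dvd_mul_right _ _)).1 h
            have h2 : r + s = 0 ∨ r + s = w := by
              obtain ⟨t, ht⟩ := h1
              have : t < 2 := by
                by_contra! h'
                have : w * 2 ≤ w * t := Nat.mul_le_mul_left _ h'
                omega
              interval_cases t <;> omega
            have h3 : a + b = 2 * (w * c) + (r + s) := by omega
            rcases h2 with h2 | h2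
            · have hr : r = 0 := by omega
              have : w ∣ a := ⟨c, by omega⟩
              have hqa : q ∣ a := (by rw [← hw]; exact dvd_pow_self q two_ne_zero : q ∣ w).trans this
              have := (Nat.prime_dvd_prime_iff_eq hq ha.2.1).1 hqa
              subst this
              have : q ^ 2 ≤ q := hw ▸ Nat.le_of_dvd (by omega) ‹w ∣ q›
              nlinarith
            · omega
    _ = _ := Finset.card_range _

/-- The moduli that separate the square roots of `-m` modulo `n` up to sign: the odd primes
dividing `n`, and `4` if it divides `n`. -/
def signModuli (n : ℕ) : Finset ℕ :=
  n.primeFactors.erase 2 ∪ if 4 ∣ n then {4} else ∅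

lemma mem_signModuli {n l : ℕ} (hn : n ≠ 0) :
    l ∈ signModuli n ↔ (l.Prime ∧ l ≠ 2 ∧ l ∣ n) ∨ (l = 4 ∧ 4 ∣ n) := by
  unfold signModuli
  split_ifs with h <;> simp [h, hn] <;> tauto

/-- The pair `(p, q)` of primes is a solution of `p ^ 2 + m * q ^ 2 = n` coprime to `n`. -/
structure IsFormSolution (n m p q : ℕ) : Prop where
  prime_left : p.Prime
  prime_right : q.Prime
  five_le_left : 5 ≤ p
  five_le_right : 5 ≤ q
  not_dvd_left : ¬ p ∣ n
  not_dvd_right : ¬ q ∣ n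
  eq : p ^ 2 + m * q ^ 2 = n

namespace IsFormSolution

variable {n m p q p' q' p₀ q₀ l : ℕ}

lemma ne_zero (h : IsFormSolution n m p q) : n ≠ 0 := by
  rintro rfl; exact h.not_dvd_left (dvd_zero _)

lemma prod_eq (h : IsFormSolution n m p q) (h' : IsFormSolution n m p' q') :
    ((p : ℤ) * q' - p' * q) * (p * q' + p' * q) = n * (q' ^ 2 - q ^ 2) := by
  have e : ((p : ℤ)) ^ 2 + m * q ^ 2 = n := by exact_mod_cast h.eq
  have e' : ((p' : ℤ)) ^ 2 + m * q' ^ 2 = n := by exact_mod_cast h'.eq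
  linear_combination (q' : ℤ) ^ 2 * e - (q : ℤ) ^ 2 * e'

lemma odd_left (h : IsFormSolution n m p q) : (p : ℤ) % 2 = 1 := by
  have := h.prime_left.eq_two_or_odd
  have := h.five_le_left
  omega

lemma odd_right (h : IsFormSolution n m p q) : (q : ℤ) % 2 = 1 := by
  have := h.prime_right.eq_two_or_odd
  have := h.five_le_right
  omega

lemma isCoprime_left (h : IsFormSolution n m p q) (hl : l ∈ signModuli n) :
    IsCoprime (l : ℤ) p := by
  rw [Nat.isCoprime_iff_coprime]
  rcases (mem_signModuli h.ne_zero).1 hl with ⟨hl, -, hd⟩ | ⟨rfl, -⟩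
  · rw [Nat.coprime_primes hl h.prime_left]
    rintro rfl; exact h.not_dvd_left hd
  · have := h.odd_left
    exact Nat.Coprime.pow_left 2 ((Nat.coprime_two_left).2 (Nat.odd_iff.2 (by omega)))

lemma isCoprime_right (h : IsFormSolution n m p q) (hl : l ∈ signModuli n) :
    IsCoprime (l : ℤ) q := by
  rw [Nat.isCoprime_iff_coprime]
  rcases (mem_signModuli h.ne_zero).1 hl with ⟨hl, -, hd⟩ | ⟨rfl, -⟩
  · rw [Nat.coprime_primes hl h.prime_right]
    rintro rfl; exact h.not_dvd_right hd
  · have := h.odd_right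
    exact Nat.Coprime.pow_left 2 ((Nat.coprime_two_left).2 (Nat.odd_iff.2 (by omega)))

lemma two_dvd_sub (h : IsFormSolution n m p q) (h' : IsFormSolution n m p' q') :
    (2 : ℤ) ∣ p * q' - p' * q := by
  have a1 : ((p : ℤ) * q') % 2 = 1 := by rw [Int.mul_emod, h.odd_left, h'.odd_right]; rfl
  have a2 : ((p' : ℤ) * q) % 2 = 1 := by rw [Int.mul_emod, h'.odd_left, h.odd_right]; rfl
  omega

lemma four_dvd_iff (h : IsFormSolution n m p q) (h' : IsFormSolution n m p' q') :
    (4 : ℤ) ∣ p * q' - p' * q ↔ ¬ (4 : ℤ) ∣ p * q' + p' * q := by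
  have a1 : ((p : ℤ) * q') % 2 = 1 := by rw [Int.mul_emod, h.odd_left, h'.odd_right]; rfl
  have a2 : ((p' : ℤ) * q) % 2 = 1 := by rw [Int.mul_emod, h'.odd_left, h.odd_right]; rfl
  omega

/-- Each sign modulus divides exactly one of the two cross combinations of two solutions. -/
lemma dvd_sub_iff (h : IsFormSolution n m p q) (h' : IsFormSolution n m p' q')
    (hl : l ∈ signModuli n) :
    (l : ℤ) ∣ p * q' - p' * q ↔ ¬ (l : ℤ) ∣ p * q' + p' * q := by
  have hc := (h.isCoprime_left hl).mul_right (h'.isCoprime_right hl)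
  rcases (mem_signModuli h.ne_zero).1 hl with ⟨hl, h2, hd⟩ | ⟨rfl, -⟩
  · have hli : Prime (l : ℤ) := Nat.prime_iff_prime_int.1 hl
    constructor
    · intro ha hb
      have h2 : (l : ℤ) ∣ 2 * (p * q') := by
        have := dvd_add ha hb
        rwa [show (p : ℤ) * q' - p' * q + (p * q' + p' * q) = 2 * (p * q') by ring] at this
      rcases hli.dvd_or_dvd h2 with h | h
      · have : l ∣ 2 := by exact_mod_cast h
        exact ‹l ≠ 2› ((Nat.prime_dvd_prime_iff_eq hl Nat.prime_two).1 this)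
      · exact hli.not_isUnit (hc.isUnit_of_dvd' dvd_rfl h)
    · intro hb
      have : (l : ℤ) ∣ (p * q' - p' * q) * (p * q' + p' * q) := by
        rw [prod_eq h h']
        exact (Int.natCast_dvd_natCast.2 hd).mul_right _
      exact (hli.dvd_or_dvd this).resolve_right hb
  · exact_mod_cast four_dvd_iff h h'

/-- Sign patterns relative to a base solution determine the sign pattern of a pair. -/
lemma dvd_sub_of_iff (h : IsFormSolution n m p q) (h' : IsFormSolution n m p' q')
    (h₀ : IsFormSolution n m p₀ q₀) (hl : l ∈ signModuli n)
    (ht : (l : ℤ) ∣ p * q₀ - p₀ * q ↔ (l : ℤ) ∣ p' * q₀ - p₀ * q') :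
    (l : ℤ) ∣ p * q' - p' * q := by
  have hc := (h₀.isCoprime_left hl).mul_right (h₀.isCoprime_right hl)
  refine hc.dvd_of_dvd_mul_left ?_
  by_cases hd : (l : ℤ) ∣ p * q₀ - p₀ * q
  · obtain ⟨a, ha⟩ := hd
    obtain ⟨b, hb⟩ := ht.1 ⟨a, ha⟩
    exact ⟨a * (p₀ * q') - b * (p₀ * q), by linear_combination p₀ * q' * ha - p₀ * q * hb⟩
  · have hd' : ¬ (l : ℤ) ∣ p' * q₀ - p₀ * q' := fun h => hd (ht.2 h)
    rw [dvd_sub_iff h h₀ hl, not_not] at hd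
    rw [dvd_sub_iff h' h₀ hl, not_not] at hd'
    obtain ⟨a, ha⟩ := hd
    obtain ⟨b, hb⟩ := hd'
    exact ⟨a * (p₀ * q') - b * (p₀ * q), by linear_combination p₀ * q' * ha - p₀ * q * hb⟩

lemma dvd_add_of_not_iff (h : IsFormSolution n m p q) (h' : IsFormSolution n m p' q')
    (h₀ : IsFormSolution n m p₀ q₀) (hl : l ∈ signModuli n)
    (ht : (l : ℤ) ∣ p * q₀ - p₀ * q ↔ ¬ (l : ℤ) ∣ p' * q₀ - p₀ * q') :
    (l : ℤ) ∣ p * q' + p' * q := by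
  have hc := (h₀.isCoprime_left hl).mul_right (h₀.isCoprime_right hl)
  refine hc.dvd_of_dvd_mul_left ?_
  by_cases hd : (l : ℤ) ∣ p * q₀ - p₀ * q
  · have hd' := ht.1 hd
    rw [dvd_sub_iff h' h₀ hl, not_not] at hd'
    obtain ⟨a, ha⟩ := hd
    obtain ⟨b, hb⟩ := hd'
    exact ⟨a * (p₀ * q') + b * (p₀ * q), by linear_combination p₀ * q' * ha + p₀ * q * hb⟩
  · have hd' := not_not.1 fun h => hd (ht.2 h)
    rw [dvd_sub_iff h h₀ hl, not_not] at hd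
    obtain ⟨a, ha⟩ := hd
    obtain ⟨b, hb⟩ := hd'
    exact ⟨a * (p₀ * q') + b * (p₀ * q), by linear_combination p₀ * q' * ha + p₀ * q * hb⟩

lemma eight_dvd (h : IsFormSolution n m p q) (h' : IsFormSolution n m p' q') :
    (8 : ℤ) ∣ (q' : ℤ) ^ 2 - q ^ 2 := by
  have a1 := sq_mod_twentyfour h.prime_right h.five_le_right
  have a2 := sq_mod_twentyfour h'.prime_right h'.five_le_right
  zify at a1 a2
  omega

/-- If every sign modulus divides the factor `a` of a product `a * b` divisible by `n * 8`,
and no sign modulus divides `b`, then `n` divides `a`. -/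
lemma _root_.dvd_of_signModuli {a b : ℤ} {n : ℕ} (hn : n ≠ 0) (h2 : 2 ∣ a) (hb2 : 2 ∣ b)
    (h4 : 4 ∣ n → ¬ (4 : ℤ) ∣ b)
    (hab : (n : ℤ) * 8 ∣ a * b) (hb : ∀ l ∈ signModuli n, ¬ (l : ℤ) ∣ b) :
    (n : ℤ) ∣ a := by
  rw [Int.natCast_dvd, Nat.dvd_iff_prime_pow_dvd_dvd]
  intro l k hl hk
  rw [← Int.natCast_dvd]
  push_cast
  have hkz : (l : ℤ) ^ k ∣ n := by exact_mod_cast hk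
  have hli : Prime (l : ℤ) := Nat.prime_iff_prime_int.1 hl
  rcases Nat.eq_zero_or_pos k with rfl | hkpos
  · simp
  by_cases hl2 : l = 2
  · subst hl2
    rcases lt_or_eq_of_le (Nat.succ_le_of_lt hkpos) with hk1 | rfl
    · have h4n : 4 ∣ n := (pow_dvd_pow 2 hk1).trans hk
      obtain ⟨c, rfl⟩ := hb2
      have hc : ¬ (2 : ℤ) ∣ c := fun ⟨d, hd⟩ => h4 h4n ⟨d, by rw [hd]; ring⟩
      have hco : IsCoprime ((2 : ℤ) ^ k) c :=
        ((Prime.coprime_iff_not_dvd Int.prime_two).2 hc).pow_left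
      refine hco.dvd_of_dvd_mul_right ?_
      obtain ⟨e, he⟩ := hab
      obtain ⟨f, hf⟩ := hkz
      push_cast at hf
      exact ⟨f * 4 * e, by rw [hf] at he; linarith⟩
    · simpa using h2
  · have hmem : l ∈ signModuli n :=
      (mem_signModuli hn).2 (Or.inl ⟨hl, hl2, (dvd_pow_self l hkpos.ne').trans hk⟩)
    have hco : IsCoprime ((l : ℤ) ^ k) b :=
      ((Prime.coprime_iff_not_dvd hli).2 (hb l hmem)).pow_left
    exact hco.dvd_of_dvd_mul_right (hkz.trans ((dvd_mul_right _ _).trans hab))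

lemma mul_eight_dvd (h : IsFormSolution n m p q) (h' : IsFormSolution n m p' q') :
    (n : ℤ) * 8 ∣ (p * q' - p' * q) * (p * q' + p' * q) := by
  rw [prod_eq h h']; exact mul_dvd_mul_left _ (eight_dvd h h')

lemma two_dvd_add (h : IsFormSolution n m p q) (h' : IsFormSolution n m p' q') :
    (2 : ℤ) ∣ p * q' + p' * q := by
  have := two_dvd_sub h h'; omega

lemma dvd_sub_of_forall (h : IsFormSolution n m p q) (h' : IsFormSolution n m p' q')
    (hd : ∀ l ∈ signModuli n, (l : ℤ) ∣ p * q' - p' * q) : (n : ℤ) ∣ p * q' - p' * q := by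
  refine dvd_of_signModuli h.ne_zero (two_dvd_sub h h') (two_dvd_add h h') (fun h4 => ?_)
    (mul_eight_dvd h h') fun l hl => (dvd_sub_iff h h' hl).1 (hd l hl)
  have hm : 4 ∈ signModuli n := (mem_signModuli h.ne_zero).2 (Or.inr ⟨rfl, h4⟩)
  exact_mod_cast (dvd_sub_iff h h' hm).1 (hd 4 hm)

lemma dvd_add_of_forall (h : IsFormSolution n m p q) (h' : IsFormSolution n m p' q')
    (hd : ∀ l ∈ signModuli n, (l : ℤ) ∣ p * q' + p' * q) : (n : ℤ) ∣ p * q' + p' * q := by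
  refine dvd_of_signModuli h.ne_zero (two_dvd_add h h') (two_dvd_sub h h') (fun h4 => ?_)
    (mul_comm ((p : ℤ) * q' - p' * q) _ ▸ mul_eight_dvd h h')
    fun l hl hs => (dvd_sub_iff h h' hl).1 hs (hd l hl)
  have hm : 4 ∈ signModuli n := (mem_signModuli h.ne_zero).2 (Or.inr ⟨rfl, h4⟩)
  exact fun hs => (dvd_sub_iff h h' hm).1 (by exact_mod_cast hs) (hd 4 hm)

lemma one_le (h : IsFormSolution n m p q) : 1 ≤ m := by
  rcases Nat.eq_zero_or_pos m with rfl | hm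
  · exact absurd ⟨p, by rw [← h.eq]; ring⟩ h.not_dvd_left
  · exact hm

lemma left_eq_of_dvd_sub (h : IsFormSolution n m p q) (h' : IsFormSolution n m p' q')
    (hd : (n : ℤ) ∣ p * q' - p' * q) : p = p' := by
  have e : ((p : ℤ)) ^ 2 + m * q ^ 2 = n := by exact_mod_cast h.eq
  have e' : ((p' : ℤ)) ^ 2 + m * q' ^ 2 = n := by exact_mod_cast h'.eq
  have hm : (1 : ℤ) ≤ m := by exact_mod_cast h.one_le
  have hid : (n : ℤ) ^ 2 = (p * p' + m * q * q') ^ 2 + m * (p * q' - p' * q) ^ 2 := by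
    linear_combination (-(p' : ℤ) ^ 2 - m * q' ^ 2) * e - (n : ℤ) * e'
  have hp : (0 : ℤ) < p := by exact_mod_cast h.prime_left.pos
  have hp' : (0 : ℤ) < p' := by exact_mod_cast h'.prime_left.pos
  have hpos : (0 : ℤ) < p * p' + m * q * q' := by positivity
  have hlt : (p * q' - p' * q : ℤ) ^ 2 < (n : ℤ) ^ 2 := by
    have : (0 : ℤ) < (p * p' + m * q * q') ^ 2 := by positivity
    nlinarith [sq_nonneg (p * q' - p' * q : ℤ)]
  have h0 : (p * q' - p' * q : ℤ) = 0 :=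
    Int.eq_zero_of_abs_lt_dvd hd (abs_lt_of_sq_lt_sq hlt (by positivity))
  have hE : p * q' = p' * q := by zify; linarith
  have hdvd : p ∣ p' * q := ⟨q', hE.symm⟩
  rcases h.prime_left.dvd_mul.1 hdvd with hd | hd
  · exact (Nat.prime_dvd_prime_iff_eq h.prime_left h'.prime_left).1 hd
  · have := (Nat.prime_dvd_prime_iff_eq h.prime_left h.prime_right).1 hd
    subst this
    exact absurd ⟨p + m * p, by rw [← h.eq]; ring⟩ h.not_dvd_left

lemma not_dvd_add (h : IsFormSolution n m p q) (h' : IsFormSolution n m p' q') (hm : 2 ≤ m) :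
    ¬ (n : ℤ) ∣ p * q' + p' * q := by
  intro hd
  have e : ((p : ℤ)) ^ 2 + m * q ^ 2 = n := by exact_mod_cast h.eq
  have e' : ((p' : ℤ)) ^ 2 + m * q' ^ 2 = n := by exact_mod_cast h'.eq
  have hm : (2 : ℤ) ≤ m := by exact_mod_cast hm
  have hid : (n : ℤ) ^ 2 = (p * p' - m * q * q') ^ 2 + m * (p * q' + p' * q) ^ 2 := by
    linear_combination (-(p' : ℤ) ^ 2 - m * q' ^ 2) * e - (n : ℤ) * e'
  have hp : (0 : ℤ) < p := by exact_mod_cast h.prime_left.pos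
  have hp' : (0 : ℤ) < p' := by exact_mod_cast h'.prime_left.pos
  have hq : (0 : ℤ) < q := by exact_mod_cast h.prime_right.pos
  have hq' : (0 : ℤ) < q' := by exact_mod_cast h'.prime_right.pos
  have hB : (0 : ℤ) < p * q' + p' * q := by positivity
  have hle := Int.le_of_dvd hB hd
  have : (n : ℤ) ^ 2 ≤ (p * q' + p' * q) ^ 2 := pow_le_pow_left₀ (by positivity) hle 2
  nlinarith [sq_nonneg (p * p' - m * q * q' : ℤ), pow_pos hB 2]

end IsFormSolution

open Classical in
/-- The set of sign moduli at which `(p, q)` agrees with `(p₀, q₀)`. -/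
noncomputable def signPattern (n p₀ q₀ p q : ℕ) : Finset ℕ :=
  (signModuli n).filter fun l => (l : ℤ) ∣ p * q₀ - p₀ * q

lemma exists_pattern (n m : ℕ) : ∃ T : ℕ → Finset ℕ,
    (∀ p, T p ⊆ signModuli n) ∧ Set.InjOn T (formPrimes n m) ∧
    (2 ≤ m → ∀ p ∈ formPrimes n m, ∀ p' ∈ formPrimes n m, T p ≠ signModuli n \ T p') := by
  classical
  have hex : ∀ p ∈ formPrimes n m, ∃ q, IsFormSolution n m p q := by
    intro p hp
    simp only [formPrimes, Finset.mem_filter, Finset.mem_Icc] at hp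
    obtain ⟨⟨h5, -⟩, hpp, hpn, q, hq, hq5, hqn, he⟩ := hp
    exact ⟨q, hpp, hq, h5, hq5, hpn, hqn, he⟩
  rcases (formPrimes n m).eq_empty_or_nonempty with h0 | ⟨p₀, hp₀⟩
  · exact ⟨fun _ => ∅, by simp, by simp [h0], by simp [h0]⟩
  choose! f hf using hex
  have h₀ := hf p₀ hp₀
  have hmem : ∀ p l, l ∈ signPattern n p₀ (f p₀) p (f p) ↔
      l ∈ signModuli n ∧ (l : ℤ) ∣ p * f p₀ - p₀ * f p := by
    intro p l; simp [signPattern]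
  refine ⟨fun p => signPattern n p₀ (f p₀) p (f p), fun p => Finset.filter_subset _ _, ?_, ?_⟩
  · intro p hp p' hp' he
    have hp := Finset.mem_coe.1 hp
    have hp' := Finset.mem_coe.1 hp'
    refine (hf p hp).left_eq_of_dvd_sub (hf p' hp')
      ((hf p hp).dvd_sub_of_forall (hf p' hp') fun l hl =>
        (hf p hp).dvd_sub_of_iff (hf p' hp') h₀ hl ?_)
    have := Finset.ext_iff.1 he l
    simpa [hmem, hl] using this
  · intro hm p hp p' hp' he
    refine (hf p hp).not_dvd_add (hf p' hp') hm
      ((hf p hp).dvd_add_of_forall (hf p' hp') fun l hl =>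
        (hf p hp).dvd_add_of_not_iff (hf p' hp') h₀ hl ?_)
    have := Finset.ext_iff.1 he l
    simpa [hmem, hl] using this

lemma card_formPrimes_le (n m : ℕ) : (formPrimes n m).card ≤ 2 ^ (signModuli n).card := by
  obtain ⟨T, hT, hinj, -⟩ := exists_pattern n m
  rw [← Finset.card_powerset]
  exact Finset.card_le_card_of_injOn T (fun p _ => Finset.mem_powerset.2 (hT p)) hinj

lemma two_mul_card_formPrimes_le {n m : ℕ} (hm : 2 ≤ m) :
    2 * (formPrimes n m).card ≤ 2 ^ (signModuli n).card := by
  obtain ⟨T, hT, hinj, hne⟩ := exists_pattern n m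
  have hinj' : Set.InjOn (fun p => signModuli n \ T p) (formPrimes n m) := by
    intro p hp p' hp' he
    apply hinj hp hp'
    dsimp only at he
    rw [← Finset.sdiff_sdiff_eq_self (hT p), he, Finset.sdiff_sdiff_eq_self (hT p')]
  have hdisj : Disjoint ((formPrimes n m).image T)
      ((formPrimes n m).image fun p => signModuli n \ T p) := by
    rw [Finset.disjoint_left]
    intro t ht ht'
    obtain ⟨p, hp, rfl⟩ := Finset.mem_image.1 ht
    obtain ⟨p', hp', he⟩ := Finset.mem_image.1 ht'
    exact hne hm p hp p' hp' he.symm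
  rw [← Finset.card_powerset, two_mul]
  nth_rewrite 1 [← Finset.card_image_of_injOn hinj]
  rw [← Finset.card_image_of_injOn hinj', ← Finset.card_union_of_disjoint hdisj]
  refine Finset.card_le_card (Finset.union_subset ?_ ?_)
  · exact Finset.image_subset_iff.2 fun p _ => Finset.mem_powerset.2 (hT p)
  · exact Finset.image_subset_iff.2 fun p _ => Finset.mem_powerset.2 Finset.sdiff_subset

lemma badPrimes_three_eq_empty {n P : ℕ} (hP : P ^ 2 < n) (h3 : n % 3 ≠ 1) (hn : ¬ 3 ∣ n) :
    badPrimes n P 3 = ∅ := by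
  rw [badPrimes, Finset.filter_eq_empty_iff]
  rintro p hp ⟨hpp, -, hd⟩
  rw [Finset.mem_Icc] at hp
  have := sq_mod_twentyfour hpp hp.1
  have : p ^ 2 ≤ P ^ 2 := Nat.pow_le_pow_left hp.2 2
  omega

/-- The total contribution of the forms `p ^ 2 + m * q ^ 2`. -/
lemma two_mul_card_biUnion_formPrimes_le (n j : ℕ) (hn : 0 < n) :
    2 * (((Finset.Ico 1 (24 * j)).filter fun m => m % 24 = (n - 1) % 24).biUnion
      (formPrimes n)).card ≤ (j + if n % 3 = 1 then 0 else 1) * 2 ^ (signModuli n).card := by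
  set M := (Finset.Ico 1 (24 * j)).filter fun m => m % 24 = (n - 1) % 24 with hM
  set k := (signModuli n).card with hk
  have hMj : M.card ≤ j := card_mod_twentyfour_le j _
  have hle : ∀ m ∈ M, 2 * (formPrimes n m).card ≤
      2 ^ k + if m = 1 then (if n % 3 = 1 then 0 else 2 ^ k) else 0 := by
    intro m hm
    simp only [hM, Finset.mem_filter, Finset.mem_Ico] at hm
    by_cases h1 : m = 1
    · have h2 : n % 3 ≠ 1 := by omega
      rw [if_pos h1, if_neg h2]
      have := card_formPrimes_le n m
      rw [← hk] at this
      omega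
    · rw [if_neg h1]
      exact two_mul_card_formPrimes_le (by omega)
  calc 2 * (M.biUnion (formPrimes n)).card ≤ 2 * ∑ m ∈ M, (formPrimes n m).card :=
        Nat.mul_le_mul_left _ Finset.card_biUnion_le
    _ ≤ ∑ m ∈ M, (2 ^ k + if m = 1 then (if n % 3 = 1 then 0 else 2 ^ k) else 0) := by
        rw [Finset.mul_sum]; exact Finset.sum_le_sum hle
    _ ≤ j * 2 ^ k + (if n % 3 = 1 then 0 else 2 ^ k) := by
        rw [Finset.sum_add_distrib, Finset.sum_const, smul_eq_mul]
        refine add_le_add (Nat.mul_le_mul_right _ hMj) ?_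
        rw [Finset.sum_ite_eq']
        split_ifs <;> simp
    _ = _ := by split_ifs <;> ring

lemma primeFactors_filter_subset (n : ℕ) : n.primeFactors.filter (5 ≤ ·) ⊆ signModuli n := by
  intro p hp
  rw [Finset.mem_filter, Nat.mem_primeFactors] at hp
  exact (mem_signModuli hp.1.2.2).2 (Or.inl ⟨hp.1.1, by omega, hp.1.2.1⟩)

/-- The fundamental inequality violated by suitable parameters. -/
lemma two_mul_card_primes_le {n P Q j : ℕ} (h4 : n % 4 ≠ 1) (hP : P ^ 2 < n) (hQ : 3 ≤ Q)
    (hj : n ≤ 24 * j * (Q + 1) ^ 2)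
    (hns : ∀ p, p.Prime → p ^ 2 < n → ¬ Squarefree (n - p ^ 2)) :
    2 * ((Finset.Icc 5 P).filter Nat.Prime).card ≤ 2 * ((signModuli n).card +
      ∑ q ∈ (Finset.Icc 3 Q).filter (fun q => q.Prime ∧ ¬ q ∣ n), (badPrimes n P q).card) +
      (j + if n % 3 = 1 then 0 else 1) * 2 ^ (signModuli n).card := by
  have h1 := Finset.card_le_card (cover h4 hP hQ hj hns)
  have h2 := h1.trans (Finset.card_union_le _ _)
  have h3 := Finset.card_union_le (n.primeFactors.filter (5 ≤ ·))
    (((Finset.Icc 3 Q).filter fun q => q.Prime ∧ ¬ q ∣ n).biUnion (badPrimes n P))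
  have h4 := Finset.card_le_card (primeFactors_filter_subset n)
  have h5 : (((Finset.Icc 3 Q).filter fun q => q.Prime ∧ ¬ q ∣ n).biUnion
    (badPrimes n P)).card ≤ _ := Finset.card_biUnion_le
  have h6 := two_mul_card_biUnion_formPrimes_le n j (by omega)
  omega

lemma prod_signModuli_le {n : ℕ} (hn : n ≠ 0) : ∏ l ∈ signModuli n, l ≤ n := by
  refine Nat.le_of_dvd (Nat.pos_of_ne_zero hn) (Finset.prod_dvd_of_isRelPrime ?_ ?_)
  · intro a ha b hb hab
    have ha := (mem_signModuli hn).1 (Finset.mem_coe.1 ha)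
    have hb := (mem_signModuli hn).1 (Finset.mem_coe.1 hb)
    simp only [Function.onFun]
    rw [← Nat.coprime_iff_isRelPrime]
    have h4 : ∀ c, c.Prime → c ≠ 2 → Nat.Coprime c 4 := by
      intro c hc h2
      exact Nat.Coprime.pow_right 2 ((Nat.coprime_primes hc Nat.prime_two).2 h2)
    rcases ha with ⟨pa, a2, -⟩ | ⟨rfl, -⟩ <;> rcases hb with ⟨pb, b2, -⟩ | ⟨rfl, -⟩
    · exact (Nat.coprime_primes pa pb).2 hab
    · exact h4 a pa a2
    · exact (h4 b pb b2).symm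
    · exact absurd rfl hab
  · intro l hl
    rcases (mem_signModuli hn).1 hl with ⟨-, -, h⟩ | ⟨rfl, h⟩ <;> exact h

/-- A product over `S` is least, for a given cardinality, when `S` consists of small elements. -/
lemma pow_card_mul_prod_le {S T : Finset ℕ} {B : ℕ} (hS : ∀ s ∈ S, s ∈ T ∨ B ≤ s)
    (hT : ∀ t ∈ T, t ≤ B) : B ^ S.card * ∏ t ∈ T, t ≤ (∏ s ∈ S, s) * B ^ T.card := by
  have e1 : (∏ s ∈ S ∩ T, s) * ∏ s ∈ S \ T, s = ∏ s ∈ S, s := Finset.prod_inter_mul_prod_sdiff S T _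
  have e2 : (∏ s ∈ T ∩ S, s) * ∏ s ∈ T \ S, s = ∏ s ∈ T, s := Finset.prod_inter_mul_prod_sdiff T S _
  have c1 : (S ∩ T).card + (S \ T).card = S.card := Finset.card_inter_add_card_sdiff S T
  have c2 : (T ∩ S).card + (T \ S).card = T.card := Finset.card_inter_add_card_sdiff T S
  have l1 : B ^ (S \ T).card ≤ ∏ s ∈ S \ T, s := by
    refine Finset.pow_card_le_prod _ _ _ fun s hs => ?_
    rw [Finset.mem_sdiff] at hs
    exact (hS s hs.1).resolve_left hs.2
  have l2 : ∏ s ∈ T \ S, s ≤ B ^ (T \ S).card :=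
    Finset.prod_le_pow_card _ _ _ fun s hs => hT s (Finset.mem_sdiff.1 hs).1
  rw [← e1, ← e2, ← c1, ← c2, Finset.inter_comm T S, pow_add, pow_add]
  calc _ = (B ^ (S ∩ T).card * ∏ s ∈ S ∩ T, s) * (B ^ (S \ T).card * ∏ s ∈ T \ S, s) := by ring
    _ ≤ (B ^ (S ∩ T).card * ∏ s ∈ S ∩ T, s) * ((∏ s ∈ S \ T, s) * B ^ (T \ S).card) := by
        gcongr
    _ = _ := by ring

/-- The possible sign moduli below `B`. -/
def smallModuli (B : ℕ) : Finset ℕ :=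
  (Finset.range B).filter fun s => s = 4 ∨ (s.Prime ∧ s ≠ 2)

lemma mem_smallModuli_or_le {n B l : ℕ} (hn : n ≠ 0) (hl : l ∈ signModuli n) :
    l ∈ smallModuli B ∨ B ≤ l := by
  rcases lt_or_ge l B with h | h
  · left
    rw [smallModuli, Finset.mem_filter, Finset.mem_range]
    rcases (mem_signModuli hn).1 hl with ⟨h1, h2, -⟩ | ⟨h1, -⟩
    · exact ⟨h, Or.inr ⟨h1, h2⟩⟩
    · exact ⟨h, Or.inl h1⟩
  · exact Or.inr h

lemma card_le_of_lt_mul_prod {n B : ℕ} {S T : Finset ℕ} (hn : ∏ s ∈ S, s ≤ n) (hB : 0 < B)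
    (hS : ∀ s ∈ S, s ∈ T ∨ B ≤ s) (hT : ∀ t ∈ T, t ≤ B) (h : n < B * ∏ t ∈ T, t) :
    S.card ≤ T.card := by
  by_contra! hc
  have h1 := pow_card_mul_prod_le hS hT
  have h2 : B ^ (T.card + 1) ≤ B ^ S.card := Nat.pow_le_pow_right hB hc
  have h3 : B ^ T.card * (B * ∏ t ∈ T, t) ≤ B ^ T.card * n := by
    calc _ = B ^ (T.card + 1) * ∏ t ∈ T, t := by ring
      _ ≤ B ^ S.card * ∏ t ∈ T, t := Nat.mul_le_mul_right _ h2
      _ ≤ (∏ s ∈ S, s) * B ^ T.card := h1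
      _ ≤ n * B ^ T.card := Nat.mul_le_mul_right _ hn
      _ = _ := mul_comm _ _
  have := Nat.le_of_mul_le_mul_left h3 (by positivity)
  omega

lemma card_signModuli_le {n B : ℕ} (hn : n ≠ 0) (h : n < B * ∏ t ∈ smallModuli B, t) :
    (signModuli n).card ≤ (smallModuli B).card :=
  card_le_of_lt_mul_prod (prod_signModuli_le hn) (Nat.pos_of_ne_zero (by rintro rfl; simp at h))
    (fun _ => mem_smallModuli_or_le hn)
    (fun t ht => (Finset.mem_range.1 (Finset.mem_filter.1 ht).1).le) h

lemma card_signModuli_le_of_not_three_dvd {n B : ℕ} (hn : n ≠ 0) (h3 : ¬ 3 ∣ n)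
    (h : n < B * ∏ t ∈ (smallModuli B).erase 3, t) :
    (signModuli n).card ≤ ((smallModuli B).erase 3).card :=
  card_le_of_lt_mul_prod (prod_signModuli_le hn) (Nat.pos_of_ne_zero (by rintro rfl; simp at h))
    (fun l hl => by
      rcases mem_smallModuli_or_le (B := B) hn hl with h | h
      · refine Or.inl (Finset.mem_erase.2 ⟨?_, h⟩)
        rintro rfl
        rcases (mem_signModuli hn).1 hl with ⟨-, -, h⟩ | ⟨h, -⟩
        · exact h3 h
        · omega
      · exact Or.inr h)
    (fun t ht => (Finset.mem_range.1 (Finset.mem_filter.1 (Finset.mem_of_mem_erase ht)).1).le) h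

lemma sixteen_pow_card_signModuli_le {n : ℕ} (hn : 9 * 10 ^ 14 ≤ n) :
    16 ^ (signModuli n).card ≤ 8 * n := by
  have h0 : n ≠ 0 := by omega
  rcases le_or_gt (signModuli n).card 12 with h | h
  · have := Nat.pow_le_pow_right (n := 16) (by norm_num) h
    omega
  · obtain ⟨c, hc⟩ := Nat.exists_eq_add_of_lt h
    have h1 := pow_card_mul_prod_le (fun _ => mem_smallModuli_or_le (B := 43) h0)
      (fun t ht => (Finset.mem_range.1 (Finset.mem_filter.1 ht).1).le)
    have hcard : (smallModuli 43).card = 13 := by decide +kernel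
    have hprod : ∏ t ∈ smallModuli 43, t = 608500527054420 := by decide +kernel
    rw [hcard, hprod, hc, show 12 + c + 1 = c + 13 by ring, pow_add] at h1
    have h2 := h1.trans (Nat.mul_le_mul_right _ (prod_signModuli_le h0))
    have h3 : 43 ^ c * 608500527054420 ≤ n := by
      refine Nat.le_of_mul_le_mul_right (a := 43 ^ c * 608500527054420) (c := 43 ^ 13) ?_ (by norm_num)
      calc _ = _ := by ring
        _ ≤ _ := h2
    have h4 : 16 ^ c ≤ 43 ^ c := Nat.pow_le_pow_left (by norm_num) c
    calc 16 ^ (signModuli n).card = 16 ^ c * 16 ^ 13 := by rw [hc, ← pow_add]; congr 1; ring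
      _ ≤ 43 ^ c * (8 * 608500527054420) := Nat.mul_le_mul h4 (by norm_num)
      _ = 8 * (43 ^ c * 608500527054420) := by ring
      _ ≤ 8 * n := Nat.mul_le_mul_left _ h3

/-- `2 ^ f` copies of the bit pattern `a`, at distance `w` from each other. -/
def copies : ℕ → ℕ → ℕ → ℕ
  | 0, _, a => a
  | f + 1, w, a => copies f (2 * w) (a ||| a <<< w)

lemma testBit_copies (f w a i : ℕ) :
    (copies f w a).testBit i ↔ ∃ c < 2 ^ f, c * w ≤ i ∧ a.testBit (i - c * w) := by
  induction f generalizing w a with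
  | zero => simp [copies]
  | succ f ih =>
    rw [copies, ih]
    simp only [Nat.testBit_or, Nat.testBit_shiftLeft, Bool.or_eq_true, Bool.and_eq_true,
      decide_eq_true_eq, pow_succ]
    constructor
    · rintro ⟨c, hc, hi, h | ⟨h1, h⟩⟩
      · refine ⟨2 * c, by omega, ?_, ?_⟩
        · rwa [mul_comm 2 c, mul_assoc]
        · rwa [mul_comm 2 c, mul_assoc]
      · have e : (2 * c + 1) * w = c * (2 * w) + w := by ring
        refine ⟨2 * c + 1, by omega, by omega, ?_⟩
        rwa [e, ← Nat.sub_sub]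
    · rintro ⟨c, hc, hi, h⟩
      obtain ⟨d, rfl | rfl⟩ := Nat.even_or_odd' c
      · have e : 2 * d * w = d * (2 * w) := by ring
        rw [e] at hi h
        exact ⟨d, by omega, hi, Or.inl h⟩
      · have e : (2 * d + 1) * w = d * (2 * w) + w := by ring
        rw [e] at hi h
        refine ⟨d, by omega, by omega, Or.inr ⟨by omega, ?_⟩⟩
        rwa [← Nat.sub_sub] at h

/-- A number whose binary digits below `W` are `1` exactly at the multiples of `w`. -/
def multiplesMask (w W : ℕ) : ℕ := copies (Nat.log2 (W / w) + 1) w 1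

lemma dvd_of_testBit_multiplesMask {w W i : ℕ} (h : (multiplesMask w W).testBit i) : w ∣ i := by
  rw [multiplesMask, testBit_copies] at h
  obtain ⟨c, -, hi, h⟩ := h
  rw [Nat.testBit_one_eq_true_iff_self_eq_zero] at h
  exact ⟨c, by rw [mul_comm]; omega⟩

lemma testBit_multiplesMask {w W i : ℕ} (hw : 0 < w) (hi : i < W) (h : w ∣ i) :
    (multiplesMask w W).testBit i := by
  rw [multiplesMask, testBit_copies]
  obtain ⟨c, rfl⟩ := h
  refine ⟨c, ?_, by rw [mul_comm], by rw [mul_comm, Nat.sub_self]; rfl⟩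
  refine lt_of_le_of_lt ?_ Nat.lt_log2_self
  rw [Nat.le_div_iff_mul_le hw, mul_comm]
  exact hi.le

/-- A list containing all primes below `m`. -/
def roughList (m : ℕ) : List ℕ :=
  (List.range m).filter fun q => Nat.ble 2 q &&
    [2, 3, 5, 7, 11, 13, 17, 19, 23, 29, 31, 37, 41, 43, 47, 53, 59, 61, 67].all
      fun d => Nat.beq q d || !(Nat.beq (q % d) 0)

lemma mem_roughList {m q : ℕ} (hq : q.Prime) (hm : q < m) : q ∈ roughList m := by
  rw [roughList, List.mem_filter, List.mem_range, Bool.and_eq_true, List.all_eq_true]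
  refine ⟨hm, Nat.ble_eq_true_of_le hq.two_le, fun d hd => ?_⟩
  have hd1 : d ≠ 1 := by rintro rfl; simp at hd
  rw [Bool.or_eq_true, Bool.not_eq_true', Nat.beq_eq, ← Bool.not_eq_true, Nat.beq_eq]
  by_contra! hc
  rcases (Nat.dvd_prime hq).1 (Nat.dvd_of_mod_eq_zero hc.2) with h | h
  · exact hd1 h
  · exact hc.1 h.symm

lemma testBit_foldr_or {α : Type*} (l : List α) (g : α → ℕ) (b i : ℕ) :
    (l.foldr (fun q acc => acc ||| g q) b).testBit i ↔
      b.testBit i ∨ ∃ q ∈ l, (g q).testBit i := by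
  induction l with
  | nil => simp
  | cons a l ih =>
    rw [List.foldr_cons, Nat.testBit_or, Bool.or_eq_true, ih]
    simp only [List.mem_cons, exists_eq_or_imp]
    exact or_assoc.trans (or_congr_right or_comm)

/-- The digits `i < W` for which `w` divides `s + i`. -/
def shiftedMultiples (s W w : ℕ) : ℕ :=
  bif Nat.ble W ((w - s % w) % w) then 0 else multiplesMask w W <<< ((w - s % w) % w)

lemma testBit_shiftedMultiples {s W w i : ℕ} (hw : 0 < w) (hi : i < W) (h : w ∣ s + i) :
    (shiftedMultiples s W w).testBit i := by
  have h1 : i % w = (w - s % w) % w := by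
    have hs := Nat.mod_lt s hw
    have hi := Nat.mod_lt i hw
    have h2 : (s % w + i % w) % w = 0 := by rw [← Nat.add_mod]; exact Nat.mod_eq_zero_of_dvd h
    rcases Nat.eq_zero_or_pos (s % w) with h0 | h0
    · rw [h0, zero_add, Nat.mod_mod] at h2
      rw [h0, h2, Nat.sub_zero, Nat.mod_self]
    · rw [Nat.mod_eq_of_lt (a := w - s % w) (by omega)]
      have h3 : s % w + i % w = w := by
        rcases lt_or_ge (s % w + i % w) w with h | h
        · rw [Nat.mod_eq_of_lt h] at h2; omega
        · rw [Nat.mod_eq_sub_mod h, Nat.mod_eq_of_lt (by omega)] at h2; omega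
      omega
  have h3 : (w - s % w) % w ≤ i := h1 ▸ Nat.mod_le i w
  have hb : Nat.ble W ((w - s % w) % w) = false := by
    rw [Bool.eq_false_iff, Ne, Nat.ble_eq]; omega
  rw [shiftedMultiples, hb, cond_false, Nat.testBit_shiftLeft, Bool.and_eq_true]
  refine ⟨by simpa using h3, testBit_multiplesMask hw (by omega) ?_⟩
  rw [← h1]; exact Nat.dvd_sub_mod i

/-- The digits `i < W` for which `s + i` is divisible by the square of a prime below `m`. -/
def squareMask (s W m : ℕ) : ℕ :=
  (roughList m).foldr (fun q acc => acc ||| shiftedMultiples s W (q * q)) 0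

lemma testBit_squareMask {s W m q i : ℕ} (hq : q.Prime) (hm : q < m) (hi : i < W)
    (h : q * q ∣ s + i) : (squareMask s W m).testBit i := by
  rw [squareMask, testBit_foldr_or]
  exact Or.inr ⟨q, mem_roughList hq hm, testBit_shiftedMultiples (Nat.mul_pos hq.pos hq.pos) hi h⟩

/-- The digits `i` of `region` such that `i < p ^ 2` or `i - p ^ 2` is a digit of `mask`, for all
`p` in the list. -/
def allBad (mask : ℕ) (l : List ℕ) (region : ℕ) : ℕ :=
  l.foldr (fun p acc => acc &&& ((mask <<< (p * p)) ||| (2 ^ (p * p) - 1))) region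

lemma testBit_allBad {mask region i : ℕ} {l : List ℕ} :
    (allBad mask l region).testBit i ↔
      region.testBit i ∧ ∀ p ∈ l, p * p ≤ i → mask.testBit (i - p * p) := by
  induction l with
  | nil => simp [allBad]
  | cons a l ih =>
    rw [allBad, List.foldr_cons, Nat.testBit_and, Bool.and_eq_true, ← allBad, ih, Nat.testBit_or,
      Nat.testBit_shiftLeft, Nat.testBit_two_pow_sub_one, Bool.or_eq_true, Bool.and_eq_true]
    simp only [ge_iff_le, decide_eq_true_eq, List.mem_cons, forall_eq_or_imp]
    have : (a * a ≤ i ∧ mask.testBit (i - a * a) = true ∨ i < a * a) ↔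
        (a * a ≤ i → mask.testBit (i - a * a) = true) := by
      rcases lt_or_ge i (a * a) with h | h
      · simp [h, h.not_ge]
      · simp [h, h.not_gt]
    tauto

/-- The digits `t ≤ i < W` with `i % 4 ≠ 1`, for `t` a multiple of `4`. -/
def regionMask (t W : ℕ) : ℕ := (copies (Nat.log2 W) 4 13 <<< t) % 2 ^ W

lemma testBit_regionMask {t W i : ℕ} (ht : t % 4 = 0) (hti : t ≤ i) (hi : i < W)
    (h4 : i % 4 ≠ 1) : (regionMask t W).testBit i := by
  rw [regionMask, Nat.testBit_mod_two_pow, Nat.testBit_shiftLeft]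
  simp only [Bool.and_eq_true, decide_eq_true_eq, testBit_copies]
  refine ⟨hi, hti, (i - t) / 4, ?_, by omega, ?_⟩
  · have : W < 2 ^ (Nat.log2 W + 1) := Nat.lt_log2_self
    rw [pow_succ] at this
    omega
  · have : i - t - (i - t) / 4 * 4 = i % 4 := by omega
    rw [this]
    have := Nat.mod_lt i (show 0 < 4 by norm_num)
    interval_cases i % 4 <;> simp_all <;> decide

/-- All admissible `s + t ≤ n < s + W` are sums of a square-free number and the square of one of
the first eight primes. -/
def segmentOk (s t W : ℕ) : Bool :=
  Nat.beq (allBad (squareMask s W 5001) [2, 3, 5, 7, 11, 13, 17, 19] (regionMask t W)) 0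

lemma exists_of_segmentOk {s t W n : ℕ} (h : segmentOk s t W = true) (hs : s % 4 = 0)
    (ht : t % 4 = 0) (hW : s + W ≤ 25000000) (hn : s + t ≤ n) (hnW : n < s + W) (h4 : n % 4 ≠ 1) :
    ∃ p k : ℕ, p.Prime ∧ Squarefree k ∧ 0 < k ∧ n = p ^ 2 + k := by
  obtain ⟨i, rfl⟩ := Nat.exists_eq_add_of_le (show s ≤ n by omega)
  have h0 := Nat.beq_eq.mp h
  have hbit : ¬ (allBad (squareMask s W 5001) [2, 3, 5, 7, 11, 13, 17, 19]
      (regionMask t W)).testBit i := by rw [h0]; simp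
  rw [testBit_allBad] at hbit
  push Not at hbit
  obtain ⟨p, hp, hpi, hb⟩ := hbit (testBit_regionMask ht (by omega) (by omega) (by omega))
  have hpp : p.Prime := by
    simp only [List.mem_cons, List.not_mem_nil, or_false] at hp
    rcases hp with rfl | rfl | rfl | rfl | rfl | rfl | rfl | rfl <;> norm_num
  have key : ∀ q, q.Prime → q < 5001 → ¬ q * q ∣ s + (i - p * p) := fun q hq hm hd =>
    hb (testBit_squareMask hq hm (by omega) hd)
  have hpos : 0 < s + (i - p * p) := by
    rcases Nat.eq_zero_or_pos (s + (i - p * p)) with h | h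
    · exact absurd (by rw [h]; exact dvd_zero _) (key 2 Nat.prime_two (by norm_num))
    · exact h
  refine ⟨p, s + (i - p * p), hpp, ?_, hpos, by rw [pow_two]; omega⟩
  rw [Nat.squarefree_iff_prime_squarefree]
  intro q hq hd
  refine key q hq ?_ hd
  have := Nat.le_of_dvd hpos hd
  by_contra! hc
  have : 5001 * 5001 ≤ q * q := Nat.mul_le_mul hc hc
  omega

set_option maxRecDepth 100000 in
lemma exists_of_lt {n : ℕ} (hn : 10 ≤ n) (hlt : n < 25000000) (h4 : n % 4 ≠ 1) :
    ∃ p k : ℕ, p.Prime ∧ Squarefree k ∧ 0 < k ∧ n = p ^ 2 + k := by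
  rcases lt_or_ge n 12 with h | h
  · obtain rfl | rfl : n = 10 ∨ n = 11 := by omega
    · exact ⟨2, 6, by norm_num, by decide +kernel, by norm_num, rfl⟩
    · exact ⟨2, 7, by norm_num, by decide +kernel, by norm_num, rfl⟩
  have s0 : segmentOk 0 12 5000000 = true := by decide +kernel
  have s1 : segmentOk 4999600 400 5000400 = true := by decide +kernel
  have s2 : segmentOk 9999600 400 5000400 = true := by decide +kernel
  have s3 : segmentOk 14999600 400 5000400 = true := by decide +kernel
  have s4 : segmentOk 19999600 400 5000400 = true := by decide +kernel
  rcases lt_or_ge n 5000000 with h0 | h0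
  · exact exists_of_segmentOk s0 rfl rfl (by norm_num) (by omega) (by omega) h4
  rcases lt_or_ge n 10000000 with h1 | h1
  · exact exists_of_segmentOk s1 rfl rfl (by norm_num) (by omega) (by omega) h4
  rcases lt_or_ge n 15000000 with h2 | h2
  · exact exists_of_segmentOk s2 rfl rfl (by norm_num) (by omega) (by omega) h4
  rcases lt_or_ge n 20000000 with h3 | h3
  · exact exists_of_segmentOk s3 rfl rfl (by norm_num) (by omega) (by omega) h4
  · exact exists_of_segmentOk s4 rfl rfl (by norm_num) (by omega) (by omega) h4

/-- The number of digits `1` of `x` below `L` at positions congruent to `s` modulo `w`. -/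
def bitCount (x L w s : ℕ) : ℕ := ((Finset.range L).filter fun i => i % w = s ∧ x.testBit i).card

lemma modEq_card_testBit {w : ℕ} (hw : 0 < w) (t y : ℕ)
    (h : ∀ i, y.testBit i → w ∣ i ∧ i < w * t) :
    y ≡ ((Finset.range t).filter fun c => y.testBit (w * c)).card [MOD 2 ^ w - 1] := by
  induction t generalizing y with
  | zero =>
    have : y = 0 := Nat.eq_of_testBit_eq fun i => by
      rw [Nat.zero_testBit, ← Bool.not_eq_true]; intro hi; have := (h i hi).2; simp at this
    simp [this, Nat.ModEq]
  | succ t ih =>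
    have h1 := ih (y / 2 ^ w) (by
      intro i hi
      rw [Nat.testBit_div_two_pow] at hi
      obtain ⟨⟨c, hc⟩, hl⟩ := h _ hi
      rw [mul_add, mul_one] at hl
      exact ⟨⟨c - 1, by rw [Nat.mul_sub, mul_one]; omega⟩, by omega⟩)
    have h2 : y % 2 ^ w = (y.testBit 0).toNat := by
      apply Nat.eq_of_testBit_eq
      intro i
      rw [Nat.testBit_mod_two_pow]
      rcases Nat.eq_zero_or_pos i with rfl | hi
      · cases y.testBit 0 <;> simp [hw]
      · have e : (y.testBit 0).toNat.testBit i = false := by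
          cases y.testBit 0
          · simp
          · rw [← Bool.not_eq_true, Bool.toNat_true, Nat.testBit_one_eq_true_iff_self_eq_zero]
            omega
        rw [e, Bool.and_eq_false_iff, decide_eq_false_iff_not]
        by_cases hiw : i < w
        · right
          rw [← Bool.not_eq_true]
          intro hb
          have := Nat.le_of_dvd hi (h i hb).1
          omega
        · exact Or.inl hiw
    have h3 : ((Finset.range (t + 1)).filter fun c => y.testBit (w * c)).card =
        (y.testBit 0).toNat +
          ((Finset.range t).filter fun c => (y / 2 ^ w).testBit (w * c)).card := by
      rw [Finset.card_filter, Finset.card_filter, Finset.sum_range_succ', add_comm]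
      congr 1
      · simp only [mul_zero]; cases y.testBit 0 <;> rfl
      · refine Finset.sum_congr rfl fun c _ => ?_
        rw [Nat.testBit_div_two_pow, mul_add, mul_one]
    have h4 : y ≡ y % 2 ^ w + y / 2 ^ w [MOD 2 ^ w - 1] := by
      conv_lhs => rw [← Nat.mod_add_div y (2 ^ w)]
      refine Nat.ModEq.add_left _ ?_
      have h5 : 2 ^ w ≡ 1 [MOD 2 ^ w - 1] := by
        have : 1 ≤ 2 ^ w := Nat.one_le_two_pow
        exact ((Nat.modEq_iff_dvd' this).2 dvd_rfl).symm
      simpa using h5.mul_right (y / 2 ^ w)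
    rw [h3, ← h2]
    exact h4.trans (h1.add_left _)

/-- Efficient computation of `bitCount`. -/
def classCount (x L w s : ℕ) : ℕ := ((x >>> s) &&& multiplesMask w L) % (2 ^ w - 1)

lemma classCount_eq {x L w s : ℕ} (hx : x < 2 ^ L) (hw : 0 < w) (hs : s < w)
    (hL : L < 2 ^ w - 1) : classCount x L w s = bitCount x L w s := by
  have hbit : ∀ i, L ≤ i → x.testBit i = false := fun i hi =>
    Nat.testBit_eq_false_of_lt (hx.trans_le (Nat.pow_le_pow_right (by norm_num) hi))
  set y := (x >>> s) &&& multiplesMask w L with hy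
  have hyb : ∀ i, y.testBit i ↔ x.testBit (s + i) ∧ (multiplesMask w L).testBit i := by
    intro i; rw [hy, Nat.testBit_and, Nat.testBit_shiftRight, Bool.and_eq_true]
  have key := modEq_card_testBit hw L y (by
    intro i hi
    rw [hyb] at hi
    refine ⟨dvd_of_testBit_multiplesMask hi.2, ?_⟩
    by_contra! hc
    have : L ≤ s + i := by nlinarith
    rw [hbit _ this] at hi
    simp at hi)
  have hcard : ((Finset.range L).filter fun c => y.testBit (w * c)).card = bitCount x L w s := by
    apply Finset.card_nbij' (fun c => s + w * c) (fun i => i / w)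
    · intro c hc
      simp only [Finset.coe_filter, Finset.mem_range, Set.mem_ofPred_eq, hyb] at hc ⊢
      refine ⟨?_, ?_, hc.2.1⟩
      · by_contra! h
        rw [hbit _ h] at hc
        simp at hc
      · rw [Nat.add_mul_mod_self_left, Nat.mod_eq_of_lt hs]
    · intro i hi
      simp only [Finset.coe_filter, Finset.mem_range, Set.mem_ofPred_eq, hyb] at hi ⊢
      have e := Nat.mod_add_div i w
      rw [hi.2.1] at e
      refine ⟨(Nat.div_le_self _ _).trans_lt hi.1, by rw [e]; exact hi.2.2, ?_⟩
      exact testBit_multiplesMask hw (by omega) (dvd_mul_right _ _)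
    · intro c _
      simp only
      rw [Nat.add_mul_div_left _ _ hw, Nat.div_eq_of_lt hs, zero_add]
    · intro i hi
      simp only [Finset.coe_filter, Finset.mem_range, Set.mem_ofPred_eq] at hi ⊢
      rw [← hi.2.1]; exact Nat.mod_add_div i w
  rw [hcard] at key
  have hle : bitCount x L w s ≤ L := by
    rw [← hcard]
    exact (Finset.card_filter_le _ _).trans (Finset.card_range L).le
  unfold classCount
  rw [← hy, key, Nat.mod_eq_of_lt (by omega)]

lemma sum_bitCount (x L : ℕ) {w : ℕ} (hw : 0 < w) :
    ∑ s ∈ Finset.range w, bitCount x L w s =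
      ((Finset.range L).filter fun i => x.testBit i).card := by
  rw [Finset.card_eq_sum_card_fiberwise (f := fun i => i % w) (t := Finset.range w)]
  · refine Finset.sum_congr rfl fun s _ => ?_
    rw [bitCount, Finset.filter_filter]
    simp only [and_comm]
  · intro i _
    simpa using Nat.mod_lt i hw

/-- The number of digits `1` of `x`, computed through the classes modulo `25`. -/
def popCount (x L : ℕ) : ℕ := ((List.range 25).map fun s => classCount x L 25 s).sum

lemma popCount_eq {x L : ℕ} (hx : x < 2 ^ L) (hL : L < 2 ^ 25 - 1) :
    popCount x L = ((Finset.range L).filter fun i => x.testBit i).card := by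
  rw [← sum_bitCount x L (w := 25) (by norm_num), popCount, Finset.sum_range,
    ← List.sum_ofFn, List.ofFn_eq_map]
  congr 1
  rw [← List.map_coe_finRange_eq_range, List.map_map]
  exact List.map_congr_left fun s _ => classCount_eq hx (by norm_num) s.2 hL

/-- An upper bound for the number of digits `1` in a pair of opposite classes modulo `w`. -/
def pairMax (x L w : ℕ) : ℕ :=
  (List.range ((w + 1) / 2)).foldr
    (fun s acc => max (classCount x L w s + classCount x L w (w - 1 - s)) acc) 0

lemma le_foldr_max {α : Type*} (l : List α) (g : α → ℕ) {a : α} (ha : a ∈ l) :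
    g a ≤ l.foldr (fun s acc => max (g s) acc) 0 := by
  induction l with
  | nil => simp at ha
  | cons b l ih =>
    rw [List.foldr_cons]
    rcases List.mem_cons.1 ha with rfl | h
    · exact le_max_left _ _
    · exact (ih h).trans (le_max_right _ _)

lemma bitCount_add_le_pairMax {x L w s : ℕ} (hx : x < 2 ^ L) (hs : s < w) (hL : L < 2 ^ w - 1) :
    bitCount x L w s + bitCount x L w (w - 1 - s) ≤ pairMax x L w := by
  wlog hsw : s < (w + 1) / 2 generalizing s
  · have := this (s := w - 1 - s) (by omega) (by omega)
    rw [show w - 1 - (w - 1 - s) = s by omega] at this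
    omega
  rw [← classCount_eq hx (by omega) hs hL, ← classCount_eq hx (by omega) (by omega) hL]
  exact le_foldr_max _ (fun s => classCount x L w s + classCount x L w (w - 1 - s))
    (List.mem_range.2 hsw)

/-- The analogue of `pairMax` for the classes modulo `9`. -/
def pairMaxNine (x L : ℕ) : ℕ :=
  (List.range 5).foldr (fun s acc => max
    (classCount x L 27 s + classCount x L 27 (s + 9) + classCount x L 27 (s + 18) +
      (classCount x L 27 (8 - s) + classCount x L 27 (17 - s) + classCount x L 27 (26 - s))) acc) 0

lemma bitCount_nine (x L : ℕ) {s : ℕ} (hs : s < 9) :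
    bitCount x L 9 s ≤ bitCount x L 27 s + bitCount x L 27 (s + 9) + bitCount x L 27 (s + 18) := by
  unfold bitCount
  refine le_trans (Finset.card_le_card ?_) ((Finset.card_union_le _ _).trans
    (Nat.add_le_add_right (Finset.card_union_le _ _) _))
  intro i hi
  simp only [Finset.mem_union, Finset.mem_filter, Finset.mem_range] at hi ⊢
  have : i % 27 = s ∨ i % 27 = s + 9 ∨ i % 27 = s + 18 := by omega
  tauto

lemma bitCount_add_le_pairMaxNine {x L s : ℕ} (hx : x < 2 ^ L) (hs : s < 9) (hL : L < 2 ^ 27 - 1) :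
    bitCount x L 9 s + bitCount x L 9 (8 - s) ≤ pairMaxNine x L := by
  wlog hsw : s < 5 generalizing s
  · have := this (s := 8 - s) (by omega) (by omega)
    rw [show 8 - (8 - s) = s by omega] at this
    omega
  have h1 := bitCount_nine x L hs
  have h2 := bitCount_nine x L (s := 8 - s) (by omega)
  rw [show 8 - s + 9 = 17 - s by omega, show 8 - s + 18 = 26 - s by omega] at h2
  refine (add_le_add h1 h2).trans ?_
  have hc : ∀ r < 27, bitCount x L 27 r = classCount x L 27 r := fun r hr =>
    (classCount_eq hx (by norm_num) hr hL).symm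
  rw [hc _ (by omega), hc _ (by omega), hc _ (by omega), hc _ (by omega), hc _ (by omega),
    hc _ (by omega)]
  exact le_foldr_max _ (fun s =>
    classCount x L 27 s + classCount x L 27 (s + 9) + classCount x L 27 (s + 18) +
      (classCount x L 27 (8 - s) + classCount x L 27 (17 - s) + classCount x L 27 (26 - s)))
    (List.mem_range.2 hsw)

/-- The digits `i` for which `2 * i + 1` is `1`, `3` or a proper multiple of an odd `l < m`. -/
def compositeMask (W m : ℕ) : ℕ :=
  ((roughList m).filter (Nat.ble 3)).foldr
    (fun l acc => acc ||| (multiplesMask l W <<< (l * l / 2))) 3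

/-- The digits `i < W` for which `2 * i + 1` is a prime greater than `3`. -/
def primeMask (W m : ℕ) : ℕ := (2 ^ W - 1) ^^^ (compositeMask W m % 2 ^ W)

lemma odd_of_mem_roughList {m l : ℕ} (h : l ∈ roughList m) (h3 : 3 ≤ l) : l % 2 = 1 := by
  rw [roughList, List.mem_filter, Bool.and_eq_true, List.all_eq_true] at h
  have := h.2.2 2 (by simp)
  rw [Bool.or_eq_true, Bool.not_eq_true', Nat.beq_eq, ← Bool.not_eq_true, Nat.beq_eq] at this
  omega

lemma testBit_compositeMask {W m i : ℕ} (hW : 2 * W < m * m) (hi : i < W) :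
    (compositeMask W m).testBit i ↔ ¬ ((2 * i + 1).Prime ∧ 5 ≤ 2 * i + 1) := by
  rw [compositeMask, testBit_foldr_or]
  constructor
  · rintro (h | ⟨l, hl, h⟩) ⟨hp, h5⟩
    · have h3 : (3 : ℕ).testBit i = false :=
        Nat.testBit_eq_false_of_lt (lt_of_lt_of_le (show 3 < 2 ^ 2 by norm_num)
          (Nat.pow_le_pow_right (by norm_num) (by omega)))
      rw [h3] at h; simp at h
    · rw [List.mem_filter] at hl
      have h3 := Nat.le_of_ble_eq_true hl.2
      have hodd := odd_of_mem_roughList hl.1 h3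
      rw [Nat.testBit_shiftLeft, Bool.and_eq_true, decide_eq_true_eq] at h
      obtain ⟨c, hc⟩ := dvd_of_testBit_multiplesMask h.2
      have hll : l * l % 2 = 1 := by rw [Nat.mul_mod, hodd]
      have e : 2 * i + 1 = l * (l + 2 * c) := by
        rw [mul_add, ← mul_assoc, mul_comm l 2, mul_assoc]; omega
      rw [e] at hp
      rcases Nat.prime_mul_iff.1 hp with ⟨-, h⟩ | ⟨-, h⟩ <;> omega
  · intro h
    by_cases h5 : 5 ≤ 2 * i + 1
    · right
      have hnp : ¬ (2 * i + 1).Prime := fun hp => h ⟨hp, h5⟩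
      set l := (2 * i + 1).minFac with hl
      have hlp : l.Prime := Nat.minFac_prime (by omega)
      have hsq : l ^ 2 ≤ 2 * i + 1 := Nat.minFac_sq_le_self (by omega) hnp
      obtain ⟨d, hd⟩ := Nat.minFac_dvd (2 * i + 1)
      rw [← hl] at hd
      have hlodd : l % 2 = 1 := by
        rcases Nat.mod_two_eq_zero_or_one l with h | h
        · have : (2 * i + 1) % 2 = 0 := by rw [hd, Nat.mul_mod, h]; simp
          omega
        · exact h
      have hdodd : d % 2 = 1 := by
        rcases Nat.mod_two_eq_zero_or_one d with h | h
        · have : (2 * i + 1) % 2 = 0 := by rw [hd, Nat.mul_mod, h]; simp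
          omega
        · exact h
      have hl3 : 3 ≤ l := by have := hlp.two_le; omega
      have hlm : l < m := by
        by_contra! hc
        have : m * m ≤ l * l := Nat.mul_le_mul hc hc
        rw [pow_two] at hsq
        omega
      have hld : l ≤ d := by
        by_contra! hc
        have : l * d < l * l := Nat.mul_lt_mul_of_pos_left hc (by omega)
        rw [pow_two] at hsq
        omega
      obtain ⟨c, rfl⟩ : ∃ c, d = l + 2 * c := ⟨(d - l) / 2, by omega⟩
      have hll : l * l % 2 = 1 := by rw [Nat.mul_mod, hlodd]
      have e : i = l * l / 2 + l * c := by
        have e1 : l * (l + 2 * c) = l * l + 2 * (l * c) := by ring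
        omega
      refine ⟨l, List.mem_filter.2 ⟨mem_roughList hlp hlm, Nat.ble_eq_true_of_le hl3⟩, ?_⟩
      rw [Nat.testBit_shiftLeft, Bool.and_eq_true, decide_eq_true_eq]
      refine ⟨by omega, testBit_multiplesMask (by omega) (by omega) ⟨c, by omega⟩⟩
    · left
      have : i < 2 := by omega
      interval_cases i <;> rfl

lemma testBit_primeMask {W m i : ℕ} (hW : 2 * W < m * m) (hi : i < W) :
    (primeMask W m).testBit i ↔ (2 * i + 1).Prime ∧ 5 ≤ 2 * i + 1 := by
  rw [primeMask, Nat.testBit_xor, Nat.testBit_two_pow_sub_one, Nat.testBit_mod_two_pow,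
    ← not_iff_not, ← testBit_compositeMask hW hi]
  simp [hi]

/-- The primes `5 ≤ p ≤ P`, as digits of a number. -/
def primesUpTo (W m P : ℕ) : ℕ := primeMask W m % 2 ^ ((P + 1) / 2)

lemma testBit_primesUpTo {W m P i : ℕ} (hW : 2 * W < m * m) (hP : P < 2 * W) :
    (primesUpTo W m P).testBit i ↔ (2 * i + 1).Prime ∧ 5 ≤ 2 * i + 1 ∧ 2 * i + 1 ≤ P := by
  rw [primesUpTo, Nat.testBit_mod_two_pow, Bool.and_eq_true, decide_eq_true_eq]
  constructor
  · rintro ⟨h1, h2⟩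
    rw [testBit_primeMask hW (by omega)] at h2
    exact ⟨h2.1, h2.2, by omega⟩
  · rintro ⟨h1, h2, h3⟩
    exact ⟨by omega, (testBit_primeMask hW (by omega)).2 ⟨h1, h2⟩⟩

lemma primesUpTo_lt (W m P : ℕ) : primesUpTo W m P < 2 ^ ((P + 1) / 2) :=
  Nat.mod_lt _ (by positivity)

lemma card_primes_eq {W m P : ℕ} (hW : 2 * W < m * m) (hP : P < 2 * W) (hL : W < 2 ^ 25 - 1) :
    ((Finset.Icc 5 P).filter Nat.Prime).card = popCount (primesUpTo W m P) ((P + 1) / 2) := by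
  rw [popCount_eq (primesUpTo_lt W m P) (by omega)]
  refine Finset.card_nbij' (fun p => p / 2) (fun i => 2 * i + 1) ?_ ?_ ?_ ?_
  · intro p hp
    simp only [Finset.coe_filter, Finset.mem_Icc, Finset.mem_range, Set.mem_ofPred_eq,
      testBit_primesUpTo hW hP] at hp ⊢
    have hodd := hp.2.eq_two_or_odd
    have e : 2 * (p / 2) + 1 = p := by omega
    rw [e]
    exact ⟨by omega, hp.2, hp.1⟩
  · intro i hi
    simp only [Finset.coe_filter, Finset.mem_Icc, Finset.mem_range, Set.mem_ofPred_eq,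
      testBit_primesUpTo hW hP] at hi ⊢
    exact ⟨hi.2.2, hi.2.1⟩
  · intro p hp
    simp only [Finset.coe_filter, Finset.mem_Icc, Set.mem_ofPred_eq] at hp ⊢
    have hodd := hp.2.eq_two_or_odd
    omega
  · intro i _
    simp only
    omega

lemma card_badPrimes_le_of_bitCount {W m n P q b : ℕ} (hW : 2 * W < m * m) (hPW : P < 2 * W)
    (hP : P ^ 2 < n) (hq : q.Prime) (hq3 : 3 ≤ q) (hqn : ¬ q ∣ n)
    (hb : ∀ s < q ^ 2, bitCount (primesUpTo W m P) ((P + 1) / 2) (q ^ 2) s +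
      bitCount (primesUpTo W m P) ((P + 1) / 2) (q ^ 2) (q ^ 2 - 1 - s) ≤ b) :
    (badPrimes n P q).card ≤ b := by
  have hpos : 0 < q ^ 2 := by positivity
  have hw2 : q ^ 2 % 2 = 1 := by
    have := hq.eq_two_or_odd
    rw [Nat.pow_mod, this.resolve_left (by omega)]
  rcases (badPrimes n P q).eq_empty_or_nonempty with h0 | ⟨p', hp'⟩
  · rw [h0]; simp
  refine le_trans ?_ (hb (p' / 2 % q ^ 2) (Nat.mod_lt _ hpos))
  unfold bitCount
  refine le_trans ?_ (Finset.card_union_le _ _)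
  refine Finset.card_le_card_of_injOn (fun p => p / 2) ?_ ?_
  · intro p hp
    have hp := Finset.mem_coe.1 hp
    have hc := badPrimes_congr hP hq hq3 hqn hp hp'
    simp only [badPrimes, Finset.mem_filter, Finset.mem_Icc] at hp hp'
    have o := hp.2.1.eq_two_or_odd
    have o' := hp'.2.1.eq_two_or_odd
    have e : 2 * (p / 2) + 1 = p := by omega
    have e' : 2 * (p' / 2) + 1 = p' := by omega
    simp only [Finset.mem_union, Finset.mem_filter, Finset.mem_range,
      testBit_primesUpTo hW hPW, Finset.mem_coe]
    rw [e]
    have hlt : p / 2 < (P + 1) / 2 := by omega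
    refine Or.imp (fun h => ⟨hlt, h, hp.2.1, hp.1⟩) (fun h => ⟨hlt, h, hp.2.1, hp.1⟩) ?_
    set i := p / 2
    set i' := p' / 2
    have hco : Nat.Coprime (q ^ 2) 2 := (Nat.coprime_two_right).2 (Nat.odd_iff.2 hw2)
    rcases hc with h | h
    · left
      rw [← e, ← e'] at h
      exact Nat.ModEq.cancel_left_of_coprime hco (Nat.ModEq.add_right_cancel' 1 h)
    · right
      rw [← e, ← e', show 2 * i + 1 + (2 * i' + 1) = 2 * (i + i' + 1) by ring] at h
      have h1 := hco.dvd_of_dvd_mul_left h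
      generalize q ^ 2 = w at *
      have h2 := Nat.mod_lt i' hpos
      have h3 := Nat.mod_lt i hpos
      have h4 : w ∣ i % w + i' % w + 1 := by
        have e2 : i + i' + 1 = (i % w + i' % w + 1) + w * (i / w + i' / w) := by
          have a1 := Nat.mod_add_div i w
          have a2 := Nat.mod_add_div i' w
          rw [mul_add]; omega
        rw [e2] at h1
        exact (Nat.dvd_add_left (dvd_mul_right _ _)).1 h1
      obtain ⟨t, ht⟩ := h4
      have ht2 : t < 2 := by
        by_contra! h'
        have : w * 2 ≤ w * t := Nat.mul_le_mul_left _ h'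
        omega
      interval_cases t <;> omega
  · intro a ha b hb hab
    have ha := Finset.mem_coe.1 ha
    have hb := Finset.mem_coe.1 hb
    simp only [badPrimes, Finset.mem_filter, Finset.mem_Icc] at ha hb
    have oa := ha.2.1.eq_two_or_odd
    have ob := hb.2.1.eq_two_or_odd
    dsimp only at hab
    omega

/-- A bound for the sum of `P / q ^ 2` over the primes `q ≥ 19`. -/
def tailSum (m P : ℕ) : ℕ :=
  (((roughList m).filter (Nat.ble 19)).map fun q => P / q ^ 2).sum

lemma sum_le_tailSum {m P Q : ℕ} (hP : P < m * m) :
    ∑ q ∈ (Finset.Icc 19 Q).filter Nat.Prime, P / q ^ 2 ≤ tailSum m P := by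
  have hnd : ((roughList m).filter (Nat.ble 19)).Nodup :=
    (List.nodup_range.filter _).filter _
  rw [tailSum, ← List.sum_toFinset _ hnd, ← Finset.sum_filter_ne_zero]
  refine Finset.sum_le_sum_of_subset fun q hq => ?_
  simp only [Finset.mem_filter, Finset.mem_Icc, List.mem_toFinset, List.mem_filter] at hq ⊢
  obtain ⟨⟨⟨h1, -⟩, h3⟩, h4⟩ := hq
  refine ⟨mem_roughList h3 ?_, Nat.ble_eq_true_of_le h1⟩
  by_contra! hc
  have : m * m ≤ q * q := Nat.mul_le_mul hc hc
  exact h4 (Nat.div_eq_of_lt (by rw [pow_two]; omega))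

/-- A bound for the number of bad primes for the primes `5 ≤ q ≤ Q`. -/
def lossBound (W m P Q : ℕ) : ℕ :=
  pairMax (primesUpTo W m P) ((P + 1) / 2) 25 + pairMax (primesUpTo W m P) ((P + 1) / 2) 49 +
  pairMax (primesUpTo W m P) ((P + 1) / 2) 121 + pairMax (primesUpTo W m P) ((P + 1) / 2) 169 +
  pairMax (primesUpTo W m P) ((P + 1) / 2) 289 +
  (popCount (primesUpTo W m Q) ((Q + 1) / 2) - 5 + tailSum m P)

lemma card_primes_nineteen_le {Q : ℕ} (hQ : 17 ≤ Q) :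
    ((Finset.Icc 19 Q).filter Nat.Prime).card ≤ ((Finset.Icc 5 Q).filter Nat.Prime).card - 5 := by
  have hd : Disjoint ({5, 7, 11, 13, 17} : Finset ℕ) ((Finset.Icc 19 Q).filter Nat.Prime) := by
    rw [Finset.disjoint_left]
    intro a ha hb
    simp only [Finset.mem_filter, Finset.mem_Icc] at hb
    simp only [Finset.mem_insert, Finset.mem_singleton] at ha
    omega
  have hs : ({5, 7, 11, 13, 17} : Finset ℕ) ∪ (Finset.Icc 19 Q).filter Nat.Prime ⊆
      (Finset.Icc 5 Q).filter Nat.Prime := by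
    intro a ha
    simp only [Finset.mem_union, Finset.mem_insert, Finset.mem_singleton, Finset.mem_filter,
      Finset.mem_Icc] at ha ⊢
    rcases ha with (rfl | rfl | rfl | rfl | rfl) | ⟨h1, h2⟩
    · exact ⟨by omega, by norm_num⟩
    · exact ⟨by omega, by norm_num⟩
    · exact ⟨by omega, by norm_num⟩
    · exact ⟨by omega, by norm_num⟩
    · exact ⟨by omega, by norm_num⟩
    · exact ⟨by omega, h2⟩
  have := Finset.card_le_card hs
  rw [Finset.card_union_of_disjoint hd, show ({5, 7, 11, 13, 17} : Finset ℕ).card = 5 from rfl]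
    at this
  omega

lemma card_badPrimes_le_pairMax {W m n P q : ℕ} (hW : 2 * W < m * m) (hPW : P < 2 * W)
    (hL : W < 2 ^ 25 - 1) (hP : P ^ 2 < n) (hq : q.Prime) (hq5 : 5 ≤ q) (hqn : ¬ q ∣ n) :
    (badPrimes n P q).card ≤ pairMax (primesUpTo W m P) ((P + 1) / 2) (q ^ 2) := by
  refine card_badPrimes_le_of_bitCount hW hPW hP hq (by omega) hqn fun s hs => ?_
  refine bitCount_add_le_pairMax (primesUpTo_lt W m P) hs ?_
  have : 2 ^ 25 ≤ 2 ^ q ^ 2 := Nat.pow_le_pow_right (by norm_num) (by nlinarith)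
  omega

lemma card_badPrimes_three_le {W m n P : ℕ} (hW : 2 * W < m * m) (hPW : P < 2 * W)
    (hL : W < 2 ^ 25 - 1) (hP : P ^ 2 < n) (hn : ¬ 3 ∣ n) : (badPrimes n P 3).card ≤
      if n % 3 = 1 then pairMaxNine (primesUpTo W m P) ((P + 1) / 2) else 0 := by
  split_ifs with h
  · refine card_badPrimes_le_of_bitCount hW hPW hP Nat.prime_three le_rfl hn fun s hs => ?_
    exact bitCount_add_le_pairMaxNine (primesUpTo_lt W m P) hs (by omega)
  · rw [badPrimes_three_eq_empty hP h hn]; simp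

lemma sum_card_badPrimes_le {W m n P Q : ℕ} (hW : 2 * W < m * m) (hPW : P < 2 * W)
    (hQW : Q < 2 * W) (hQ : 17 ≤ Q) (hL : W < 2 ^ 25 - 1) (hP : P ^ 2 < n) :
    ∑ q ∈ (Finset.Icc 3 Q).filter (fun q => q.Prime ∧ ¬ q ∣ n), (badPrimes n P q).card ≤
      (if n % 3 = 1 then pairMaxNine (primesUpTo W m P) ((P + 1) / 2) else 0) +
        lossBound W m P Q := by
  set g : ℕ → ℕ := fun q => if q ∣ n then 0 else (badPrimes n P q).card with hg
  have hsub : (Finset.Icc 3 Q).filter (fun q => q.Prime ∧ ¬ q ∣ n) ⊆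
      ({3, 5, 7, 11, 13, 17} : Finset ℕ) ∪ (Finset.Icc 19 Q).filter Nat.Prime := by
    intro q hq
    simp only [Finset.mem_union, Finset.mem_insert, Finset.mem_singleton, Finset.mem_filter,
      Finset.mem_Icc] at hq ⊢
    rcases lt_or_ge q 19 with h | h
    · left
      have h3 := hq.1.1
      have hp := hq.2.1
      interval_cases q <;> first | omega | (exfalso; revert hp; norm_num)
    · exact Or.inr ⟨⟨h, hq.1.2⟩, hq.2.1⟩
  have hd : Disjoint ({3, 5, 7, 11, 13, 17} : Finset ℕ) ((Finset.Icc 19 Q).filter Nat.Prime) := by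
    rw [Finset.disjoint_left]
    intro a ha hb
    simp only [Finset.mem_filter, Finset.mem_Icc] at hb
    simp only [Finset.mem_insert, Finset.mem_singleton] at ha
    omega
  have hex : ∀ q, q.Prime → 5 ≤ q →
      g q ≤ pairMax (primesUpTo W m P) ((P + 1) / 2) (q ^ 2) := by
    intro q hq h5
    simp only [hg]
    split_ifs with h
    · exact Nat.zero_le _
    · exact card_badPrimes_le_pairMax hW hPW hL hP hq h5 h
  have h3 : g 3 ≤ if n % 3 = 1 then pairMaxNine (primesUpTo W m P) ((P + 1) / 2) else 0 := by
    simp only [hg]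
    split_ifs with h h' h'
    · exact Nat.zero_le _
    · exact le_rfl
    · simpa [h'] using card_badPrimes_three_le hW hPW hL hP h
    · simpa [h'] using card_badPrimes_three_le hW hPW hL hP h
  have htail : ∑ q ∈ (Finset.Icc 19 Q).filter Nat.Prime, g q ≤
      popCount (primesUpTo W m Q) ((Q + 1) / 2) - 5 + tailSum m P := by
    calc _ ≤ ∑ q ∈ (Finset.Icc 19 Q).filter Nat.Prime, (P / q ^ 2 + 1) := by
          refine Finset.sum_le_sum fun q hq => ?_
          simp only [Finset.mem_filter, Finset.mem_Icc] at hq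
          simp only [hg]
          split_ifs with h
          · exact Nat.zero_le _
          · exact card_badPrimes_le hP hq.2 (by omega) h
      _ = ((Finset.Icc 19 Q).filter Nat.Prime).card +
          ∑ q ∈ (Finset.Icc 19 Q).filter Nat.Prime, P / q ^ 2 := by
          rw [Finset.sum_add_distrib, Finset.sum_const, smul_eq_mul, mul_one, add_comm]
      _ ≤ _ := by
          refine add_le_add ?_ (sum_le_tailSum (by omega))
          rw [← card_primes_eq hW hQW hL]
          exact card_primes_nineteen_le hQ
  calc _ = ∑ q ∈ (Finset.Icc 3 Q).filter (fun q => q.Prime ∧ ¬ q ∣ n), g q := by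
        refine Finset.sum_congr rfl fun q hq => ?_
        simp only [Finset.mem_filter] at hq
        simp [hg, hq.2.2]
    _ ≤ ∑ q ∈ ({3, 5, 7, 11, 13, 17} : Finset ℕ) ∪ (Finset.Icc 19 Q).filter Nat.Prime, g q :=
        Finset.sum_le_sum_of_subset hsub
    _ = ∑ q ∈ ({3, 5, 7, 11, 13, 17} : Finset ℕ), g q +
        ∑ q ∈ (Finset.Icc 19 Q).filter Nat.Prime, g q := Finset.sum_union hd
    _ ≤ _ := by
        have e5 := hex 5 (by norm_num) (by norm_num)
        have e7 := hex 7 (by norm_num) (by norm_num)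
        have e11 := hex 11 (by norm_num) (by norm_num)
        have e13 := hex 13 (by norm_num) (by norm_num)
        have e17 := hex 17 (by norm_num) (by norm_num)
        norm_num only at e5 e7 e11 e13 e17
        rw [Finset.sum_insert (by decide), Finset.sum_insert (by decide),
          Finset.sum_insert (by decide), Finset.sum_insert (by decide),
          Finset.sum_insert (by decide), Finset.sum_singleton, lossBound]
        omega

/-- Numerical conditions under which no `P ^ 2 < n ≤ N ^ 2` is exceptional. -/
def rowOk (W m P N j Q B₁ B₀ : ℕ) : Prop :=
  N ^ 2 < B₁ * (∏ t ∈ (smallModuli B₁).erase 3, t) ∧ N ^ 2 < B₀ * (∏ t ∈ smallModuli B₀, t) ∧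
  N ^ 2 ≤ 24 * j * (Q + 1) ^ 2 ∧ P < 2 * W ∧ Q < 2 * W ∧ 17 ≤ Q ∧
  2 * (((smallModuli B₁).erase 3).card + (pairMaxNine (primesUpTo W m P) ((P + 1) / 2) +
    lossBound W m P Q)) + j * 2 ^ ((smallModuli B₁).erase 3).card <
      2 * popCount (primesUpTo W m P) ((P + 1) / 2) ∧
  2 * ((smallModuli B₀).card + lossBound W m P Q) + (j + 1) * 2 ^ (smallModuli B₀).card <
      2 * popCount (primesUpTo W m P) ((P + 1) / 2)

instance (W m P N j Q B₁ B₀ : ℕ) : Decidable (rowOk W m P N j Q B₁ B₀) := by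
  unfold rowOk; infer_instance

lemma exists_of_rowOk {W m P N j Q B₁ B₀ n : ℕ} (hW : 2 * W < m * m) (hL : W < 2 ^ 25 - 1)
    (hr : rowOk W m P N j Q B₁ B₀) (hP : P ^ 2 < n) (hN : n ≤ N ^ 2) (h4 : n % 4 ≠ 1) :
    ∃ p, p.Prime ∧ p ^ 2 < n ∧ Squarefree (n - p ^ 2) := by
  by_contra! hns
  obtain ⟨r1, r2, r3, r4, r5, r6, r7, r8⟩ := hr
  have hn : n ≠ 0 := by omega
  have key := two_mul_card_primes_le h4 hP (by omega : 3 ≤ Q) (hN.trans r3) hns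
  have hs := sum_card_badPrimes_le hW r4 r5 r6 hL hP
  rw [card_primes_eq hW r4 hL] at key
  by_cases h3 : n % 3 = 1
  · simp only [if_pos h3, add_zero] at key hs
    have hk := card_signModuli_le_of_not_three_dvd hn (by omega) (lt_of_le_of_lt hN r1)
    have := Nat.mul_le_mul_left j (Nat.pow_le_pow_right (n := 2) (by norm_num) hk)
    omega
  · simp only [if_neg h3, zero_add] at key hs
    have hk := card_signModuli_le hn (lt_of_le_of_lt hN r2)
    have := Nat.mul_le_mul_left (j + 1) (Nat.pow_le_pow_right (n := 2) (by norm_num) hk)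
    omega

set_option maxRecDepth 100000 in
lemma rowOk_small :
    rowOk 200000 633 4999 5628 1 1149 23 23 ∧
    rowOk 200000 633 5628 6460 1 1319 23 23 ∧
    rowOk 200000 633 6460 8049 2 1162 23 23 ∧
    rowOk 200000 633 8049 11043 2 1594 23 23 ∧
    rowOk 200000 633 11043 12390 1 2530 29 23 ∧
    rowOk 200000 633 12390 14273 1 2914 29 23 ∧
    rowOk 200000 633 14273 16927 1 3456 29 23 ∧
    rowOk 200000 633 16927 22275 2 3216 29 29 ∧
    rowOk 200000 633 22275 33323 2 4810 29 29 ∧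
    rowOk 200000 633 33323 59048 3 6959 29 29 ∧
    rowOk 200000 633 59048 92705 3 10926 31 29 ∧
    rowOk 200000 633 92705 177251 4 18091 31 31 ∧
    rowOk 200000 633 177251 365491 3 43074 31 31 ∧
    rowOk 200000 633 365491 866213 6 72185 37 37 := by
  decide +kernel

set_option maxRecDepth 100000 in
lemma rowOk_large :
    rowOk 4000000 2829 866213 2222702 5 202905 37 37 ∧
    rowOk 4000000 2829 2222702 6668105 7 514456 41 41 ∧
    rowOk 4000000 2829 6668105 20004314 7 1543367 43 41 ∧
    rowOk 4000000 2829 7999999 33120000 23 1409681 43 43 := by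
  decide +kernel

set_option maxRecDepth 100000 in
lemma rowOk_top : rowOk 16000000 5657 31999999 163000000 39 5327825 47 47 := by
  decide +kernel

lemma exists_of_le {n : ℕ} (hn : 25000000 ≤ n) (hle : n ≤ 163000000 ^ 2) (h4 : n % 4 ≠ 1) :
    ∃ p, p.Prime ∧ p ^ 2 < n ∧ Squarefree (n - p ^ 2) := by
  obtain ⟨s0, s1, s2, s3, s4, s5, s6, s7, s8, s9, s10, s11, s12, s13⟩ := rowOk_small
  obtain ⟨b0, b1, b2, b3⟩ := rowOk_large
  rcases le_or_gt n (5628 ^ 2) with h | h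
  · exact exists_of_rowOk (by norm_num) (by norm_num) s0 (by omega) h h4
  rcases le_or_gt n (6460 ^ 2) with h | h
  · exact exists_of_rowOk (by norm_num) (by norm_num) s1 (by omega) h h4
  rcases le_or_gt n (8049 ^ 2) with h | h
  · exact exists_of_rowOk (by norm_num) (by norm_num) s2 (by omega) h h4
  rcases le_or_gt n (11043 ^ 2) with h | h
  · exact exists_of_rowOk (by norm_num) (by norm_num) s3 (by omega) h h4
  rcases le_or_gt n (12390 ^ 2) with h | h
  · exact exists_of_rowOk (by norm_num) (by norm_num) s4 (by omega) h h4
  rcases le_or_gt n (14273 ^ 2) with h | h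
  · exact exists_of_rowOk (by norm_num) (by norm_num) s5 (by omega) h h4
  rcases le_or_gt n (16927 ^ 2) with h | h
  · exact exists_of_rowOk (by norm_num) (by norm_num) s6 (by omega) h h4
  rcases le_or_gt n (22275 ^ 2) with h | h
  · exact exists_of_rowOk (by norm_num) (by norm_num) s7 (by omega) h h4
  rcases le_or_gt n (33323 ^ 2) with h | h
  · exact exists_of_rowOk (by norm_num) (by norm_num) s8 (by omega) h h4
  rcases le_or_gt n (59048 ^ 2) with h | h
  · exact exists_of_rowOk (by norm_num) (by norm_num) s9 (by omega) h h4
  rcases le_or_gt n (92705 ^ 2) with h | h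
  · exact exists_of_rowOk (by norm_num) (by norm_num) s10 (by omega) h h4
  rcases le_or_gt n (177251 ^ 2) with h | h
  · exact exists_of_rowOk (by norm_num) (by norm_num) s11 (by omega) h h4
  rcases le_or_gt n (365491 ^ 2) with h | h
  · exact exists_of_rowOk (by norm_num) (by norm_num) s12 (by omega) h h4
  rcases le_or_gt n (866213 ^ 2) with h | h
  · exact exists_of_rowOk (by norm_num) (by norm_num) s13 (by omega) h h4
  rcases le_or_gt n (2222702 ^ 2) with h | h
  · exact exists_of_rowOk (by norm_num) (by norm_num) b0 (by omega) h h4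
  rcases le_or_gt n (6668105 ^ 2) with h | h
  · exact exists_of_rowOk (by norm_num) (by norm_num) b1 (by omega) h h4
  rcases le_or_gt n (20004314 ^ 2) with h | h
  · exact exists_of_rowOk (by norm_num) (by norm_num) b2 (by omega) h h4
  rcases le_or_gt n (33120000 ^ 2) with h | h
  · exact exists_of_rowOk (by norm_num) (by norm_num) b3 (by omega) h h4
  exact exists_of_rowOk (by norm_num) (by norm_num) rowOk_top (by omega) hle h4

/-- The main term `∫ t in 1..y, log t` of a sum of logarithms. -/
noncomputable def logIntegral (y : ℝ) : ℝ := y * Real.log y - y + 1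

/-- The sum of the logarithms of the `0 < m ≤ N` in a residue class modulo `K`. -/
noncomputable def logSum (K r N : ℕ) : ℝ :=
  ∑ m ∈ (Finset.Ioc 0 N).filter (fun m => m % K = r), Real.log m

lemma mul_log_le_logIntegral_sub {a b : ℝ} (ha : 0 < a) (hab : a ≤ b) :
    (b - a) * Real.log a ≤ logIntegral b - logIntegral a := by
  have hb : 0 < b := ha.trans_le hab
  have h := Real.log_le_sub_one_of_pos (div_pos ha hb)
  rw [Real.log_div ha.ne' hb.ne'] at h
  have h2 : b * (Real.log a - Real.log b) ≤ a - b := by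
    have := mul_le_mul_of_nonneg_left h hb.le
    rwa [mul_sub b (a / b), mul_div_cancel₀ _ hb.ne', mul_one] at this
  unfold logIntegral
  linarith

lemma logIntegral_sub_le_mul_log {a b : ℝ} (ha : 0 < a) (hab : a ≤ b) :
    logIntegral b - logIntegral a ≤ (b - a) * Real.log b := by
  have hb : 0 < b := ha.trans_le hab
  have h := Real.log_le_sub_one_of_pos (div_pos hb ha)
  rw [Real.log_div hb.ne' ha.ne'] at h
  have h2 : a * (Real.log b - Real.log a) ≤ b - a := by
    have := mul_le_mul_of_nonneg_left h ha.le
    rwa [mul_sub a (b / a), mul_div_cancel₀ _ ha.ne', mul_one] at this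
  unfold logIntegral
  linarith

lemma logIntegral_one : logIntegral 1 = 0 := by simp [logIntegral]

lemma logIntegral_nonneg {y : ℝ} (hy : 1 ≤ y) : 0 ≤ logIntegral y := by
  have := mul_log_le_logIntegral_sub one_pos hy
  rw [logIntegral_one] at this
  simpa using this

lemma card_filter_Ioc_mod {K r : ℕ} (hr : r < K) (N : ℕ) :
    ((Finset.Ioc N (N + K)).filter fun m => m % K = r).card = 1 := by
  have h : Finset.Ioc N (N + K) = Finset.Ico (N + 1) (N + 1 + K) := by
    ext m; simp only [Finset.mem_Ioc, Finset.mem_Ico]; omega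
  have hp : Function.Periodic (fun m => m % K = r) K := fun m => by simp
  rw [h, Nat.filter_Ico_card_eq_of_periodic _ _ _ hp, Nat.count_eq_card_filter_range,
    Finset.card_eq_one]
  refine ⟨r, ?_⟩
  ext m
  simp only [Finset.mem_filter, Finset.mem_range, Finset.mem_singleton]
  constructor
  · rintro ⟨h1, h2⟩; rwa [Nat.mod_eq_of_lt h1] at h2
  · rintro rfl; exact ⟨hr, Nat.mod_eq_of_lt hr⟩

lemma abs_logSum_sub_le {K r : ℕ} (hr : r < K) {N : ℕ} (hN : 1 ≤ N) :
    |logSum K r N - logIntegral N / K| ≤ Real.log N := by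
  have hK : (0 : ℝ) < K := by exact_mod_cast (by omega : 0 < K)
  induction N using Nat.strong_induction_on with
  | _ N ih =>
  have hN' : (1 : ℝ) ≤ N := by exact_mod_cast hN
  have hlog : 0 ≤ Real.log N := Real.log_nonneg hN'
  rcases le_or_gt N K with h | h
  · have h1 : logIntegral N / K ≤ Real.log N := by
      rw [div_le_iff₀ hK]
      have := logIntegral_sub_le_mul_log one_pos hN'
      rw [logIntegral_one] at this
      have h2 : (N : ℝ) ≤ K := by exact_mod_cast h
      nlinarith
    have h2 : 0 ≤ logIntegral N / K := div_nonneg (logIntegral_nonneg hN') hK.le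
    have h3 : 0 ≤ logSum K r N := Finset.sum_nonneg fun m hm => Real.log_natCast_nonneg m
    have h4 : logSum K r N ≤ Real.log N := by
      have hc : ((Finset.Ioc 0 N).filter fun m => m % K = r).card ≤ 1 := by
        rw [← card_filter_Ioc_mod hr 0, zero_add]
        exact Finset.card_le_card (Finset.filter_subset_filter _ (Finset.Ioc_subset_Ioc_right h))
      calc logSum K r N ≤ ((Finset.Ioc 0 N).filter fun m => m % K = r).card • Real.log N := by
            refine Finset.sum_le_card_nsmul _ _ _ fun m hm => ?_
            simp only [Finset.mem_filter, Finset.mem_Ioc] at hm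
            exact Real.log_le_log (by exact_mod_cast hm.1.1) (by exact_mod_cast hm.1.2)
        _ ≤ 1 • Real.log N := nsmul_le_nsmul_left hlog hc
        _ = _ := one_smul _ _
    rw [abs_le]; constructor <;> linarith
  · obtain ⟨M, rfl⟩ := Nat.exists_eq_add_of_lt h
    have e : K + M + 1 = (M + 1) + K := by ring
    rw [e] at h hN' hlog ⊢
    have hM := ih (M + 1) (by omega) (by omega)
    have hsplit : ∃ m ∈ Finset.Ioc (M + 1) (M + 1 + K),
        logSum K r (M + 1 + K) = logSum K r (M + 1) + Real.log m := by
      obtain ⟨m, hm⟩ := Finset.card_eq_one.1 (card_filter_Ioc_mod hr (M + 1))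
      have hm' : m ∈ (Finset.Ioc (M + 1) (M + 1 + K)).filter fun m => m % K = r := by
        rw [hm]; exact Finset.mem_singleton_self m
      refine ⟨m, (Finset.mem_filter.1 hm').1, ?_⟩
      rw [logSum, logSum, ← Finset.Ioc_union_Ioc_eq_Ioc (Nat.zero_le (M + 1)) (by omega),
        Finset.filter_union, Finset.sum_union, hm, Finset.sum_singleton]
      exact Finset.disjoint_filter_filter (Finset.Ioc_disjoint_Ioc_of_le le_rfl)
    obtain ⟨m, hm, hs⟩ := hsplit
    rw [Finset.mem_Ioc] at hm
    have ha : (0 : ℝ) < ((M + 1 : ℕ) : ℝ) := by positivity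
    have hab : ((M + 1 : ℕ) : ℝ) ≤ ((M + 1 + K : ℕ) : ℝ) := by exact_mod_cast Nat.le_add_right _ _
    have h1 := mul_log_le_logIntegral_sub ha hab
    have h2 := logIntegral_sub_le_mul_log ha hab
    have hd : ((M + 1 + K : ℕ) : ℝ) - ((M + 1 : ℕ) : ℝ) = K := by push_cast; ring
    rw [hd] at h1 h2
    have hm1 : Real.log ((M + 1 : ℕ) : ℝ) ≤ Real.log m :=
      Real.log_le_log ha (by exact_mod_cast hm.1.le)
    have hm2 : Real.log m ≤ Real.log ((M + 1 + K : ℕ) : ℝ) :=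
      Real.log_le_log (by exact_mod_cast (by omega : 0 < m)) (by exact_mod_cast hm.2)
    have h3 : Real.log ((M + 1 : ℕ) : ℝ) ≤
        logIntegral ((M + 1 + K : ℕ) : ℝ) / K - logIntegral ((M + 1 : ℕ) : ℝ) / K := by
      rw [← sub_div, le_div_iff₀ hK]; linarith
    have h4 : logIntegral ((M + 1 + K : ℕ) : ℝ) / K - logIntegral ((M + 1 : ℕ) : ℝ) / K ≤
        Real.log ((M + 1 + K : ℕ) : ℝ) := by
      rw [← sub_div, div_le_iff₀ hK]; linarith
    rw [hs]
    rw [abs_le] at hM ⊢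
    constructor <;> linarith [hM.1, hM.2]

lemma logIntegral_le_floor_add {y : ℝ} (hy : 1 ≤ y) :
    logIntegral ⌊y⌋₊ ≤ logIntegral y ∧ logIntegral y ≤ logIntegral ⌊y⌋₊ + Real.log y := by
  have h1 : (1 : ℝ) ≤ ⌊y⌋₊ := by exact_mod_cast (Nat.one_le_floor_iff y).2 hy
  have h2 : (⌊y⌋₊ : ℝ) ≤ y := Nat.floor_le (by linarith)
  have h3 := Nat.lt_floor_add_one y
  have h4 := mul_log_le_logIntegral_sub (by linarith) h2
  have h5 := logIntegral_sub_le_mul_log (by linarith) h2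
  have h6 := Real.log_nonneg h1
  have h7 := Real.log_nonneg hy
  constructor <;> nlinarith

lemma logSum_floor_le {K r : ℕ} (hr : r < K) {y : ℝ} (hy : 1 ≤ y) :
    logSum K r ⌊y⌋₊ ≤ logIntegral y / K + Real.log y := by
  have hK : (0 : ℝ) < K := by exact_mod_cast (by omega : 0 < K)
  have h := (abs_le.1 (abs_logSum_sub_le hr ((Nat.one_le_floor_iff y).2 hy))).2
  have h1 := div_le_div_of_nonneg_right (logIntegral_le_floor_add hy).1 hK.le
  have h2 : Real.log ⌊y⌋₊ ≤ Real.log y :=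
    Real.log_le_log (by exact_mod_cast (Nat.one_le_floor_iff y).2 hy) (Nat.floor_le (by linarith))
  linarith

lemma le_logSum_floor {K r : ℕ} (hr : r < K) {y : ℝ} (hy : 1 ≤ y) :
    logIntegral y / K - 2 * Real.log y ≤ logSum K r ⌊y⌋₊ := by
  have hK : (1 : ℝ) ≤ K := by exact_mod_cast (by omega : 1 ≤ K)
  have h := (abs_le.1 (abs_logSum_sub_le hr ((Nat.one_le_floor_iff y).2 hy))).1
  have h1 := div_le_div_of_nonneg_right (logIntegral_le_floor_add hy).2 (by linarith : (0:ℝ) ≤ K)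
  have h2 : Real.log ⌊y⌋₊ ≤ Real.log y :=
    Real.log_le_log (by exact_mod_cast (Nat.one_le_floor_iff y).2 hy) (Nat.floor_le (by linarith))
  rw [add_div] at h1
  have h3 : Real.log y / K ≤ Real.log y := div_le_self (Real.log_nonneg hy) hK
  linarith

lemma sum_union_le {α : Type*} [DecidableEq α] (s t : Finset α) {f : α → ℝ} (hf : ∀ a, 0 ≤ f a) :
    ∑ a ∈ s ∪ t, f a ≤ ∑ a ∈ s, f a + ∑ a ∈ t, f a := by
  rw [← Finset.sum_union_inter]
  exact le_add_of_nonneg_right (Finset.sum_nonneg fun a _ => hf a)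

lemma sum_biUnion_le {α β : Type*} [DecidableEq α] [DecidableEq β] (s : Finset α)
    (t : α → Finset β) {f : β → ℝ} (hf : ∀ b, 0 ≤ f b) :
    ∑ b ∈ s.biUnion t, f b ≤ ∑ a ∈ s, ∑ b ∈ t a, f b := by
  induction s using Finset.induction_on with
  | empty => simp
  | insert a s ha ih =>
    rw [Finset.biUnion_insert, Finset.sum_insert ha]
    have h := Finset.sum_union_inter (s₁ := t a) (s₂ := s.biUnion t) (f := f)
    have h2 : 0 ≤ ∑ b ∈ t a ∩ s.biUnion t, f b := Finset.sum_nonneg fun b _ => hf b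
    linarith

open ArithmeticFunction in
lemma sum_log_filter_eq (P : ℕ → Prop) [DecidablePred P] (N : ℕ) :
    ∑ m ∈ (Finset.Ioc 0 N).filter P, Real.log m =
      ∑ d ∈ Finset.Ioc 0 N,
        vonMangoldt d * (((Finset.Ioc 0 (N / d)).filter fun k => P (d * k)).card : ℝ) := by
  have h1 : ∀ m ∈ (Finset.Ioc 0 N).filter P, Real.log m =
      ∑ d ∈ Finset.Ioc 0 N, if d ∣ m then vonMangoldt d else 0 := by
    intro m hm
    simp only [Finset.mem_filter, Finset.mem_Ioc] at hm
    rw [← vonMangoldt_sum, ← Finset.sum_filter]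
    refine Finset.sum_congr ?_ fun _ _ => rfl
    ext d
    simp only [Nat.mem_divisors, Finset.mem_filter, Finset.mem_Ioc]
    constructor
    · rintro ⟨h, -⟩
      exact ⟨⟨Nat.pos_of_dvd_of_pos h hm.1.1, (Nat.le_of_dvd hm.1.1 h).trans hm.1.2⟩, h⟩
    · rintro ⟨-, h⟩; exact ⟨h, by omega⟩
  rw [Finset.sum_congr rfl h1, Finset.sum_comm]
  refine Finset.sum_congr rfl fun d hd => ?_
  rw [Finset.mem_Ioc] at hd
  rw [← Finset.sum_filter, Finset.sum_const, nsmul_eq_mul, mul_comm]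
  congr 2
  refine Finset.card_nbij' (fun m => m / d) (fun k => d * k) ?_ ?_ ?_ ?_
  · intro m hm
    simp only [Finset.coe_filter, Finset.mem_filter, Finset.mem_Ioc, Set.mem_ofPred_eq] at hm ⊢
    obtain ⟨⟨⟨hm0, hmN⟩, hP⟩, k, rfl⟩ := hm
    rw [Nat.mul_div_cancel_left _ hd.1]
    refine ⟨⟨Nat.pos_of_mul_pos_left hm0, ?_⟩, hP⟩
    rw [Nat.le_div_iff_mul_le hd.1, mul_comm]; exact hmN
  · intro k hk
    simp only [Finset.coe_filter, Finset.mem_filter, Finset.mem_Ioc, Set.mem_ofPred_eq] at hk ⊢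
    refine ⟨⟨⟨Nat.mul_pos hd.1 hk.1.1, ?_⟩, hk.2⟩, dvd_mul_right _ _⟩
    rw [mul_comm]; exact (Nat.le_div_iff_mul_le hd.1).1 hk.1.2
  · intro m hm
    simp only [Finset.coe_filter, Finset.mem_filter, Set.mem_ofPred_eq] at hm
    exact Nat.mul_div_cancel' hm.2
  · intro k hk
    exact Nat.mul_div_cancel_left _ hd.1

lemma card_filter_Ioc_mul_mod {K r : ℕ} (hr : r < K) (c : ℕ) :
    ((Finset.Ioc 0 (K * c)).filter fun k => k % K = r).card = c := by
  induction c with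
  | zero => simp
  | succ c ih =>
    rw [mul_add, mul_one, ← Finset.Ioc_union_Ioc_eq_Ioc (Nat.zero_le (K * c)) (by omega),
      Finset.filter_union, Finset.card_union_of_disjoint, ih, card_filter_Ioc_mod hr]
    exact Finset.disjoint_filter_filter (Finset.Ioc_disjoint_Ioc_of_le le_rfl)

lemma div_le_card_filter_mod {K r : ℕ} (hr : r < K) (M : ℕ) :
    M / K ≤ ((Finset.Ioc 0 M).filter fun k => k % K = r).card := by
  rw [← card_filter_Ioc_mul_mod hr (M / K)]
  exact Finset.card_le_card (Finset.filter_subset_filter _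
    (Finset.Ioc_subset_Ioc_right (Nat.mul_div_le M K)))

lemma card_filter_mod_le {K r : ℕ} (hr : r < K) (M : ℕ) :
    ((Finset.Ioc 0 M).filter fun k => k % K = r).card ≤ M / K + 1 := by
  rw [← card_filter_Ioc_mul_mod hr (M / K + 1)]
  exact Finset.card_le_card (Finset.filter_subset_filter _
    (Finset.Ioc_subset_Ioc_right (Nat.lt_mul_div_succ M (by omega)).le))

lemma div_le_card_filter_mul_mod {K r d : ℕ} (hr : r < K) (hd : Nat.Coprime d K) (M : ℕ) :
    M / K ≤ ((Finset.Ioc 0 M).filter fun k => d * k % K = r).card := by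
  obtain ⟨e, -, he⟩ := Nat.exists_mul_mod_eq_of_coprime r hd (by omega)
  refine (div_le_card_filter_mod (Nat.mod_lt e (by omega : 0 < K)) M).trans ?_
  refine Finset.card_le_card fun k hk => ?_
  rw [Finset.mem_filter] at hk ⊢
  refine ⟨hk.1, ?_⟩
  have : d * k ≡ d * e [MOD K] := Nat.ModEq.mul_left d hk.2
  rw [this, he, Nat.mod_eq_of_lt hr]

open ArithmeticFunction in
lemma sum_vonMangoldt_div_le {l : ℕ} (hl : l.Prime) (D : ℕ) :
    ∑ d ∈ (Finset.Ioc 0 D).filter (l ∣ ·), vonMangoldt d / d ≤ Real.log l / (l - 1) := by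
  have hl1 : (1 : ℝ) < l := by exact_mod_cast hl.one_lt
  have hinj : Function.Injective fun i => l ^ (i + 1) := fun i j h => by
    have := Nat.pow_right_injective hl.two_le h; omega
  calc ∑ d ∈ (Finset.Ioc 0 D).filter (l ∣ ·), vonMangoldt d / d
      = ∑ d ∈ ((Finset.Ioc 0 D).filter (l ∣ ·)).filter (fun d => vonMangoldt d / d ≠ 0),
          vonMangoldt d / d := (Finset.sum_filter_ne_zero _).symm
    _ ≤ ∑ d ∈ (Finset.range D).image (fun i => l ^ (i + 1)), vonMangoldt d / d := by
        refine Finset.sum_le_sum_of_subset_of_nonneg (fun d hd => ?_) fun d _ _ =>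
          div_nonneg vonMangoldt_nonneg (Nat.cast_nonneg d)
        simp only [Finset.mem_filter, Finset.mem_Ioc] at hd
        obtain ⟨⟨⟨-, hD⟩, hld⟩, hne⟩ := hd
        have h1 : vonMangoldt d ≠ 0 := fun h => hne (by rw [h, zero_div])
        rw [vonMangoldt_ne_zero_iff] at h1
        obtain ⟨p, k, hp, hk, rfl⟩ := h1
        rw [← Nat.prime_iff] at hp
        have : l = p := (Nat.prime_dvd_prime_iff_eq hl hp).1 (hl.dvd_of_dvd_pow hld)
        subst this
        have := Nat.lt_pow_self hl.one_lt (n := k)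
        exact Finset.mem_image.2 ⟨k - 1, Finset.mem_range.2 (by omega),
          by rw [Nat.sub_add_cancel hk]⟩
    _ = ∑ i ∈ Finset.range D, Real.log l / (l : ℝ) ^ (i + 1) := by
        rw [Finset.sum_image fun i _ j _ h => hinj h]
        refine Finset.sum_congr rfl fun i _ => ?_
        rw [vonMangoldt_apply_pow (by omega), vonMangoldt_apply_prime hl]
        push_cast; rfl
    _ = Real.log l / (l - 1) * (1 - ((l : ℝ)⁻¹) ^ D) := by
        induction D with
        | zero => simp
        | succ D ih =>
          rw [Finset.sum_range_succ, ih, inv_pow, inv_pow]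
          have : (l : ℝ) - 1 ≠ 0 := by linarith
          have : (l : ℝ) ≠ 0 := by linarith
          field_simp
          ring
    _ ≤ _ := by
        have h1 : 0 ≤ Real.log l / (l - 1) :=
          div_nonneg (Real.log_nonneg hl1.le) (by linarith)
        have h2 : (0 : ℝ) ≤ ((l : ℝ)⁻¹) ^ D := by positivity
        nlinarith

/-- The sum of `log l / (l - 1)` over the prime divisors of `K`. -/
noncomputable def logWeight (K : ℕ) : ℝ := ∑ l ∈ K.primeFactors, Real.log l / ((l : ℝ) - 1)

open ArithmeticFunction in
lemma log_factorial_sub_le (K D : ℕ) (hK : K ≠ 0) :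
    logSum 1 0 D - D * logWeight K ≤
      ∑ d ∈ (Finset.Ioc 0 D).filter (Nat.Coprime · K), vonMangoldt d * ((D / d : ℕ) : ℝ) := by
  have h1 : logSum 1 0 D = ∑ d ∈ Finset.Ioc 0 D, vonMangoldt d * ((D / d : ℕ) : ℝ) := by
    rw [logSum, sum_log_filter_eq]
    refine Finset.sum_congr rfl fun d _ => ?_
    rw [Finset.filter_true_of_mem fun k _ => Nat.mod_one _, Nat.card_Ioc, Nat.sub_zero]
  have h2 : ∑ d ∈ (Finset.Ioc 0 D).filter (¬ Nat.Coprime · K), vonMangoldt d * ((D / d : ℕ) : ℝ) ≤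
      D * logWeight K := by
    calc _ ≤ ∑ d ∈ (Finset.Ioc 0 D).filter (¬ Nat.Coprime · K), D * (vonMangoldt d / d) := by
          refine Finset.sum_le_sum fun d _ => ?_
          rw [mul_div_assoc', mul_comm (D : ℝ), mul_div_assoc]
          exact mul_le_mul_of_nonneg_left Nat.cast_div_le vonMangoldt_nonneg
      _ ≤ ∑ d ∈ K.primeFactors.biUnion (fun l => (Finset.Ioc 0 D).filter (l ∣ ·)),
            D * (vonMangoldt d / d) := by
          refine Finset.sum_le_sum_of_subset_of_nonneg (fun d hd => ?_) fun d _ _ =>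
            mul_nonneg (Nat.cast_nonneg _) (div_nonneg vonMangoldt_nonneg (Nat.cast_nonneg d))
          rw [Finset.mem_filter] at hd
          obtain ⟨l, hl, hld, hlK⟩ := Nat.Prime.not_coprime_iff_dvd.1 hd.2
          exact Finset.mem_biUnion.2 ⟨l, Nat.mem_primeFactors.2 ⟨hl, hlK, hK⟩,
            Finset.mem_filter.2 ⟨hd.1, hld⟩⟩
      _ ≤ ∑ l ∈ K.primeFactors, ∑ d ∈ (Finset.Ioc 0 D).filter (l ∣ ·),
            D * (vonMangoldt d / d) :=
          sum_biUnion_le _ _ fun d =>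
            mul_nonneg (Nat.cast_nonneg _) (div_nonneg vonMangoldt_nonneg (Nat.cast_nonneg d))
      _ ≤ _ := by
          rw [logWeight, Finset.mul_sum]
          refine Finset.sum_le_sum fun l hl => ?_
          rw [← Finset.mul_sum]
          exact mul_le_mul_of_nonneg_left
            (sum_vonMangoldt_div_le (Nat.prime_of_mem_primeFactors hl) D) (Nat.cast_nonneg _)
  rw [h1, ← Finset.sum_filter_add_sum_filter_not (Finset.Ioc 0 D) (Nat.Coprime · K)]
  linarith

/-- Chebyshev's function in a residue class. -/
noncomputable def thetaClass (K r N : ℕ) : ℝ :=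
  ∑ p ∈ (Finset.Ioc 0 N).filter (fun p => p.Prime ∧ p % K = r), Real.log p

lemma thetaClass_le_theta (K r N : ℕ) : thetaClass K r N ≤ Chebyshev.theta N := by
  rw [thetaClass, Chebyshev.theta, Nat.floor_natCast]
  refine Finset.sum_le_sum_of_subset_of_nonneg (fun p hp => ?_) fun p _ _ =>
    Real.log_natCast_nonneg p
  simp only [Finset.mem_filter] at hp ⊢
  exact ⟨hp.1, hp.2.1⟩

open ArithmeticFunction in
lemma sum_prime_class_add_le {K r : ℕ} (hr : r < K) (hrK : Nat.Coprime r K) (N : ℕ) :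
    (∑ p ∈ (Finset.Ioc (N / K) N).filter (fun p => p.Prime ∧ p % K = r), Real.log p) +
      ∑ d ∈ (Finset.Ioc 0 (N / K)).filter (Nat.Coprime · K),
        vonMangoldt d * ((N / K / d : ℕ) : ℝ) ≤ logSum K r N := by
  have hcop : ∀ p, p % K = r → Nat.Coprime p K := by
    intro p hp
    rw [Nat.Coprime, Nat.gcd_comm, Nat.gcd_rec, hp]; exact hrK
  set c : ℕ → ℝ := fun d =>
    vonMangoldt d * (((Finset.Ioc 0 (N / d)).filter fun k => d * k % K = r).card : ℝ) with hc
  have hc0 : ∀ d, 0 ≤ c d := fun d => mul_nonneg vonMangoldt_nonneg (Nat.cast_nonneg _)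
  have hd : Disjoint ((Finset.Ioc (N / K) N).filter (fun p => p.Prime ∧ p % K = r))
      ((Finset.Ioc 0 (N / K)).filter (Nat.Coprime · K)) :=
    Finset.disjoint_filter_filter (Finset.Ioc_disjoint_Ioc_of_le le_rfl).symm
  calc _ ≤ (∑ p ∈ (Finset.Ioc (N / K) N).filter (fun p => p.Prime ∧ p % K = r), c p) +
        ∑ d ∈ (Finset.Ioc 0 (N / K)).filter (Nat.Coprime · K), c d := by
        refine add_le_add (Finset.sum_le_sum fun p hp => ?_) (Finset.sum_le_sum fun d hd => ?_)
        · simp only [Finset.mem_filter, Finset.mem_Ioc] at hp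
          simp only [hc]
          rw [vonMangoldt_apply_prime hp.2.1]
          refine le_mul_of_one_le_right (Real.log_natCast_nonneg p) ?_
          exact_mod_cast Finset.card_pos.2 ⟨1, Finset.mem_filter.2 ⟨Finset.mem_Ioc.2
            ⟨one_pos, (Nat.one_le_div_iff hp.2.1.pos).2 hp.1.2⟩, by rw [mul_one]; exact hp.2.2⟩⟩
        · rw [Finset.mem_filter] at hd
          refine mul_le_mul_of_nonneg_left ?_ vonMangoldt_nonneg
          rw [Nat.div_div_eq_div_mul, mul_comm K, ← Nat.div_div_eq_div_mul]
          exact_mod_cast div_le_card_filter_mul_mod hr hd.2 _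
    _ = ∑ d ∈ (Finset.Ioc (N / K) N).filter (fun p => p.Prime ∧ p % K = r) ∪
        (Finset.Ioc 0 (N / K)).filter (Nat.Coprime · K), c d := (Finset.sum_union hd).symm
    _ ≤ ∑ d ∈ Finset.Ioc 0 N, c d := by
        refine Finset.sum_le_sum_of_subset_of_nonneg (fun d hd => ?_) fun d _ _ => hc0 d
        simp only [Finset.mem_union, Finset.mem_filter, Finset.mem_Ioc] at hd ⊢
        rcases hd with ⟨⟨h, h'⟩, -⟩ | ⟨⟨h, h'⟩, -⟩
        · exact ⟨(Nat.zero_le _).trans_lt h, h'⟩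
        · exact ⟨h, h'.trans (Nat.div_le_self N K)⟩
    _ = logSum K r N := by rw [logSum, sum_log_filter_eq]

lemma logWeight_nonneg (K : ℕ) : 0 ≤ logWeight K :=
  Finset.sum_nonneg fun l hl => div_nonneg (Real.log_natCast_nonneg l) (by
    have : (1 : ℝ) ≤ l := by exact_mod_cast (Nat.prime_of_mem_primeFactors hl).one_le
    linarith)

lemma thetaClass_le_add {K r : ℕ} (hr : r < K) (hrK : Nat.Coprime r K) (N : ℕ) :
    thetaClass K r N ≤ N / K * (Real.log K + logWeight K) + 3 * Real.log N +
      thetaClass K r (N / K) := by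
  have hK : (1 : ℝ) ≤ K := by exact_mod_cast (by omega : 1 ≤ K)
  have hlK := Real.log_nonneg hK
  have hlN := Real.log_natCast_nonneg N
  rcases Nat.eq_zero_or_pos N with rfl | hN
  · simp
  have hN' : (1 : ℝ) ≤ N := by exact_mod_cast hN
  have hsplit : thetaClass K r N = thetaClass K r (N / K) +
      ∑ p ∈ (Finset.Ioc (N / K) N).filter (fun p => p.Prime ∧ p % K = r), Real.log p := by
    rw [thetaClass, thetaClass, ← Finset.sum_union
      (Finset.disjoint_filter_filter (Finset.Ioc_disjoint_Ioc_of_le le_rfl)),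
      ← Finset.filter_union, Finset.Ioc_union_Ioc_eq_Ioc (Nat.zero_le _) (Nat.div_le_self _ _)]
  have h1 := sum_prime_class_add_le hr hrK N
  have h2 := log_factorial_sub_le K (N / K) (by omega)
  have h3 := logSum_floor_le hr hN'
  rw [Nat.floor_natCast] at h3
  have hdiv : ((N / K : ℕ) : ℝ) ≤ N / K := Nat.cast_div_le
  have hw := mul_le_mul_of_nonneg_right hdiv (logWeight_nonneg K)
  have h4 : logIntegral N / K - N / K * Real.log K - 2 * Real.log N ≤ logSum 1 0 (N / K) := by
    have e : logIntegral N / K - N / K * Real.log K = logIntegral (N / K) - 1 + 1 / K := by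
      unfold logIntegral
      rw [Real.log_div (by linarith) (by linarith)]
      field_simp
      ring
    have hK1 : 1 / (K : ℝ) ≤ 1 := by rw [div_le_one (by linarith)]; exact hK
    rcases lt_or_ge N K with h | h
    · rw [Nat.div_eq_of_lt h]
      have hlt : (N : ℝ) / K ≤ 1 := by
        rw [div_le_one (by linarith)]; exact_mod_cast h.le
      have h5 : logIntegral N / K ≤ Real.log N := by
        have := logIntegral_sub_le_mul_log one_pos hN'
        rw [logIntegral_one] at this
        rw [div_le_iff₀ (by linarith)]
        have h6 : (N : ℝ) ≤ K := by exact_mod_cast h.le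
        nlinarith
      have h6 : (0 : ℝ) ≤ N / K * Real.log K := by positivity
      simp only [logSum, Finset.Ioc_self, Finset.filter_empty, Finset.sum_empty]
      linarith
    · have hge : (1 : ℝ) ≤ N / K := by
        rw [le_div_iff₀ (by linarith), one_mul]; exact_mod_cast h
      have h5 := le_logSum_floor (r := 0) (K := 1) one_pos hge
      rw [Nat.floor_div_natCast, Nat.floor_natCast, Nat.cast_one, div_one,
        Real.log_div (by linarith) (by linarith)] at h5
      linarith
  rw [hsplit]
  linarith

lemma thetaClass_le {K r : ℕ} (hr : r < K) (hrK : Nat.Coprime r K) (N : ℕ) :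
    thetaClass K r N ≤ N / K * ((Real.log K + logWeight K) * (1 + 1 / K) + Real.log 4 / K) +
      6 * Real.log N := by
  have hK : (1 : ℝ) ≤ K := by exact_mod_cast (by omega : 1 ≤ K)
  have hK0 : (0 : ℝ) < K := by linarith
  have hlK := Real.log_nonneg hK
  have hw := logWeight_nonneg K
  have h1 := thetaClass_le_add hr hrK N
  have h2 := thetaClass_le_add hr hrK (N / K)
  have h3 := (thetaClass_le_theta K r (N / K / K)).trans
    (Chebyshev.theta_le_log4_mul_x (Nat.cast_nonneg _))
  have h4 : ((N / K : ℕ) : ℝ) ≤ N / K := Nat.cast_div_le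
  have h5 : ((N / K / K : ℕ) : ℝ) ≤ N / K / K :=
    Nat.cast_div_le.trans (div_le_div_of_nonneg_right h4 hK0.le)
  have h6 : ((N / K : ℕ) : ℝ) / K * (Real.log K + logWeight K) ≤
      N / K / K * (Real.log K + logWeight K) :=
    mul_le_mul_of_nonneg_right (div_le_div_of_nonneg_right h4 hK0.le) (by linarith)
  have h7 : Real.log ((N / K : ℕ) : ℝ) ≤ Real.log N := by
    rcases Nat.eq_zero_or_pos (N / K) with h | h
    · rw [h]; simpa using Real.log_natCast_nonneg N
    · exact Real.log_le_log (by exact_mod_cast h) (by exact_mod_cast Nat.div_le_self N K)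
  have h8 := mul_le_mul_of_nonneg_left h5 (Real.log_nonneg (by norm_num : (1:ℝ) ≤ 4))
  have e : (N : ℝ) / K * ((Real.log K + logWeight K) * (1 + 1 / K) + Real.log 4 / K) =
      N / K * (Real.log K + logWeight K) + N / K / K * (Real.log K + logWeight K) +
        Real.log 4 * (N / K / K) := by
    field_simp
  rw [e]
  linarith

/-- `k` is prime to `3` and `k ^ 2` is not `t` modulo `9`. -/
def good (t k : ℕ) : Bool := !(Nat.beq (k % 3) 0) && !(Nat.beq (k * k % 9) t)

/-- The number of pairs `(j, k)` with `j` in the list, `0 < k ≤ y`, `j ∣ k` and `P k`. -/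
def dvdCount (l : List ℕ) (P : ℕ → Bool) (y : ℕ) : ℕ :=
  (l.map fun j => ((Finset.Ioc 0 y).filter fun k => j ∣ k ∧ P k = true).card).sum

/-- The number of elements of the list dividing `k`. -/
def dvdWeight (l : List ℕ) (k : ℕ) : ℕ :=
  l.foldr (fun j s => cond (Nat.beq (k % j) 0) (s + 1) s) 0

lemma dvdCount_succ (l : List ℕ) (P : ℕ → Bool) (y : ℕ) :
    dvdCount l P (y + 1) = dvdCount l P y + cond (P (y + 1)) (dvdWeight l (y + 1)) 0 := by
  induction l with
  | nil => cases h : P (y + 1) <;> simp [dvdCount, dvdWeight]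
  | cons j l ih =>
    have e1 : ∀ y, dvdCount (j :: l) P y =
        ((Finset.Ioc 0 y).filter fun k => j ∣ k ∧ P k = true).card + dvdCount l P y := fun y => by
      simp [dvdCount]
    have e2 : dvdWeight (j :: l) (y + 1) = dvdWeight l (y + 1) + if j ∣ y + 1 then 1 else 0 := by
      rw [dvdWeight, List.foldr_cons, ← dvdWeight]
      split_ifs with h <;> rw [Nat.dvd_iff_mod_eq_zero] at h
      · rw [h]; rfl
      · have : Nat.beq ((y + 1) % j) 0 = false := by
          rw [← Bool.not_eq_true, Nat.beq_eq]; exact h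
        rw [this]; rfl
    have e3 : Finset.Ioc 0 (y + 1) = insert (y + 1) (Finset.Ioc 0 y) := by
      ext; simp only [Finset.mem_Ioc, Finset.mem_insert]; omega
    rw [e1, e1, ih, e2, e3, Finset.filter_insert]
    by_cases hj : j ∣ y + 1 <;> cases h : P (y + 1) <;> simp [hj] <;> omega

/-- The `j` with Möbius coefficient `1` in the smoothing kernel. -/
def posIndices : List ℕ := [1, 10, 14, 22, 26, 34, 35, 38]

/-- The `j` with Möbius coefficient `-1` in the smoothing kernel. -/
def negIndices : List ℕ := [2, 5, 7, 11, 13, 17, 19, 23, 29, 31, 37, 41, 43]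

/-- The integral bound for the smoothing kernel. -/
def kernelBound (t y : ℕ) : ℕ :=
  cond (Nat.beq t 1) 0 1 + (cond (Nat.ble 61 y) 1 0 + (cond (Nat.ble 70 y) 1 0 +
    (cond (Nat.ble 109 y) 1 0 + (cond (Nat.ble 677 y) 1 0 + (cond (Nat.ble 2417 y) 1 0 +
      cond (Nat.ble 10000 y) 82 0)))))

/-- The three counts in the kernel at `y`, compared with the bound at `y, …, y + f - 1`. -/
def kernelOk (t : ℕ) : ℕ → ℕ → ℕ → ℕ → ℕ → Bool
  | 0, _, _, _, _ => true
  | f + 1, y, a, b, c =>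
    Nat.ble (1308276133167003 * a) (1308276133167003 * b + 1336649465494913 * c +
      1308276133167003 * kernelBound t y) &&
    kernelOk t f (y + 1) (a + cond (good t (y + 1)) (dvdWeight posIndices (y + 1)) 0)
      (b + cond (good t (y + 1)) (dvdWeight negIndices (y + 1)) 0)
      (c + cond (good 0 (y + 1)) (dvdWeight [47] (y + 1)) 0)

lemma le_of_kernelOk {t f y : ℕ}
    (h : kernelOk t f y (dvdCount posIndices (good t) y) (dvdCount negIndices (good t) y)
      (dvdCount [47] (good 0) y) = true) {z : ℕ} (hyz : y ≤ z) (hz : z < y + f) :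
    1308276133167003 * dvdCount posIndices (good t) z ≤
      1308276133167003 * dvdCount negIndices (good t) z + 1336649465494913 * dvdCount [47] (good 0) z +
        1308276133167003 * kernelBound t z := by
  induction f generalizing y with
  | zero => omega
  | succ f ih =>
    rw [kernelOk, Bool.and_eq_true, ← dvdCount_succ, ← dvdCount_succ, ← dvdCount_succ] at h
    rcases hyz.eq_or_lt with rfl | hlt
    · exact Nat.le_of_ble_eq_true h.1
    · exact ih h.2 hlt (by omega)

lemma sum_filter_eq_sum_mod {K : ℕ} (hK : 0 < K) {P : ℕ → Bool} (hP : ∀ m, P (m % K) = P m)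
    (f : ℕ → ℝ) (N : ℕ) :
    ∑ m ∈ (Finset.Ioc 0 N).filter (fun m => P m = true), f m =
      ∑ r ∈ (Finset.range K).filter (fun r => P r = true),
        ∑ m ∈ (Finset.Ioc 0 N).filter (fun m => m % K = r), f m := by
  rw [← Finset.sum_fiberwise_of_maps_to (g := (· % K))
    (t := (Finset.range K).filter (fun r => P r = true))]
  · refine Finset.sum_congr rfl fun r hr => ?_
    rw [Finset.filter_filter]
    refine Finset.sum_congr (Finset.filter_congr fun m _ => ?_) fun _ _ => rfl
    rw [Finset.mem_filter] at hr
    constructor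
    · exact fun h => h.2
    · exact fun h => ⟨by rw [← hP, h]; exact hr.2, h⟩
  · intro m hm
    rw [Finset.mem_filter] at hm ⊢
    exact ⟨Finset.mem_range.2 (Nat.mod_lt _ hK), by rw [hP]; exact hm.2⟩

lemma good_mod_nine (t j m : ℕ) : good t (j * (m % 9)) = good t (j * m) := by
  have h : j * (m % 9) ≡ j * m [MOD 9] := (Nat.mod_modEq m 9).mul_left j
  have h3 : j * (m % 9) % 3 = j * m % 3 := h.of_dvd (by norm_num : 3 ∣ 9)
  have h9 : j * (m % 9) * (j * (m % 9)) % 9 = j * m * (j * m) % 9 := h.mul h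
  rw [good, good, h3, h9]

lemma good_zero_mod_three (m : ℕ) : good 0 (m % 3) = good 0 m := by
  have h : ∀ a < 9, good 0 (a % 3) = good 0 a := by decide
  have e : m % 9 % 3 = m % 3 := Nat.mod_mod_of_dvd m (by norm_num)
  have := good_mod_nine 0 1 m
  rw [one_mul, one_mul] at this
  rw [← this, ← h _ (Nat.mod_lt _ (by norm_num)), e]

lemma card_good {t j : ℕ} (ht : t = 1 ∨ t = 4 ∨ t = 7) (hj : j % 3 ≠ 0) :
    ((Finset.range 9).filter fun r => good t (j * r) = true).card = 4 := by
  have h : ∀ i < 9, i % 3 ≠ 0 → ∀ s ∈ [1, 4, 7],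
      ((Finset.range 9).filter fun r => good s (r * i) = true).card = 4 := by decide
  have h1 := h (j % 9) (Nat.mod_lt _ (by norm_num)) (by omega) t (by simpa using ht)
  simp_rw [good_mod_nine] at h1
  simpa only [mul_comm j] using h1

lemma card_filter_mod_bounds {K c : ℕ} (hK : 0 < K) {P : ℕ → Bool} (hP : ∀ m, P (m % K) = P m)
    (hc : ((Finset.range K).filter fun r => P r = true).card = c) (N : ℕ) :
    c * (N / K) ≤ ((Finset.Ioc 0 N).filter fun m => P m = true).card ∧
      ((Finset.Ioc 0 N).filter fun m => P m = true).card ≤ c * (N / K) + c := by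
  have h := sum_filter_eq_sum_mod hK hP (fun _ => 1) N
  simp only [Finset.sum_const, nsmul_eq_mul, mul_one] at h
  have h' : ((Finset.Ioc 0 N).filter fun m => P m = true).card =
      ∑ r ∈ (Finset.range K).filter (fun r => P r = true),
        ((Finset.Ioc 0 N).filter fun m => m % K = r).card := by exact_mod_cast h
  rw [h', ← hc, ← smul_eq_mul, ← Finset.sum_const]
  refine ⟨Finset.sum_le_sum fun r hr => ?_, ?_⟩
  · rw [Finset.mem_filter, Finset.mem_range] at hr
    exact div_le_card_filter_mod hr.1 N
  · have e : ∑ _r ∈ (Finset.range K).filter (fun r => P r = true), N / K +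
        ((Finset.range K).filter (fun r => P r = true)).card =
        ∑ _r ∈ (Finset.range K).filter (fun r => P r = true), (N / K + 1) := by
      simp [mul_add]
    rw [e]
    refine Finset.sum_le_sum fun r hr => ?_
    rw [Finset.mem_filter, Finset.mem_range] at hr
    exact card_filter_mod_le hr.1 N

lemma card_filter_dvd {j : ℕ} (hj : 0 < j) (P : ℕ → Bool) (y : ℕ) :
    ((Finset.Ioc 0 y).filter fun k => j ∣ k ∧ P k = true).card =
      ((Finset.Ioc 0 (y / j)).filter fun k => P (j * k) = true).card := by
  refine Finset.card_nbij' (fun m => m / j) (fun k => j * k) ?_ ?_ ?_ ?_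
  · intro m hm
    simp only [Finset.coe_filter, Finset.mem_Ioc, Set.mem_ofPred_eq] at hm ⊢
    obtain ⟨⟨hm0, hmN⟩, ⟨k, rfl⟩, hP⟩ := hm
    rw [Nat.mul_div_cancel_left _ hj]
    refine ⟨⟨Nat.pos_of_mul_pos_left hm0, ?_⟩, hP⟩
    rw [Nat.le_div_iff_mul_le hj, mul_comm]; exact hmN
  · intro k hk
    simp only [Finset.coe_filter, Finset.mem_Ioc, Set.mem_ofPred_eq] at hk ⊢
    refine ⟨⟨Nat.mul_pos hj hk.1.1, ?_⟩, dvd_mul_right _ _, hk.2⟩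
    rw [mul_comm]; exact (Nat.le_div_iff_mul_le hj).1 hk.1.2
  · intro m hm
    simp only [Finset.coe_filter, Set.mem_ofPred_eq] at hm
    exact Nat.mul_div_cancel' hm.2.1
  · intro k hk
    exact Nat.mul_div_cancel_left _ hj

lemma card_filter_dvd_bounds {K c j : ℕ} (hK : 0 < K) (hj : 0 < j) {P : ℕ → Bool}
    (hP : ∀ m, P (j * (m % K)) = P (j * m))
    (hc : ((Finset.range K).filter fun r => P (j * r) = true).card = c) (y : ℕ) :
    (c : ℝ) / K * (y / j) - c ≤ ((Finset.Ioc 0 y).filter fun k => j ∣ k ∧ P k = true).card ∧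
      (((Finset.Ioc 0 y).filter fun k => j ∣ k ∧ P k = true).card : ℝ) ≤
        c / K * (y / j) + c := by
  obtain ⟨h1, h2⟩ := card_filter_mod_bounds hK hP hc (y / j)
  rw [← card_filter_dvd hj, Nat.div_div_eq_div_mul] at h1 h2
  have h1' : (c : ℝ) * (y / (j * K) : ℕ) ≤
    ((Finset.Ioc 0 y).filter fun k => j ∣ k ∧ P k = true).card := by exact_mod_cast h1
  have h2' : (((Finset.Ioc 0 y).filter fun k => j ∣ k ∧ P k = true).card : ℝ) ≤
    c * (y / (j * K) : ℕ) + c := by exact_mod_cast h2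
  have e : (c : ℝ) / K * (y / j) = c * (y / (j * K : ℕ)) := by push_cast; field_simp
  have h3 : ((y / (j * K) : ℕ) : ℝ) ≤ y / (j * K : ℕ) := Nat.cast_div_le
  have h4 : (y : ℝ) / (j * K : ℕ) ≤ (y / (j * K) : ℕ) + 1 := (Nat.lt_floor_add_one _).le.trans_eq
    (by rw [Nat.floor_div_natCast, Nat.floor_natCast])
  have hc0 : (0 : ℝ) ≤ c := Nat.cast_nonneg c
  rw [e]
  constructor
  · linarith [mul_le_mul_of_nonneg_left h4 hc0]
  · linarith [mul_le_mul_of_nonneg_left h3 hc0]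

lemma dvdCount_le_crude {t : ℕ} (ht : t = 1 ∨ t = 4 ∨ t = 7) (y : ℕ) :
    1308276133167003 * dvdCount posIndices (good t) y ≤
      1308276133167003 * dvdCount negIndices (good t) y +
        1336649465494913 * dvdCount [47] (good 0) y + 1308276133167003 * 87 := by
  have hb : ∀ j : ℕ, 0 < j → j % 3 ≠ 0 → _ := fun j hj hj3 =>
    card_filter_dvd_bounds (by norm_num) hj (good_mod_nine t j) (card_good ht hj3) y
  have hc := card_filter_dvd_bounds (K := 3) (j := 47) (c := 2) (by norm_num) (by norm_num)
    (P := good 0) (fun m => by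
      rw [← good_zero_mod_three, ← good_zero_mod_three (47 * m), Nat.mul_mod_mod])
    (by decide) y
  have hb1 := (hb 1 (by norm_num) (by norm_num)).2
  have hb10 := (hb 10 (by norm_num) (by norm_num)).2
  have hb14 := (hb 14 (by norm_num) (by norm_num)).2
  have hb22 := (hb 22 (by norm_num) (by norm_num)).2
  have hb26 := (hb 26 (by norm_num) (by norm_num)).2
  have hb34 := (hb 34 (by norm_num) (by norm_num)).2
  have hb35 := (hb 35 (by norm_num) (by norm_num)).2
  have hb38 := (hb 38 (by norm_num) (by norm_num)).2
  have hb2 := (hb 2 (by norm_num) (by norm_num)).1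
  have hb5 := (hb 5 (by norm_num) (by norm_num)).1
  have hb7 := (hb 7 (by norm_num) (by norm_num)).1
  have hb11 := (hb 11 (by norm_num) (by norm_num)).1
  have hb13 := (hb 13 (by norm_num) (by norm_num)).1
  have hb17 := (hb 17 (by norm_num) (by norm_num)).1
  have hb19 := (hb 19 (by norm_num) (by norm_num)).1
  have hb23 := (hb 23 (by norm_num) (by norm_num)).1
  have hb29 := (hb 29 (by norm_num) (by norm_num)).1
  have hb31 := (hb 31 (by norm_num) (by norm_num)).1
  have hb37 := (hb 37 (by norm_num) (by norm_num)).1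
  have hb41 := (hb 41 (by norm_num) (by norm_num)).1
  have hb43 := (hb 43 (by norm_num) (by norm_num)).1
  have hc47 := hc.1
  rw [← Nat.cast_le (α := ℝ)]
  simp only [dvdCount, posIndices, negIndices, List.map_cons, List.map_nil, List.sum_cons,
    List.sum_nil]
  push_cast at *
  linarith

lemma dvdCount_zero (l : List ℕ) (P : ℕ → Bool) : dvdCount l P 0 = 0 := by
  simp [dvdCount]

lemma dvdCount_le {t : ℕ} (ht : t = 1 ∨ t = 4 ∨ t = 7) (y : ℕ) :
    1308276133167003 * dvdCount posIndices (good t) y ≤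
      1308276133167003 * dvdCount negIndices (good t) y +
        1336649465494913 * dvdCount [47] (good 0) y +
          1308276133167003 * kernelBound t y := by
  rcases lt_or_ge y 10000 with hy | hy
  · refine le_of_kernelOk (y := 0) (f := 10000) ?_ (Nat.zero_le y) (by omega)
    rw [dvdCount_zero, dvdCount_zero, dvdCount_zero]
    rcases ht with rfl | rfl | rfl
    · decide +kernel
    · decide +kernel
    · decide +kernel
  · have hY : ∀ Y ≤ 10000, Nat.ble Y y = true := fun Y hY =>
      Nat.ble_eq_true_of_le (hY.trans hy)
    have hk : 87 ≤ kernelBound t y := by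
      rw [kernelBound, hY 61 (by norm_num), hY 70 (by norm_num), hY 109 (by norm_num),
        hY 677 (by norm_num), hY 2417 (by norm_num), hY 10000 le_rfl]
      simp only [cond_true]
      omega
    have := dvdCount_le_crude ht y
    omega

/-- The sum over `j` in the list of the sums of `log m` over the `m ≤ x / j` with `P (j * m)`. -/
noncomputable def logCount (l : List ℕ) (P : ℕ → Bool) (x : ℕ) : ℝ :=
  (l.map fun j => ∑ m ∈ (Finset.Ioc 0 (x / j)).filter (fun m => P (j * m) = true), Real.log m).sum

open ArithmeticFunction in
lemma sum_log_filter_mul_eq {j : ℕ} (hj : 0 < j) (P : ℕ → Bool) (x : ℕ) :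
    ∑ m ∈ (Finset.Ioc 0 (x / j)).filter (fun m => P (j * m) = true), Real.log m =
      ∑ d ∈ Finset.Ioc 0 x, vonMangoldt d *
        (((Finset.Ioc 0 (x / d)).filter fun k => j ∣ k ∧ P (d * k) = true).card : ℝ) := by
  rw [sum_log_filter_eq]
  have e : ∀ d, ((Finset.Ioc 0 (x / j / d)).filter fun k => P (j * (d * k)) = true).card =
      ((Finset.Ioc 0 (x / d)).filter fun k => j ∣ k ∧ P (d * k) = true).card := fun d => by
    rw [card_filter_dvd hj (fun k => P (d * k)), Nat.div_div_eq_div_mul, mul_comm j d,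
      ← Nat.div_div_eq_div_mul]
    simp_rw [mul_left_comm j d]
  simp_rw [e]
  refine Finset.sum_subset (Finset.Ioc_subset_Ioc_right (Nat.div_le_self x j)) fun d hd hd' => ?_
  rw [Finset.mem_Ioc] at hd hd'
  rw [← e, Nat.div_eq_of_lt (by omega)]
  simp

lemma good_mul {t d : ℕ} (ht : t = 0 ∨ t = 1 ∨ t = 4 ∨ t = 7) (hd : d % 3 ≠ 0) (k : ℕ) :
    good t (d * k) = good (t * d ^ 4 % 9) k := by
  have h : ∀ a < 9, a % 3 ≠ 0 → ∀ b < 9, ∀ s ∈ [0, 1, 4, 7],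
      good s (b * a) = good (s * a ^ 4 % 9) b := by decide
  have h1 := h (d % 9) (Nat.mod_lt _ (by norm_num)) (by omega) (k % 9)
    (Nat.mod_lt _ (by norm_num)) t (by simpa using ht)
  have e : t * (d % 9) ^ 4 % 9 = t * d ^ 4 % 9 :=
    Nat.ModEq.mul_left t ((Nat.mod_modEq d 9).pow 4)
  have e2 : ∀ s, good s (k % 9) = good s k := fun s => by
    simpa using good_mod_nine s 1 k
  rw [good_mod_nine, mul_comm, good_mod_nine, e, e2] at h1
  exact h1

lemma good_mul_of_dvd {d : ℕ} (t : ℕ) (hd : d % 3 = 0) (k : ℕ) : good t (d * k) = false := by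
  rw [good, Nat.mul_mod, hd, zero_mul]
  rfl

open ArithmeticFunction in
lemma logCount_eq {t : ℕ} (ht : t = 0 ∨ t = 1 ∨ t = 4 ∨ t = 7) {l : List ℕ}
    (hl : ∀ j ∈ l, 0 < j) (x : ℕ) :
    logCount l (good t) x = ∑ d ∈ (Finset.Ioc 0 x).filter (· % 3 ≠ 0),
      vonMangoldt d * (dvdCount l (good (t * d ^ 4 % 9)) (x / d) : ℝ) := by
  induction l with
  | nil => simp [logCount, dvdCount]
  | cons j l ih =>
    have h := ih fun i hi => hl i (List.mem_cons_of_mem j hi)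
    rw [logCount] at h ⊢
    rw [List.map_cons, List.sum_cons, h, sum_log_filter_mul_eq (hl j List.mem_cons_self),
      ← Finset.sum_filter_add_sum_filter_not (Finset.Ioc 0 x) (· % 3 ≠ 0), add_right_comm,
      ← Finset.sum_add_distrib]
    have h0 : ∑ d ∈ (Finset.Ioc 0 x).filter (¬ · % 3 ≠ 0), vonMangoldt d *
        (((Finset.Ioc 0 (x / d)).filter fun k => j ∣ k ∧ good t (d * k) = true).card : ℝ) = 0 := by
      refine Finset.sum_eq_zero fun d hd => ?_
      rw [Finset.mem_filter, not_not] at hd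
      simp [good_mul_of_dvd t hd.2]
    rw [h0, add_zero]
    refine Finset.sum_congr rfl fun d hd => ?_
    rw [Finset.mem_filter] at hd
    simp only [good_mul ht hd.2, dvdCount, List.map_cons, List.sum_cons, Nat.cast_add, mul_add]

/-- The sum of `log p` over the good primes `p ≤ x`. -/
noncomputable def thetaGood (t x : ℕ) : ℝ :=
  ∑ p ∈ (Finset.Ioc 0 x).filter (fun p => p.Prime ∧ good t p = true), Real.log p

open ArithmeticFunction in
lemma sum_vonMangoldt_cond {Y : ℕ} (hY : 0 < Y) (c x : ℕ) :
    ∑ d ∈ Finset.Ioc 0 x, vonMangoldt d * ((cond (Nat.ble Y (x / d)) c 0 : ℕ) : ℝ) =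
      c * Chebyshev.psi ((x / Y : ℕ) : ℝ) := by
  rw [Chebyshev.psi, Nat.floor_natCast, Finset.mul_sum, eq_comm]
  refine Finset.sum_subset_zero_on_sdiff (Finset.Ioc_subset_Ioc_right (Nat.div_le_self x Y))
    (fun d hd => ?_) fun d hd => ?_
  · rw [Finset.mem_sdiff, Finset.mem_Ioc, Finset.mem_Ioc] at hd
    have : Nat.ble Y (x / d) = false := by
      rw [← Bool.not_eq_true]
      intro h
      have h := Nat.le_of_ble_eq_true h
      rw [Nat.le_div_iff_mul_le hd.1.1, mul_comm, ← Nat.le_div_iff_mul_le hY] at h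
      omega
    rw [this]; simp
  · rw [Finset.mem_Ioc] at hd
    have : Nat.ble Y (x / d) = true := by
      apply Nat.ble_eq_true_of_le
      rw [Nat.le_div_iff_mul_le hd.1, mul_comm, ← Nat.le_div_iff_mul_le hY]
      exact hd.2
    rw [this, cond_true, mul_comm]

open ArithmeticFunction in
lemma sum_vonMangoldt_good_le {t : ℕ} (ht : t = 1 ∨ t = 4 ∨ t = 7) (x : ℕ) :
    ∑ d ∈ (Finset.Ioc 0 x).filter (· % 3 ≠ 0),
      vonMangoldt d * ((cond (Nat.beq (t * d ^ 4 % 9) 1) 0 1 : ℕ) : ℝ) ≤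
        thetaGood t x + (Chebyshev.psi x - Chebyshev.theta x) := by
  have h1 : Chebyshev.psi x - Chebyshev.theta x =
      ∑ d ∈ (Finset.Ioc 0 x).filter (¬ Nat.Prime ·), vonMangoldt d := by
    rw [Chebyshev.psi, Chebyshev.theta, Nat.floor_natCast,
      ← Finset.sum_filter_add_sum_filter_not (Finset.Ioc 0 x) Nat.Prime]
    rw [Finset.sum_congr rfl fun p hp => vonMangoldt_apply_prime (Finset.mem_filter.1 hp).2]
    ring
  rw [h1, ← Finset.sum_filter_add_sum_filter_not _ Nat.Prime, Finset.filter_filter,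
    Finset.filter_filter]
  refine add_le_add ?_ ?_
  · rw [thetaGood, Finset.sum_filter, Finset.sum_filter]
    refine Finset.sum_le_sum fun d _ => ?_
    by_cases hd : d % 3 ≠ 0 ∧ d.Prime
    · have hg := good_mul (Or.inr ht) hd.1 1
      rw [mul_one] at hg
      have hs : good (t * d ^ 4 % 9) 1 = !(Nat.beq (t * d ^ 4 % 9) 1) := by
        have : ∀ s < 9, good s 1 = !(Nat.beq s 1) := by decide
        exact this _ (Nat.mod_lt _ (by norm_num))
      rw [if_pos hd, vonMangoldt_apply_prime hd.2, hg, hs]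
      cases Nat.beq (t * d ^ 4 % 9) 1 <;> simp [hd.2]
    · rw [if_neg hd]
      split_ifs
      · exact Real.log_natCast_nonneg d
      · exact le_rfl
  · calc _ ≤ ∑ d ∈ (Finset.Ioc 0 x).filter (fun d => d % 3 ≠ 0 ∧ ¬ d.Prime), vonMangoldt d := by
          refine Finset.sum_le_sum fun d _ => ?_
          refine mul_le_of_le_one_right vonMangoldt_nonneg ?_
          cases Nat.beq (t * d ^ 4 % 9) 1 <;> simp
      _ ≤ _ := Finset.sum_le_sum_of_subset_of_nonneg
          (Finset.monotone_filter_right _ fun d _ h => h.2) fun _ _ _ => vonMangoldt_nonneg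

open ArithmeticFunction in
lemma logCount_le {t : ℕ} (ht : t = 1 ∨ t = 4 ∨ t = 7) (x : ℕ) :
    logCount posIndices (good t) x ≤ logCount negIndices (good t) x +
      1336649465494913 / 1308276133167003 * logCount [47] (good 0) x + thetaGood t x +
      (Chebyshev.psi x - Chebyshev.theta x) +
      (Chebyshev.psi ((x / 61 : ℕ) : ℝ) + Chebyshev.psi ((x / 70 : ℕ) : ℝ) +
        Chebyshev.psi ((x / 109 : ℕ) : ℝ) + Chebyshev.psi ((x / 677 : ℕ) : ℝ) +
        Chebyshev.psi ((x / 2417 : ℕ) : ℝ) + 82 * Chebyshev.psi ((x / 10000 : ℕ) : ℝ)) := by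
  have hpos : ∀ j ∈ posIndices, 0 < j := by decide
  have hneg : ∀ j ∈ negIndices, 0 < j := by decide
  have hs : ∀ {Y : ℕ} (_ : 0 < Y) (c : ℕ), ∑ d ∈ (Finset.Ioc 0 x).filter (· % 3 ≠ 0),
      vonMangoldt d * ((cond (Nat.ble Y (x / d)) c 0 : ℕ) : ℝ) ≤
        c * Chebyshev.psi ((x / Y : ℕ) : ℝ) := fun hY c => by
    rw [← sum_vonMangoldt_cond hY]
    exact Finset.sum_le_sum_of_subset_of_nonneg (Finset.filter_subset _ _) fun _ _ _ =>
      mul_nonneg vonMangoldt_nonneg (Nat.cast_nonneg _)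
  have h0 := sum_vonMangoldt_good_le ht x
  have h1 := hs (by norm_num : 0 < 61) 1
  have h2 := hs (by norm_num : 0 < 70) 1
  have h3 := hs (by norm_num : 0 < 109) 1
  have h4 := hs (by norm_num : 0 < 677) 1
  have h5 := hs (by norm_num : 0 < 2417) 1
  have h6 := hs (by norm_num : 0 < 10000) 82
  have key : ∑ d ∈ (Finset.Ioc 0 x).filter (· % 3 ≠ 0),
      vonMangoldt d * (dvdCount posIndices (good (t * d ^ 4 % 9)) (x / d) : ℝ) ≤
      ∑ d ∈ (Finset.Ioc 0 x).filter (· % 3 ≠ 0),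
      (vonMangoldt d * (dvdCount negIndices (good (t * d ^ 4 % 9)) (x / d) : ℝ) +
      1336649465494913 / 1308276133167003 *
        (vonMangoldt d * (dvdCount [47] (good (0 * d ^ 4 % 9)) (x / d) : ℝ)) +
      vonMangoldt d * (kernelBound (t * d ^ 4 % 9) (x / d) : ℝ)) := by
    refine Finset.sum_le_sum fun d hd => ?_
    rw [Finset.mem_filter] at hd
    have htd : t * d ^ 4 % 9 = 1 ∨ t * d ^ 4 % 9 = 4 ∨ t * d ^ 4 % 9 = 7 := by
      have h : ∀ a < 9, a % 3 ≠ 0 → ∀ s ∈ [1, 4, 7],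
        s * a ^ 4 % 9 = 1 ∨ s * a ^ 4 % 9 = 4 ∨ s * a ^ 4 % 9 = 7 := by decide
      have e : t * (d % 9) ^ 4 % 9 = t * d ^ 4 % 9 :=
        Nat.ModEq.mul_left t ((Nat.mod_modEq d 9).pow 4)
      rw [← e]
      exact h (d % 9) (Nat.mod_lt _ (by norm_num)) (by omega) t (by simpa using ht)
    have h := (Nat.cast_le (α := ℝ)).2 (dvdCount_le htd (x / d))
    push_cast at h
    rw [zero_mul, Nat.zero_mod]
    have hL : 0 ≤ vonMangoldt d := vonMangoldt_nonneg
    have := mul_le_mul_of_nonneg_left h hL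
    linarith
  rw [logCount_eq (Or.inr ht) hpos, logCount_eq (Or.inr ht) hneg,
    logCount_eq (Or.inl rfl) (by decide)]
  refine key.trans ?_
  rw [Finset.sum_add_distrib, Finset.sum_add_distrib, ← Finset.mul_sum]
  simp only [kernelBound, Nat.cast_add, mul_add, Finset.sum_add_distrib]
  push_cast at h1 h2 h3 h4 h5 h6 ⊢
  linarith

lemma log_le_mul_sqrt {a c u : ℝ} (ha : 8 ≤ a) (hau : a ≤ u) (h : Real.log a ≤ c * √a) :
    Real.log u ≤ c * √u := by
  have he : Real.exp 2 ≤ 8 := by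
    have := Real.exp_one_lt_d9
    rw [show (2 : ℝ) = 1 + 1 by norm_num, Real.exp_add]
    nlinarith [Real.exp_pos 1]
  have h1 := Real.log_div_sqrt_antitoneOn (Set.mem_ofPred_eq ▸ he.trans ha :
    a ∈ {x : ℝ | Real.exp 2 ≤ x}) (Set.mem_ofPred_eq ▸ he.trans (ha.trans hau)) hau
  simp only at h1
  rw [div_le_iff₀ (Real.sqrt_pos.2 (by linarith))] at h1
  refine h1.trans (mul_le_mul_of_nonneg_right ?_ (Real.sqrt_nonneg u))
  rwa [div_le_iff₀ (Real.sqrt_pos.2 (by linarith))]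

lemma mul_log_two_le {a b p : ℕ} (h : 2 ^ a ≤ p ^ b) : a * Real.log 2 ≤ b * Real.log p := by
  rw [← Real.log_pow, ← Real.log_pow]
  exact Real.log_le_log (by positivity) (by exact_mod_cast h)

lemma le_mul_log_two {a b p : ℕ} (hp : 0 < p) (h : p ^ b ≤ 2 ^ a) :
    b * Real.log p ≤ a * Real.log 2 := by
  rw [← Real.log_pow, ← Real.log_pow]
  exact Real.log_le_log (by positivity) (by exact_mod_cast h)

set_option exponentiation.threshold 1000 in
lemma log_le_sqrt {x : ℝ} (hx : 163000000 ≤ x) : Real.log x ≤ 0.0015 * √x := by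
  refine log_le_mul_sqrt (by norm_num) hx ?_
  have h1 := le_mul_log_two (a := 683) (b := 25) (p := 163000000) (by norm_num)
    (by norm_num)
  have h2 := Real.log_two_lt_d9
  have h3 : (12767 : ℝ) ≤ √163000000 := Real.le_sqrt_of_sq_le (by norm_num)
  push_cast at h1
  linarith

lemma psi_div_le {x Y : ℕ} (hY : 0 < Y) (hx : 16300 * Y ≤ x) :
    Chebyshev.psi ((x / Y : ℕ) : ℝ) ≤ 1.55 * x / Y := by
  have hu : (16300 : ℝ) ≤ (x / Y : ℕ) := by
    exact_mod_cast (Nat.le_div_iff_mul_le hY).2 hx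
  have hux : ((x / Y : ℕ) : ℝ) ≤ x / Y := Nat.cast_div_le
  have h1 := Chebyshev.psi_le (x := ((x / Y : ℕ) : ℝ)) (by linarith)
  have h2 : Real.log ((x / Y : ℕ) : ℝ) ≤ 0.0763 * √((x / Y : ℕ) : ℝ) := by
    refine log_le_mul_sqrt (by norm_num) hu ?_
    have h1 := le_mul_log_two (a := 140) (b := 10) (p := 16300) (by norm_num) (by norm_num)
    have h2 := Real.log_two_lt_d9
    have h3 : (127.6 : ℝ) ≤ √16300 := Real.le_sqrt_of_sq_le (by norm_num)
    push_cast at h1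
    linarith
  have h3 := Real.log_two_lt_d9
  have h4 : Real.log 4 = 2 * Real.log 2 := by
    rw [show (4 : ℝ) = 2 ^ 2 by norm_num, Real.log_pow]; norm_num
  have h5 := Real.mul_self_sqrt (Nat.cast_nonneg (α := ℝ) (x / Y))
  have h6 := mul_le_mul_of_nonneg_left h2 (Real.sqrt_nonneg ((x / Y : ℕ) : ℝ))
  rw [h4] at h1
  have h7 : Real.log 2 * ((x / Y : ℕ) : ℝ) ≤ 0.6931471808 * ((x / Y : ℕ) : ℝ) :=
    mul_le_mul_of_nonneg_right h3.le (Nat.cast_nonneg _)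
  rw [mul_div_assoc]
  linarith

lemma sum_log_filter_bounds {K c j : ℕ} (hK : 0 < K) (hj : 0 < j) {P : ℕ → Bool}
    (hP : ∀ m, P (j * (m % K)) = P (j * m))
    (hc : ((Finset.range K).filter fun r => P (j * r) = true).card = c) {x : ℕ} (hx : j ≤ x) :
    c * ((x / j * (Real.log x - Real.log j) - x / j + 1) / K - 2 * Real.log x) ≤
      ∑ m ∈ (Finset.Ioc 0 (x / j)).filter (fun m => P (j * m) = true), Real.log m ∧
    ∑ m ∈ (Finset.Ioc 0 (x / j)).filter (fun m => P (j * m) = true), Real.log m ≤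
      c * ((x / j * (Real.log x - Real.log j) - x / j + 1) / K + Real.log x) := by
  have hj0 : (0 : ℝ) < j := by exact_mod_cast hj
  have hx0 : (0 : ℝ) < x := by exact_mod_cast hj.trans_le hx
  have hy : (1 : ℝ) ≤ x / j := by
    rw [le_div_iff₀ hj0, one_mul]; exact_mod_cast hx
  have hlog : Real.log (x / j) = Real.log x - Real.log j := Real.log_div hx0.ne' hj0.ne'
  have hlj := Real.log_natCast_nonneg j
  have hfl : ⌊(x : ℝ) / j⌋₊ = x / j := by rw [Nat.floor_div_natCast, Nat.floor_natCast]
  rw [sum_filter_eq_sum_mod hK (P := fun m => P (j * m)) hP, ← hc, ← nsmul_eq_mul,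
    ← nsmul_eq_mul, ← Finset.sum_const, ← Finset.sum_const]
  constructor
  · refine Finset.sum_le_sum fun r hr => ?_
    rw [Finset.mem_filter, Finset.mem_range] at hr
    have := le_logSum_floor hr.1 hy
    rw [hfl, logIntegral, hlog, logSum] at this
    linarith
  · refine Finset.sum_le_sum fun r hr => ?_
    rw [Finset.mem_filter, Finset.mem_range] at hr
    have := logSum_floor_le hr.1 hy
    rw [hfl, logIntegral, hlog, logSum] at this
    linarith

set_option exponentiation.threshold 1000 in
lemma le_sum_sub_sum {S : ℕ → ℝ} {T x L : ℝ} (hx : 0 ≤ x) (hL : 1 ≤ L)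
    (hS : ∀ j : ℕ, 0 < j → j % 3 ≠ 0 → j < 100 →
      (4 : ℕ) * ((x / j * (L - Real.log j) - x / j + 1) / (9 : ℕ) - 2 * L) ≤ S j ∧
        S j ≤ (4 : ℕ) * ((x / j * (L - Real.log j) - x / j + 1) / (9 : ℕ) + L))
    (hT : T ≤ (2 : ℕ) * ((x / (47 : ℕ) * (L - Real.log (47 : ℕ)) - x / (47 : ℕ) + 1) / (3 : ℕ) + L)) :
    0.649 * x - 125 * L ≤ (posIndices.map S).sum - (negIndices.map S).sum -
      1336649465494913 / 1308276133167003 * T := by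
  have hb1 := (hS 1 (by norm_num) (by norm_num) (by norm_num)).1
  have hb10 := (hS 10 (by norm_num) (by norm_num) (by norm_num)).1
  have hb14 := (hS 14 (by norm_num) (by norm_num) (by norm_num)).1
  have hb22 := (hS 22 (by norm_num) (by norm_num) (by norm_num)).1
  have hb26 := (hS 26 (by norm_num) (by norm_num) (by norm_num)).1
  have hb34 := (hS 34 (by norm_num) (by norm_num) (by norm_num)).1
  have hb35 := (hS 35 (by norm_num) (by norm_num) (by norm_num)).1
  have hb38 := (hS 38 (by norm_num) (by norm_num) (by norm_num)).1
  have hb2 := (hS 2 (by norm_num) (by norm_num) (by norm_num)).2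
  have hb5 := (hS 5 (by norm_num) (by norm_num) (by norm_num)).2
  have hb7 := (hS 7 (by norm_num) (by norm_num) (by norm_num)).2
  have hb11 := (hS 11 (by norm_num) (by norm_num) (by norm_num)).2
  have hb13 := (hS 13 (by norm_num) (by norm_num) (by norm_num)).2
  have hb17 := (hS 17 (by norm_num) (by norm_num) (by norm_num)).2
  have hb19 := (hS 19 (by norm_num) (by norm_num) (by norm_num)).2
  have hb23 := (hS 23 (by norm_num) (by norm_num) (by norm_num)).2
  have hb29 := (hS 29 (by norm_num) (by norm_num) (by norm_num)).2
  have hb31 := (hS 31 (by norm_num) (by norm_num) (by norm_num)).2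
  have hb37 := (hS 37 (by norm_num) (by norm_num) (by norm_num)).2
  have hb41 := (hS 41 (by norm_num) (by norm_num) (by norm_num)).2
  have hb43 := (hS 43 (by norm_num) (by norm_num) (by norm_num)).2
  have h2 := Real.log_two_gt_d9
  have h5 := mul_log_two_le (a := 232) (b := 100) (p := 5) (by norm_num)
  have h7 := mul_log_two_le (a := 280) (b := 100) (p := 7) (by norm_num)
  have h11 := mul_log_two_le (a := 345) (b := 100) (p := 11) (by norm_num)
  have h13 := mul_log_two_le (a := 370) (b := 100) (p := 13) (by norm_num)
  have h17 := mul_log_two_le (a := 408) (b := 100) (p := 17) (by norm_num)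
  have h19 := mul_log_two_le (a := 424) (b := 100) (p := 19) (by norm_num)
  have h23 := mul_log_two_le (a := 452) (b := 100) (p := 23) (by norm_num)
  have h29 := mul_log_two_le (a := 485) (b := 100) (p := 29) (by norm_num)
  have h31 := mul_log_two_le (a := 495) (b := 100) (p := 31) (by norm_num)
  have h37 := mul_log_two_le (a := 520) (b := 100) (p := 37) (by norm_num)
  have h41 := mul_log_two_le (a := 535) (b := 100) (p := 41) (by norm_num)
  have h43 := mul_log_two_le (a := 542) (b := 100) (p := 43) (by norm_num)
  have h47 := mul_log_two_le (a := 555) (b := 100) (p := 47) (by norm_num)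
  push_cast at hb1 hb10 hb14 hb22 hb26 hb34 hb35 hb38 hb2 hb5 hb7 hb11 hb13 hb17 hb19 hb23 hb29 hb31 hb37 hb41 hb43 hT h5 h7 h11 h13 h17 h19 h23 h29 h31 h37 h41 h43 h47
  have e10 : Real.log 10 = Real.log 2 + Real.log 5 := by
    rw [← Real.log_mul (by norm_num) (by norm_num)]; norm_num
  rw [e10] at hb10
  have e14 : Real.log 14 = Real.log 2 + Real.log 7 := by
    rw [← Real.log_mul (by norm_num) (by norm_num)]; norm_num
  rw [e14] at hb14
  have e22 : Real.log 22 = Real.log 2 + Real.log 11 := by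
    rw [← Real.log_mul (by norm_num) (by norm_num)]; norm_num
  rw [e22] at hb22
  have e26 : Real.log 26 = Real.log 2 + Real.log 13 := by
    rw [← Real.log_mul (by norm_num) (by norm_num)]; norm_num
  rw [e26] at hb26
  have e34 : Real.log 34 = Real.log 2 + Real.log 17 := by
    rw [← Real.log_mul (by norm_num) (by norm_num)]; norm_num
  rw [e34] at hb34
  have e35 : Real.log 35 = Real.log 5 + Real.log 7 := by
    rw [← Real.log_mul (by norm_num) (by norm_num)]; norm_num
  rw [e35] at hb35
  have e38 : Real.log 38 = Real.log 2 + Real.log 19 := by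
    rw [← Real.log_mul (by norm_num) (by norm_num)]; norm_num
  rw [e38] at hb38
  rw [Real.log_one] at hb1
  have m2 : 0.6931 * x ≤ Real.log 2 * x :=
    mul_le_mul_of_nonneg_right (by linarith) hx
  have m5 : 1.6081 * x ≤ Real.log 5 * x :=
    mul_le_mul_of_nonneg_right (by linarith) hx
  have m7 : 1.9408 * x ≤ Real.log 7 * x :=
    mul_le_mul_of_nonneg_right (by linarith) hx
  have m11 : 2.3913 * x ≤ Real.log 11 * x :=
    mul_le_mul_of_nonneg_right (by linarith) hx
  have m13 : 2.5646 * x ≤ Real.log 13 * x :=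
    mul_le_mul_of_nonneg_right (by linarith) hx
  have m17 : 2.828 * x ≤ Real.log 17 * x :=
    mul_le_mul_of_nonneg_right (by linarith) hx
  have m19 : 2.9389 * x ≤ Real.log 19 * x :=
    mul_le_mul_of_nonneg_right (by linarith) hx
  have m23 : 3.133 * x ≤ Real.log 23 * x :=
    mul_le_mul_of_nonneg_right (by linarith) hx
  have m29 : 3.3617 * x ≤ Real.log 29 * x :=
    mul_le_mul_of_nonneg_right (by linarith) hx
  have m31 : 3.431 * x ≤ Real.log 31 * x :=
    mul_le_mul_of_nonneg_right (by linarith) hx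
  have m37 : 3.6043 * x ≤ Real.log 37 * x :=
    mul_le_mul_of_nonneg_right (by linarith) hx
  have m41 : 3.7083 * x ≤ Real.log 41 * x :=
    mul_le_mul_of_nonneg_right (by linarith) hx
  have m43 : 3.7568 * x ≤ Real.log 43 * x :=
    mul_le_mul_of_nonneg_right (by linarith) hx
  have m47 : 3.8469 * x ≤ Real.log 47 * x :=
    mul_le_mul_of_nonneg_right (by linarith) hx
  clear hS
  simp only [posIndices, negIndices, List.map_cons, List.map_nil, List.sum_cons,
    List.sum_nil]
  linarith

lemma le_logCount_sub {t x : ℕ} (ht : t = 1 ∨ t = 4 ∨ t = 7) (hx : 163000000 ≤ x) :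
    0.649 * x - 125 * Real.log x ≤ logCount posIndices (good t) x -
      logCount negIndices (good t) x -
        1336649465494913 / 1308276133167003 * logCount [47] (good 0) x := by
  have hX : (163000000 : ℝ) ≤ x := by exact_mod_cast hx
  have hL : 1 ≤ Real.log x := by
    rw [Real.le_log_iff_exp_le (by linarith)]
    linarith [Real.exp_one_lt_d9]
  have hc := sum_log_filter_bounds (K := 3) (j := 47) (c := 2) (by norm_num) (by norm_num)
    (P := good 0) (fun m => by
      rw [← good_zero_mod_three, ← good_zero_mod_three (47 * m), Nat.mul_mod_mod])
    (by decide) (show 47 ≤ x by omega)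
  rw [show logCount [47] (good 0) x = _ from List.sum_singleton]
  exact le_sum_sub_sum (by linarith) hL (fun j hj hj3 hj100 =>
    sum_log_filter_bounds (by norm_num) hj (good_mod_nine t j) (card_good ht hj3)
      (show j ≤ x by omega)) hc.2

lemma le_thetaGood {t x : ℕ} (ht : t = 1 ∨ t = 4 ∨ t = 7) (hx : 163000000 ≤ x) :
    0.568 * x ≤ thetaGood t x := by
  have hX : (163000000 : ℝ) ≤ x := by exact_mod_cast hx
  have h1 := le_logCount_sub ht hx
  have h2 := logCount_le ht x
  have h3 := Chebyshev.psi_sub_theta_le (x := (x : ℝ)) (by linarith)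
  have p1 := psi_div_le (x := x) (by norm_num : 0 < 61) (by omega)
  have p2 := psi_div_le (x := x) (by norm_num : 0 < 70) (by omega)
  have p3 := psi_div_le (x := x) (by norm_num : 0 < 109) (by omega)
  have p4 := psi_div_le (x := x) (by norm_num : 0 < 677) (by omega)
  have p5 := psi_div_le (x := x) (by norm_num : 0 < 2417) (by omega)
  have p6 := psi_div_le (x := x) (by norm_num : 0 < 10000) (by omega)
  have hl := log_le_sqrt hX
  have hs := Real.mul_self_sqrt (by linarith : (0 : ℝ) ≤ x)
  have hs0 : (10000 : ℝ) ≤ √(x : ℝ) := Real.le_sqrt_of_sq_le (by linarith)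
  have hsl := mul_le_mul_of_nonneg_left hl (Real.sqrt_nonneg (x : ℝ))
  have hlx : 125 * Real.log x ≤ 0.0001 * x := by nlinarith
  push_cast at p1 p2 p3 p4 p5 p6
  linarith

lemma good_mod_eighteen (t m : ℕ) : good t (m % 18) = good t m := by
  have h := good_mod_nine t 1
  simp only [one_mul] at h
  rw [← h (m % 18), ← h m, Nat.mod_mod_of_dvd m (by norm_num : 9 ∣ 18)]

/-- The residues modulo `18 * w` coprime to `6` that are good and congruent to `± a` modulo `w`. -/
def goodClasses (t w a : ℕ) : Finset ℕ :=
  (Finset.range (18 * w)).filter fun r =>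
    Nat.Coprime r 18 ∧ good t r = true ∧ (r ≡ a [MOD w] ∨ w ∣ r + a)

lemma card_goodClasses_le {t w : ℕ} (ht : t = 1 ∨ t = 4 ∨ t = 7) (hw : Nat.Coprime 18 w) (a : ℕ) :
    (goodClasses t w a).card ≤ 8 := by
  have hcard : ((Finset.range 18).filter fun r => Nat.Coprime r 18 ∧ good t r = true).card = 4 := by
    rcases ht with rfl | rfl | rfl <;> decide
  have hpair : ({a % w, (w - a % w) % w} : Finset ℕ).card ≤ 2 := Finset.card_le_two
  calc (goodClasses t w a).card
      ≤ (((Finset.range 18).filter fun r => Nat.Coprime r 18 ∧ good t r = true) ×ˢ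
          ({a % w, (w - a % w) % w} : Finset ℕ)).card := by
        apply Finset.card_le_card_of_injOn (fun r => (r % 18, r % w))
        · intro r hr
          have hr := Finset.mem_coe.1 hr
          rw [goodClasses, Finset.mem_filter, Finset.mem_range] at hr
          obtain ⟨hlt, hc, hg, h⟩ := hr
          rw [Finset.mem_coe, Finset.mem_product]
          refine ⟨Finset.mem_filter.2 ⟨Finset.mem_range.2 (Nat.mod_lt _ (by norm_num)), ?_, ?_⟩, ?_⟩
          · exact (Nat.mod_modEq r 18).gcd_eq.trans hc
          · rwa [good_mod_eighteen]
          · rw [Finset.mem_insert, Finset.mem_singleton]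
            refine h.imp id fun h => ?_
            have hw0 : 0 < w := Nat.pos_of_ne_zero fun h0 => by subst h0; omega
            refine Nat.ModEq.add_right_cancel' (a % w) ?_
            rw [Nat.sub_add_cancel (Nat.mod_lt a hw0).le]
            refine ((Nat.mod_modEq a w).add_left r).trans ?_
            rw [Nat.ModEq, Nat.mod_self]
            exact Nat.mod_eq_zero_of_dvd h
        · intro r hr s hs hrs
          have hr := Finset.mem_coe.1 hr
          have hs := Finset.mem_coe.1 hs
          rw [goodClasses, Finset.mem_filter, Finset.mem_range] at hr hs
          obtain ⟨h1, h2⟩ := Prod.mk.inj hrs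
          have h3 : r ≡ s [MOD 18 * w] := (Nat.modEq_and_modEq_iff_modEq_mul hw).1 ⟨h1, h2⟩
          exact Nat.ModEq.eq_of_lt_of_lt h3 hr.1 hs.1
    _ ≤ 8 := by rw [Finset.card_product, hcard]; omega

lemma sum_badPrimes_filter_le {n P q t : ℕ} (ht : t = 1 ∨ t = 4 ∨ t = 7) (hP : P ^ 2 < n)
    (hq : q.Prime) (hq5 : 5 ≤ q) (hqn : ¬ q ∣ n) :
    ∑ p ∈ (badPrimes n P q).filter (fun p => good t p = true), Real.log p ≤
      8 * (P / (18 * q ^ 2 : ℕ) * ((Real.log (18 * q ^ 2 : ℕ) + logWeight (18 * q ^ 2)) *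
        (1 + 1 / (18 * q ^ 2 : ℕ)) + Real.log 4 / (18 * q ^ 2 : ℕ)) + 6 * Real.log P) := by
  set B : ℝ := P / (18 * q ^ 2 : ℕ) * ((Real.log (18 * q ^ 2 : ℕ) + logWeight (18 * q ^ 2)) *
        (1 + 1 / (18 * q ^ 2 : ℕ)) + Real.log 4 / (18 * q ^ 2 : ℕ)) + 6 * Real.log P with hB
  have hB0 : 0 ≤ B := by
    have h1 := Real.log_natCast_nonneg P
    have h2 := Real.log_natCast_nonneg (18 * q ^ 2)
    have h3 := logWeight_nonneg (18 * q ^ 2)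
    have h4 : 0 ≤ Real.log 4 := Real.log_nonneg (by norm_num)
    positivity
  have hmem : ∀ p ∈ badPrimes n P q, Nat.Coprime p (18 * q ^ 2) := by
    intro p hp
    simp only [badPrimes, Finset.mem_filter, Finset.mem_Icc] at hp
    obtain ⟨⟨h5, hpP⟩, hpp, hpn, hd⟩ := hp
    have hlt : p ^ 2 < n := lt_of_le_of_lt (Nat.pow_le_pow_left hpP 2) hP
    rw [Nat.Prime.coprime_iff_not_dvd hpp, show 18 = 2 * 3 ^ 2 by norm_num]
    intro h
    rcases (Nat.Prime.dvd_mul hpp).1 h with h | h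
    · rcases (Nat.Prime.dvd_mul hpp).1 h with h | h
      · have := Nat.le_of_dvd (by norm_num) h; omega
      · have := Nat.le_of_dvd (by norm_num) (hpp.dvd_of_dvd_pow h); omega
    · obtain rfl := (Nat.prime_dvd_prime_iff_eq hpp hq).1 (hpp.dvd_of_dvd_pow h)
      exact hqn ((Nat.dvd_sub_iff_left hlt.le (dvd_pow_self p two_ne_zero)).1
        ((dvd_pow_self p two_ne_zero).trans hd))
  have hcop : Nat.Coprime 18 (q ^ 2) := by
    refine Nat.Coprime.pow_right 2 ((Nat.Prime.coprime_iff_not_dvd hq).2 fun h => ?_).symm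
    rw [show 18 = 2 * 3 ^ 2 by norm_num] at h
    rcases (Nat.Prime.dvd_mul hq).1 h with h | h
    · have := Nat.le_of_dvd (by norm_num) h; omega
    · have := Nat.le_of_dvd (by norm_num) (hq.dvd_of_dvd_pow h); omega
  rcases (badPrimes n P q).eq_empty_or_nonempty with he | ⟨a, ha⟩
  · rw [he, Finset.filter_empty, Finset.sum_empty]; linarith
  have hsub : (badPrimes n P q).filter (fun p => good t p = true) ⊆
      ((goodClasses t (q ^ 2) a).filter (Nat.Coprime · (18 * q ^ 2))).biUnion fun r =>
        (Finset.Ioc 0 P).filter fun p => p.Prime ∧ p % (18 * q ^ 2) = r := by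
    intro p hp
    rw [Finset.mem_filter] at hp
    obtain ⟨hp, hg⟩ := hp
    have hc := hmem p hp
    have hac := badPrimes_congr hP hq (by omega) hqn hp ha
    simp only [badPrimes, Finset.mem_filter, Finset.mem_Icc] at hp
    simp only [Finset.mem_biUnion, Finset.mem_filter, Finset.mem_Ioc, goodClasses,
      Finset.mem_range]
    refine ⟨p % (18 * q ^ 2), ⟨⟨Nat.mod_lt _ (by positivity), ?_, ?_, ?_⟩, ?_⟩,
      ⟨by omega, hp.1.2⟩, hp.2.1, rfl⟩
    · rw [Nat.Coprime, ← (Nat.mod_modEq _ 18).gcd_eq, Nat.mod_mul_right_mod,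
        (Nat.mod_modEq _ 18).gcd_eq]
      exact hc.coprime_mul_right_right
    · rw [← good_mod_eighteen, Nat.mod_mul_right_mod, good_mod_eighteen]; exact hg
    · refine hac.imp (fun h => ?_) fun h => ?_
      · rw [Nat.ModEq, Nat.mod_mul_left_mod]; exact h
      · rw [Nat.dvd_iff_mod_eq_zero, Nat.add_mod, Nat.mod_mul_left_mod, ← Nat.add_mod]
        exact Nat.mod_eq_zero_of_dvd h
    · exact (Nat.mod_modEq p _).gcd_eq.trans hc
  calc _ ≤ ∑ p ∈ ((goodClasses t (q ^ 2) a).filter (Nat.Coprime · (18 * q ^ 2))).biUnion fun r =>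
        (Finset.Ioc 0 P).filter fun p => p.Prime ∧ p % (18 * q ^ 2) = r, Real.log p :=
        Finset.sum_le_sum_of_subset_of_nonneg hsub fun p _ _ => Real.log_natCast_nonneg p
    _ ≤ ∑ r ∈ (goodClasses t (q ^ 2) a).filter (Nat.Coprime · (18 * q ^ 2)),
          thetaClass (18 * q ^ 2) r P :=
        sum_biUnion_le _ _ fun p => Real.log_natCast_nonneg p
    _ ≤ ∑ r ∈ (goodClasses t (q ^ 2) a).filter (Nat.Coprime · (18 * q ^ 2)), B := by
        refine Finset.sum_le_sum fun r hr => ?_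
        rw [Finset.mem_filter, goodClasses, Finset.mem_filter, Finset.mem_range] at hr
        exact thetaClass_le hr.1.1 hr.2 P
    _ ≤ 8 * B := by
        rw [Finset.sum_const, nsmul_eq_mul]
        refine mul_le_mul_of_nonneg_right ?_ hB0
        exact_mod_cast (Finset.card_filter_le _ _).trans (card_goodClasses_le ht hcop a)

/-- The density, among the integers, with which the good primes that are bad for `q` are counted
in `sum_badPrimes_filter_le`. -/
noncomputable def classDensity (q : ℕ) : ℝ :=
  8 / (18 * q ^ 2 : ℕ) * ((Real.log (18 * q ^ 2 : ℕ) + logWeight (18 * q ^ 2)) *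
    (1 + 1 / (18 * q ^ 2 : ℕ)) + Real.log 4 / (18 * q ^ 2 : ℕ))

lemma classDensity_nonneg (q : ℕ) : 0 ≤ classDensity q := by
  have h2 := Real.log_natCast_nonneg (18 * q ^ 2)
  have h3 := logWeight_nonneg (18 * q ^ 2)
  have h4 : 0 ≤ Real.log 4 := Real.log_nonneg (by norm_num)
  rw [classDensity]
  positivity

lemma log_three_le : Real.log 3 ≤ 1.0987 := by
  have h1 := le_mul_log_two (a := 233) (b := 147) (p := 3) (by norm_num) (by norm_num)
  have h2 := Real.log_two_lt_d9
  push_cast at h1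
  linarith

lemma logWeight_eighteen_mul_sq {q : ℕ} (hq : q.Prime) (hq5 : 5 ≤ q) :
    logWeight (18 * q ^ 2) = Real.log 2 + Real.log 3 / 2 + Real.log q / (q - 1) := by
  have h18 : Nat.primeFactors 18 = {2, 3} := by
    rw [show 18 = 2 * 3 ^ 2 by norm_num, Nat.primeFactors_mul (by norm_num) (by norm_num),
      Nat.primeFactors_prime_pow two_ne_zero Nat.prime_three, Nat.prime_two.primeFactors]
    rfl
  have h : (18 * q ^ 2).primeFactors = {2, 3, q} := by
    rw [Nat.primeFactors_mul (by norm_num) (by positivity), h18,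
      Nat.primeFactors_prime_pow two_ne_zero hq]
    rfl
  rw [logWeight, h, Finset.sum_insert (by simp; omega), Finset.sum_insert (by simp; omega),
    Finset.sum_singleton]
  norm_num
  ring

lemma classDensity_le {q : ℕ} (hq : q.Prime) (hq5 : 5 ≤ q) :
    classDensity q ≤ 8 / (18 * q ^ 2) * (4.1332 + (2 + 1 / (q - 1)) * Real.log q) *
      (1 + 2 / (18 * q ^ 2)) := by
  have hq0 : (5 : ℝ) ≤ q := by exact_mod_cast hq5
  have hlog : Real.log (18 * q ^ 2 : ℕ) = Real.log 2 + 2 * Real.log 3 + 2 * Real.log q := by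
    push_cast
    rw [show (18 : ℝ) = 2 * 3 ^ 2 by norm_num, Real.log_mul (by positivity) (by positivity),
      Real.log_mul (by norm_num) (by norm_num), Real.log_pow, Real.log_pow]
    norm_num
  have h2 := Real.log_two_lt_d9
  have h2' := Real.log_two_gt_d9
  have h3 := log_three_le
  have h4 : Real.log 4 = 2 * Real.log 2 := by
    rw [show (4 : ℝ) = 2 ^ 2 by norm_num, Real.log_pow]; norm_num
  have hl : 0 ≤ (2 + 1 / ((q : ℝ) - 1)) * Real.log q :=
    mul_nonneg (add_nonneg two_pos.le (one_div_nonneg.2 (by linarith))) (Real.log_natCast_nonneg q)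
  rw [classDensity, hlog, logWeight_eighteen_mul_sq hq hq5, h4, mul_assoc]
  push_cast
  refine mul_le_mul_of_nonneg_left ?_ (by positivity)
  have hK : (0 : ℝ) ≤ 1 / (18 * (q : ℝ) ^ 2) := by positivity
  have e : Real.log 2 + 2 * Real.log 3 + 2 * Real.log q +
      (Real.log 2 + Real.log 3 / 2 + Real.log q / (q - 1)) =
      2 * Real.log 2 + 2.5 * Real.log 3 + (2 + 1 / ((q : ℝ) - 1)) * Real.log q := by ring
  rw [e, div_eq_mul_one_div (2 * Real.log 2), div_eq_mul_one_div 2 (18 * (q : ℝ) ^ 2)]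
  generalize (2 + 1 / ((q : ℝ) - 1)) * Real.log q = A at hl
  generalize 1 / (18 * (q : ℝ) ^ 2) = B at hK
  nlinarith [mul_nonneg hl hK]

/-- An upper bound for `10 ^ 9 * classDensity q`. -/
def classWeight (q : ℕ) : ℕ :=
  50000 * (41332 * 16 * (q - 1) + 6932 * (2 * q - 1) * (Nat.log2 (q ^ 16) + 1)) *
    (18 * q ^ 2 + 2) / ((q - 1) * (18 * q ^ 2) ^ 2) + 1

lemma classDensity_le_classWeight {q : ℕ} (hq : q.Prime) (hq5 : 5 ≤ q) :
    10 ^ 9 * classDensity q ≤ classWeight q := by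
  obtain ⟨r, rfl⟩ : ∃ r, q = r + 1 := ⟨q - 1, by omega⟩
  have h1 := classDensity_le hq hq5
  have h2 := le_mul_log_two (a := Nat.log2 ((r + 1) ^ 16) + 1) (b := 16) (p := r + 1)
    (by omega) Nat.lt_log2_self.le
  have h3 := Real.log_two_lt_d9
  rw [classWeight]
  have h4 := Nat.lt_div_mul_add (a := 50000 * (41332 * 16 * (r + 1 - 1) + 6932 * (2 * (r + 1) - 1) *
    (Nat.log2 ((r + 1) ^ 16) + 1)) * (18 * (r + 1) ^ 2 + 2))
    (b := (r + 1 - 1) * (18 * (r + 1) ^ 2) ^ 2) (by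
      have : 0 < r := by omega
      simp only [Nat.add_sub_cancel]; positivity)
  rw [← Nat.succ_mul, Nat.succ_eq_add_one] at h4
  rw [show 2 * (r + 1) - 1 = 2 * r + 1 by omega, Nat.add_sub_cancel] at h4 ⊢
  generalize Nat.log2 ((r + 1) ^ 16) + 1 = l at h2 h4 ⊢
  generalize _ / _ + 1 = M at h4 ⊢
  have hr : (4 : ℝ) ≤ r := by exact_mod_cast (by omega : 4 ≤ r)
  have h5 : 50000 * (41332 * 16 * (r : ℝ) + 6932 * (2 * r + 1) * l) * (18 * (r + 1) ^ 2 + 2) ≤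
      M * (r * (18 * (r + 1) ^ 2) ^ 2) := by exact_mod_cast h4.le
  have hlog : Real.log (r + 1 : ℕ) ≤ 0.6932 * l / 16 := by
    have : l * Real.log 2 ≤ l * 0.6932 :=
      mul_le_mul_of_nonneg_left (by linarith) (Nat.cast_nonneg l)
    push_cast at h2 ⊢
    linarith
  have hr0 : (0 : ℝ) < r := by linarith
  calc 10 ^ 9 * classDensity (r + 1)
      ≤ 10 ^ 9 * (8 / (18 * ((r : ℝ) + 1) ^ 2) * (4.1332 + (2 + 1 / r) * (0.6932 * l / 16)) *
        (1 + 2 / (18 * ((r : ℝ) + 1) ^ 2))) := by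
        refine mul_le_mul_of_nonneg_left (h1.trans ?_) (by norm_num)
        rw [Nat.cast_add_one, add_sub_cancel_right] at *
        gcongr
    _ = 50000 * (41332 * 16 * (r : ℝ) + 6932 * (2 * r + 1) * l) * (18 * (r + 1) ^ 2 + 2) /
        (r * (18 * (r + 1) ^ 2) ^ 2) := by
        field_simp
        ring
    _ ≤ M := by rwa [div_le_iff₀ (by positivity)]

lemma sum_classWeight_le :
    (((roughList 4000).filter (5 ≤ ·)).map classWeight).sum ≤ 358500000 := by
  decide +kernel

lemma sum_classDensity_lt_le :
    ∑ q ∈ (Finset.Ico 5 4000).filter Nat.Prime, classDensity q ≤ 0.3585 := by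
  have hnodup : ((roughList 4000).filter (5 ≤ ·)).Nodup :=
    (List.nodup_range.filter _).filter _
  have h1 : ∑ q ∈ (Finset.Ico 5 4000).filter Nat.Prime, classWeight q ≤ 358500000 := by
    refine le_trans ?_ sum_classWeight_le
    rw [← List.sum_toFinset _ hnodup]
    refine Finset.sum_le_sum_of_subset fun q hq => ?_
    rw [Finset.mem_filter, Finset.mem_Ico] at hq
    rw [List.mem_toFinset, List.mem_filter]
    exact ⟨mem_roughList hq.2 hq.1.2, by simpa using hq.1.1⟩
  have h2 : ∑ q ∈ (Finset.Ico 5 4000).filter Nat.Prime, 10 ^ 9 * classDensity q ≤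
      ((∑ q ∈ (Finset.Ico 5 4000).filter Nat.Prime, classWeight q : ℕ) : ℝ) := by
    rw [Nat.cast_sum]
    refine Finset.sum_le_sum fun q hq => ?_
    rw [Finset.mem_filter, Finset.mem_Ico] at hq
    exact classDensity_le_classWeight hq.2 hq.1.1
  rw [← Finset.mul_sum] at h2
  have h3 : ((∑ q ∈ (Finset.Ico 5 4000).filter Nat.Prime, classWeight q : ℕ) : ℝ) ≤ 358500000 := by
    exact_mod_cast h1
  linarith

lemma classDensity_le_of_le {q : ℕ} (hq : q.Prime) (hq4 : 4000 ≤ q) :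
    classDensity q ≤ 0.3 * (1 / √((q - 1 : ℕ) : ℝ) - 1 / √(q : ℝ)) := by
  have hq0 : (4000 : ℝ) ≤ q := by exact_mod_cast hq4
  have hl : Real.log q ≤ 0.1316 * √(q : ℝ) := by
    refine log_le_mul_sqrt (by norm_num) hq0 ?_
    have h1 := le_mul_log_two (a := 120) (b := 10) (p := 4000) (by norm_num) (by norm_num)
    have h2 := Real.log_two_lt_d9
    have h3 : (63.24 : ℝ) ≤ √4000 := Real.le_sqrt_of_sq_le (by norm_num)
    push_cast at h1
    linarith
  have hs : (63 : ℝ) ≤ √(q : ℝ) := Real.le_sqrt_of_sq_le (by linarith)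
  have hs1 : 0 < √((q - 1 : ℕ) : ℝ) := Real.sqrt_pos.2 (by exact_mod_cast (by omega : 0 < q - 1))
  have hsle : √((q - 1 : ℕ) : ℝ) ≤ √(q : ℝ) := Real.sqrt_le_sqrt (by exact_mod_cast Nat.sub_le q 1)
  have hsq : √(q : ℝ) ^ 2 = q := Real.sq_sqrt (by linarith)
  have hsq1 : √((q - 1 : ℕ) : ℝ) ^ 2 = q - 1 := by
    rw [Real.sq_sqrt (Nat.cast_nonneg _), Nat.cast_sub (by omega), Nat.cast_one]
  have htel : 1 / (2 * (√(q : ℝ) * q)) ≤ 1 / √((q - 1 : ℕ) : ℝ) - 1 / √(q : ℝ) := by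
    generalize √((q - 1 : ℕ) : ℝ) = b at *
    generalize √(q : ℝ) = a at *
    rw [div_sub_div _ _ (by positivity) (by positivity), one_mul, mul_one,
      div_le_div_iff₀ (by positivity) (by positivity), ← hsq]
    have h1 : (a - b) * (a + b) = 1 := by linarith [hsq, hsq1, (by ring : (a - b) * (a + b) = a ^ 2 - b ^ 2)]
    have h2 : 0 ≤ a - b := by linarith
    have h3 : 1 ≤ (a - b) * (2 * a) := by nlinarith
    have h4 : b * a ≤ a * a := by nlinarith
    nlinarith [mul_le_mul h4 h3 zero_le_one (by positivity)]
  have hmain : classDensity q ≤ 0.15 / (√(q : ℝ) * q) := by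
    refine (classDensity_le hq (by omega)).trans ?_
    have h1 : 1 / ((q : ℝ) - 1) ≤ 0.001 := by
      rw [div_le_iff₀ (by linarith)]; linarith
    have h2 : (2 + 1 / ((q : ℝ) - 1)) * Real.log q ≤ 2.001 * (0.1316 * √(q : ℝ)) :=
      mul_le_mul (by linarith) hl (Real.log_natCast_nonneg q) (by norm_num)
    have h3 : 2 / (18 * (q : ℝ) ^ 2) ≤ 0.001 := by
      rw [div_le_iff₀ (by positivity)]; nlinarith
    calc _ ≤ 8 / (18 * (q : ℝ) ^ 2) * (0.329 * √(q : ℝ)) * (1 + 0.001) := by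
          gcongr
          linarith
      _ ≤ 0.15 / (√(q : ℝ) * q) := by
          rw [le_div_iff₀ (by positivity)]
          have e : 8 / (18 * (q : ℝ) ^ 2) * (0.329 * √(q : ℝ)) * (1 + 0.001) * (√(q : ℝ) * q) =
            8 / (18 * (q : ℝ) ^ 2) * 0.329 * 1.001 * (√(q : ℝ) ^ 2 * q) := by ring
          rw [e, hsq]
          field_simp
          norm_num
  refine hmain.trans ?_
  have e : 0.15 / (√(q : ℝ) * q) = 0.3 * (1 / (2 * (√(q : ℝ) * q))) := by
    field_simp; norm_num
  rw [e]
  linarith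

lemma sum_classDensity_ge_le (z : ℕ) :
    ∑ q ∈ (Finset.Ico 4000 z).filter Nat.Prime, classDensity q ≤ 0.005 := by
  have hmono : ∀ q, 4000 ≤ q → 0 ≤ 1 / √((q - 1 : ℕ) : ℝ) - 1 / √(q : ℝ) := by
    intro q hq
    rw [sub_nonneg]
    refine one_div_le_one_div_of_le (Real.sqrt_pos.2 (by exact_mod_cast (by omega : 0 < q - 1))) ?_
    exact Real.sqrt_le_sqrt (by exact_mod_cast Nat.sub_le q 1)
  have h1 : ∑ q ∈ (Finset.Ico 4000 z).filter Nat.Prime, classDensity q ≤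
      ∑ q ∈ Finset.Ico 4000 z, 0.3 * (1 / √((q - 1 : ℕ) : ℝ) - 1 / √(q : ℝ)) := by
    refine (Finset.sum_le_sum fun q hq => ?_).trans
      (Finset.sum_le_sum_of_subset_of_nonneg (Finset.filter_subset Nat.Prime _) fun q hq _ => ?_)
    · rw [Finset.mem_filter, Finset.mem_Ico] at hq
      exact classDensity_le_of_le hq.2 hq.1.1
    · rw [Finset.mem_Ico] at hq
      exact mul_nonneg (by norm_num) (hmono q hq.1)
  refine h1.trans ?_
  rw [← Finset.mul_sum]
  rcases le_total z 4000 with hz | hz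
  · rw [Finset.Ico_eq_empty_of_le hz, Finset.sum_empty]; norm_num
  have h2 : ∑ q ∈ Finset.Ico 4000 z, (1 / √((q - 1 : ℕ) : ℝ) - 1 / √(q : ℝ)) =
      1 / √((4000 - 1 : ℕ) : ℝ) - 1 / √((z - 1 : ℕ) : ℝ) := by
    have := Finset.sum_Ico_sub (fun q : ℕ => - (1 / √((q - 1 : ℕ) : ℝ))) hz
    simp only [sub_neg_eq_add] at this
    rw [show ∀ a b : ℝ, a - b = -b + a from fun a b => by ring, ← this]
    refine Finset.sum_congr rfl fun q _ => ?_
    rw [Nat.add_sub_cancel, sub_eq_neg_add]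
  have h3 : 1 / √((4000 - 1 : ℕ) : ℝ) ≤ 1 / 63 :=
    one_div_le_one_div_of_le (by norm_num) (Real.le_sqrt_of_sq_le (by norm_num))
  have h4 : 0 ≤ 1 / √((z - 1 : ℕ) : ℝ) := one_div_nonneg.2 (Real.sqrt_nonneg _)
  rw [h2]
  linarith

lemma sum_classDensity_le (z : ℕ) :
    ∑ q ∈ (Finset.Icc 5 z).filter Nat.Prime, classDensity q ≤ 0.3635 := by
  have hsub : (Finset.Icc 5 z).filter Nat.Prime ⊆
      (Finset.Ico 5 4000).filter Nat.Prime ∪ (Finset.Ico 4000 (z + 1)).filter Nat.Prime := by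
    intro q hq
    simp only [Finset.mem_union, Finset.mem_filter, Finset.mem_Icc, Finset.mem_Ico] at hq ⊢
    rcases lt_or_ge q 4000 with h | h
    · exact Or.inl ⟨⟨hq.1.1, h⟩, hq.2⟩
    · exact Or.inr ⟨⟨h, by omega⟩, hq.2⟩
  have h1 := Finset.sum_le_sum_of_subset_of_nonneg hsub (f := classDensity)
    fun q _ _ => classDensity_nonneg q
  have h2 := h1.trans (sum_union_le _ _ classDensity_nonneg)
  have h3 := sum_classDensity_lt_le
  have h4 := sum_classDensity_ge_le (z + 1)
  linarith

lemma sum_badPrimes_le {n P q : ℕ} (hP : P ^ 2 < n) (hq : q.Prime) (hq3 : 3 ≤ q) (hqn : ¬ q ∣ n) :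
    ∑ p ∈ badPrimes n P q, Real.log p ≤ P * Real.log P * ((q : ℝ) ^ 2)⁻¹ + Real.log P := by
  have h1 : ∑ p ∈ badPrimes n P q, Real.log p ≤ ∑ p ∈ badPrimes n P q, Real.log P := by
    refine Finset.sum_le_sum fun p hp => ?_
    simp only [badPrimes, Finset.mem_filter, Finset.mem_Icc] at hp
    exact Real.log_le_log (by exact_mod_cast hp.2.1.pos) (by exact_mod_cast hp.1.2)
  rw [Finset.sum_const, nsmul_eq_mul] at h1
  have h2 : ((badPrimes n P q).card : ℝ) ≤ P * ((q : ℝ) ^ 2)⁻¹ + 1 := by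
    calc ((badPrimes n P q).card : ℝ) ≤ ((P / q ^ 2 : ℕ) : ℝ) + 1 := by
          exact_mod_cast card_badPrimes_le hP hq hq3 hqn
      _ ≤ _ := by
          have : ((P / q ^ 2 : ℕ) : ℝ) ≤ P / (q ^ 2 : ℕ) := Nat.cast_div_le
          rw [← div_eq_mul_inv]; push_cast at this ⊢; linarith
  have := mul_le_mul_of_nonneg_right h2 (Real.log_natCast_nonneg P)
  linarith

lemma card_filter_prime_mul_log_le {x Q : ℕ} (z : ℕ) (hx : 0 < x) :
    (((Finset.Ioc z Q).filter Nat.Prime).card : ℝ) * Real.log x ≤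
      √(x : ℝ) * Real.log x + 2 * Chebyshev.theta Q := by
  have hsub : (Finset.Ioc z Q).filter Nat.Prime ⊆
      Finset.Icc 1 (Nat.sqrt x) ∪ (Finset.Ioc (Nat.sqrt x) Q).filter Nat.Prime := by
    intro q hq
    simp only [Finset.mem_union, Finset.mem_filter, Finset.mem_Icc, Finset.mem_Ioc] at hq ⊢
    rcases le_or_gt q (Nat.sqrt x) with h | h
    · exact Or.inl ⟨hq.2.one_le, h⟩
    · exact Or.inr ⟨⟨h, hq.1.2⟩, hq.2⟩
  have hl := Real.log_natCast_nonneg x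
  have h1 : (((Finset.Ioc z Q).filter Nat.Prime).card : ℝ) ≤
      √(x : ℝ) + ((Finset.Ioc (Nat.sqrt x) Q).filter Nat.Prime).card := by
    have h := (Finset.card_le_card hsub).trans (Finset.card_union_le _ _)
    rw [Nat.card_Icc, Nat.add_sub_cancel] at h
    have h' : (((Finset.Ioc z Q).filter Nat.Prime).card : ℝ) ≤
      (Nat.sqrt x : ℝ) + ((Finset.Ioc (Nat.sqrt x) Q).filter Nat.Prime).card := by exact_mod_cast h
    linarith [Real.nat_sqrt_le_real_sqrt (a := x)]
  have h2 : (((Finset.Ioc (Nat.sqrt x) Q).filter Nat.Prime).card : ℝ) * Real.log x ≤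
      2 * Chebyshev.theta Q := by
    rw [Chebyshev.theta, Nat.floor_natCast, Finset.mul_sum, ← nsmul_eq_mul, ← Finset.sum_const]
    refine (Finset.sum_le_sum fun q hq => ?_).trans
      (Finset.sum_le_sum_of_subset_of_nonneg (fun q hq => ?_) fun q _ _ =>
        mul_nonneg two_pos.le (Real.log_natCast_nonneg q))
    · rw [Finset.mem_filter, Finset.mem_Ioc] at hq
      have h3 : x ≤ q ^ 2 := by
        rw [pow_two]; exact (Nat.sqrt_lt.1 hq.1.1).le
      have h4 := Real.log_le_log (x := (x : ℝ)) (y := (q : ℝ) ^ 2) (by exact_mod_cast hx)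
        (by exact_mod_cast h3)
      rw [Real.log_pow] at h4
      exact_mod_cast h4
    · rw [Finset.mem_filter, Finset.mem_Ioc] at hq ⊢
      exact ⟨⟨hq.2.pos, hq.1.2⟩, hq.2⟩
  have := mul_le_mul_of_nonneg_right h1 hl
  linarith

/-- The contribution of the primes `q` beyond `z` to the bad primes. -/
lemma sum_biUnion_badPrimes_le {n x z Q : ℕ} (hx : 0 < x) (hxn : x ^ 2 < n) (hz : 3 ≤ z)
    (hzQ : z ≤ Q) :
    ∑ p ∈ ((Finset.Ioc z Q).filter fun q => q.Prime ∧ ¬ q ∣ n).biUnion (badPrimes n x),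
        Real.log p ≤
      x * Real.log x / z + √(x : ℝ) * Real.log x + 2 * Chebyshev.theta Q := by
  have hl := Real.log_natCast_nonneg x
  have hl' : 0 ≤ x * Real.log x := mul_nonneg (Nat.cast_nonneg x) hl
  calc _ ≤ ∑ q ∈ (Finset.Ioc z Q).filter (fun q => q.Prime ∧ ¬ q ∣ n),
          ∑ p ∈ badPrimes n x q, Real.log p :=
        sum_biUnion_le _ _ fun p => Real.log_natCast_nonneg p
    _ ≤ ∑ q ∈ (Finset.Ioc z Q).filter (fun q => q.Prime ∧ ¬ q ∣ n),
          (x * Real.log x * ((q : ℝ) ^ 2)⁻¹ + Real.log x) := by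
        refine Finset.sum_le_sum fun q hq => ?_
        rw [Finset.mem_filter, Finset.mem_Ioc] at hq
        exact sum_badPrimes_le hxn hq.2.1 (by omega) hq.2.2
    _ ≤ ∑ q ∈ (Finset.Ioc z Q).filter Nat.Prime,
          (x * Real.log x * ((q : ℝ) ^ 2)⁻¹ + Real.log x) := by
        refine Finset.sum_le_sum_of_subset_of_nonneg
          (Finset.monotone_filter_right _ fun q _ h => h.1) fun q _ _ => ?_
        positivity
    _ ≤ x * Real.log x * ∑ q ∈ Finset.Ioc z Q, ((q : ℝ) ^ 2)⁻¹ +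
          ((Finset.Ioc z Q).filter Nat.Prime).card * Real.log x := by
        rw [Finset.sum_add_distrib, Finset.sum_const, nsmul_eq_mul, ← Finset.mul_sum]
        refine add_le_add_left (mul_le_mul_of_nonneg_left ?_ hl') _
        exact Finset.sum_le_sum_of_subset_of_nonneg (Finset.filter_subset _ _) fun q _ _ => by
          positivity
    _ ≤ _ := by
        have h1 := sum_Ioc_inv_sq_le_sub (α := ℝ) (by omega : z ≠ 0) hzQ
        have h2 := card_filter_prime_mul_log_le (Q := Q) z hx
        have h3 : 0 ≤ ((Q : ℝ))⁻¹ := by positivity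
        have h4 := mul_le_mul_of_nonneg_left (h1.trans (sub_le_self _ h3)) hl'
        rw [div_eq_mul_inv]
        linarith

/-- The contribution of the primes `5 ≤ q ≤ z` to the good bad primes. -/
lemma sum_biUnion_badPrimes_filter_le {n x t : ℕ} (z : ℕ) (ht : t = 1 ∨ t = 4 ∨ t = 7)
    (hxn : x ^ 2 < n) :
    ∑ p ∈ ((Finset.Icc 5 z).filter fun q => q.Prime ∧ ¬ q ∣ n).biUnion fun q =>
        (badPrimes n x q).filter fun p => good t p = true, Real.log p ≤
      0.3635 * x + 48 * z * Real.log x := by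
  have hl := Real.log_natCast_nonneg x
  calc _ ≤ ∑ q ∈ (Finset.Icc 5 z).filter (fun q => q.Prime ∧ ¬ q ∣ n),
          ∑ p ∈ (badPrimes n x q).filter (fun p => good t p = true), Real.log p :=
        sum_biUnion_le _ _ fun p => Real.log_natCast_nonneg p
    _ ≤ ∑ q ∈ (Finset.Icc 5 z).filter (fun q => q.Prime ∧ ¬ q ∣ n),
          (x * classDensity q + 48 * Real.log x) := by
        refine Finset.sum_le_sum fun q hq => ?_
        rw [Finset.mem_filter, Finset.mem_Icc] at hq
        refine (sum_badPrimes_filter_le ht hxn hq.2.1 hq.1.1 hq.2.2).trans_eq ?_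
        rw [classDensity]; ring
    _ ≤ ∑ q ∈ (Finset.Icc 5 z).filter Nat.Prime, (x * classDensity q + 48 * Real.log x) := by
        refine Finset.sum_le_sum_of_subset_of_nonneg
          (Finset.monotone_filter_right _ fun q _ h => h.1) fun q _ _ => ?_
        have := classDensity_nonneg q
        positivity
    _ ≤ _ := by
        rw [Finset.sum_add_distrib, Finset.sum_const, nsmul_eq_mul, ← Finset.mul_sum]
        have h1 := mul_le_mul_of_nonneg_left (sum_classDensity_le z) (Nat.cast_nonneg (α := ℝ) x)
        have h2 : ((((Finset.Icc 5 z).filter Nat.Prime).card : ℕ) : ℝ) ≤ z := by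
          have := Finset.card_filter_le (Finset.Icc 5 z) Nat.Prime
          rw [Nat.card_Icc] at this
          exact_mod_cast this.trans (by omega)
        have h3 := mul_le_mul_of_nonneg_right h2 (by positivity : 0 ≤ 48 * Real.log x)
        linarith

/-- The prime factors of `n` and the primes from the binary forms contribute little. -/
lemma sum_primeFactors_formPrimes_le {n x : ℕ} (hx : 163000000 ≤ x) (hxn : x ^ 2 < n)
    (hnx : n ≤ (x + 1) ^ 2) :
    ∑ p ∈ (n.primeFactors.filter (5 ≤ ·) ∪
      ((Finset.Ico 1 (24 * 24)).filter fun m => m % 24 = (n - 1) % 24).biUnion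
        (formPrimes n)).filter (fun p => 0 < p ∧ p ≤ x), Real.log p ≤ 22.95 * √(x : ℝ) * Real.log x := by
  set A := n.primeFactors.filter (5 ≤ ·)
  set F := ((Finset.Ico 1 (24 * 24)).filter fun m => m % 24 = (n - 1) % 24).biUnion (formPrimes n)
  set k := (signModuli n).card
  have hl := Real.log_natCast_nonneg x
  have hX : (163000000 : ℝ) ≤ x := by exact_mod_cast hx
  have h1 : ∑ p ∈ (A ∪ F).filter (fun p => 0 < p ∧ p ≤ x), Real.log p ≤
      (A ∪ F).card * Real.log x := by
    calc _ ≤ ∑ p ∈ (A ∪ F).filter (fun p => 0 < p ∧ p ≤ x), Real.log x := by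
          refine Finset.sum_le_sum fun p hp => ?_
          rw [Finset.mem_filter] at hp
          exact Real.log_le_log (by exact_mod_cast hp.2.1) (by exact_mod_cast hp.2.2)
      _ ≤ _ := by
          rw [Finset.sum_const, nsmul_eq_mul]
          exact mul_le_mul_of_nonneg_right (by exact_mod_cast Finset.card_filter_le _ _) hl
  have h2 : 2 * (A ∪ F).card ≤ 27 * 2 ^ k := by
    have hA : A.card ≤ k := Finset.card_le_card (primeFactors_filter_subset n)
    have hF : 2 * F.card ≤ 25 * 2 ^ k :=
      (two_mul_card_biUnion_formPrimes_le n 24 (by omega)).trans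
        (Nat.mul_le_mul_right _ (by split_ifs <;> norm_num))
    have hk : k < 2 ^ k := Nat.lt_two_pow_self
    have := Finset.card_union_le A F
    omega
  have h3 : (2 : ℝ) ^ k ≤ 1.7 * √(x : ℝ) := by
    have h4 : 16 ^ k ≤ 8 * n := sixteen_pow_card_signModuli_le (by nlinarith)
    have h5 : (16 : ℝ) ^ k ≤ 8 * (x + 1) ^ 2 := by
      exact_mod_cast h4.trans (Nat.mul_le_mul_left 8 hnx)
    have h6 : (16 : ℝ) ^ k = (2 ^ k) ^ 4 := by rw [← pow_mul, mul_comm, pow_mul]; norm_num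
    have h7 : (1.7 * √(x : ℝ)) ^ 4 = 8.3521 * x ^ 2 := by
      have := Real.sq_sqrt (by linarith : (0 : ℝ) ≤ x)
      rw [mul_pow, show √(x : ℝ) ^ 4 = (√(x : ℝ) ^ 2) ^ 2 by ring, this]; norm_num
    refine le_of_pow_le_pow_left₀ (n := 4) (by norm_num) (by positivity) ?_
    rw [← h6, h7]
    nlinarith
  have h4 : ((A ∪ F).card : ℝ) ≤ 22.95 * √(x : ℝ) := by
    have : (2 : ℝ) * (A ∪ F).card ≤ 27 * 2 ^ k := by exact_mod_cast h2
    linarith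
  exact h1.trans (mul_le_mul_of_nonneg_right h4 hl)

lemma five_le_of_mem_badPrimes_of_good {n x q p t : ℕ} (hxn : x ^ 2 < n) (htn : n % 3 = 1 → t = n % 9)
    (hq : q.Prime) (hq3 : 3 ≤ q) (hqn : ¬ q ∣ n) (hp : p ∈ badPrimes n x q)
    (hg : good t p = true) : 5 ≤ q := by
  by_contra! h
  have hq4 : q ≠ 4 := by rintro rfl; revert hq; norm_num
  obtain rfl : q = 3 := by omega
  by_cases h1 : n % 3 = 1
  · simp only [badPrimes, Finset.mem_filter, Finset.mem_Icc] at hp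
    obtain ⟨⟨-, hpx⟩, -, -, hd⟩ := hp
    have hlt : p ^ 2 < n := lt_of_le_of_lt (Nat.pow_le_pow_left hpx 2) hxn
    have h2 : p * p % 9 = t := by rw [htn h1, ← pow_two]; omega
    simp [good, h2] at hg
  · rw [badPrimes_three_eq_empty hxn h1 hqn] at hp
    exact absurd hp (Finset.notMem_empty p)

lemma thetaGood_le {n x t : ℕ} (h4 : n % 4 ≠ 1) (hx : 163000000 ≤ x) (hxn : x ^ 2 < n)
    (hnx : n ≤ (x + 1) ^ 2) (ht : t = 1 ∨ t = 4 ∨ t = 7) (htn : n % 3 = 1 → t = n % 9)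
    (hns : ∀ p, p.Prime → p ^ 2 < n → ¬ Squarefree (n - p ^ 2)) :
    thetaGood t x ≤ 0.56 * x := by
  set z := Nat.sqrt x / 8 with hz
  set Q := x / 24 with hQ
  have hs : 12767 ≤ Nat.sqrt x := Nat.le_sqrt.2 (by omega)
  have hsx : Nat.sqrt x * Nat.sqrt x ≤ x := Nat.sqrt_le x
  have hzQ : z ≤ Q := by
    rw [hQ, Nat.le_div_iff_mul_le (by norm_num)]
    nlinarith [Nat.div_mul_le_self (Nat.sqrt x) 8]
  have hcov := cover (P := x) (Q := Q) (j := 24) h4 hxn (by omega) (by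
    refine hnx.trans ?_
    rw [show 24 * 24 * (Q + 1) ^ 2 = (24 * (Q + 1)) ^ 2 by ring]
    exact Nat.pow_le_pow_left (by omega) 2) hns
  have hsub : (Finset.Ioc 0 x).filter (fun p => p.Prime ∧ good t p = true) ⊆
      ({2} ∪ (n.primeFactors.filter (5 ≤ ·) ∪
        ((Finset.Ico 1 (24 * 24)).filter fun m => m % 24 = (n - 1) % 24).biUnion
          (formPrimes n)).filter (fun p => 0 < p ∧ p ≤ x)) ∪
      ((((Finset.Icc 5 z).filter fun q => q.Prime ∧ ¬ q ∣ n).biUnion fun q =>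
        (badPrimes n x q).filter fun p => good t p = true) ∪
      ((Finset.Ioc z Q).filter fun q => q.Prime ∧ ¬ q ∣ n).biUnion (badPrimes n x)) := by
    intro p hp
    simp only [Finset.mem_filter, Finset.mem_Ioc] at hp
    obtain ⟨⟨hp0, hpx⟩, hpp, hg⟩ := hp
    rcases lt_or_ge p 5 with h5 | h5
    · have hp3 : p ≠ 3 := by rintro rfl; simp [good] at hg
      have hp4 : p ≠ 4 := by rintro rfl; revert hpp; norm_num
      have := hpp.two_le
      obtain rfl : p = 2 := by omega
      simp
    have hmem := hcov (Finset.mem_filter.2 ⟨Finset.mem_Icc.2 ⟨h5, hpx⟩, hpp⟩)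
    rw [Finset.mem_union, Finset.mem_union] at hmem
    rcases hmem with (h | h) | h
    · exact Finset.mem_union_left _ (Finset.mem_union_right _
        (Finset.mem_filter.2 ⟨Finset.mem_union_left _ h, hp0, hpx⟩))
    · refine Finset.mem_union_right _ ?_
      rw [Finset.mem_biUnion] at h
      obtain ⟨q, hq, hpq⟩ := h
      rw [Finset.mem_filter, Finset.mem_Icc] at hq
      have hq5 := five_le_of_mem_badPrimes_of_good hxn htn hq.2.1 hq.1.1 hq.2.2 hpq hg
      rcases le_or_gt q z with hqz | hqz
      · exact Finset.mem_union_left _ (Finset.mem_biUnion.2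
          ⟨q, Finset.mem_filter.2 ⟨Finset.mem_Icc.2 ⟨hq5, hqz⟩, hq.2⟩,
            Finset.mem_filter.2 ⟨hpq, hg⟩⟩)
      · exact Finset.mem_union_right _ (Finset.mem_biUnion.2
          ⟨q, Finset.mem_filter.2 ⟨Finset.mem_Ioc.2 ⟨hqz, hq.1.2⟩, hq.2⟩, hpq⟩)
    · exact Finset.mem_union_left _ (Finset.mem_union_right _
        (Finset.mem_filter.2 ⟨Finset.mem_union_right _ h, hp0, hpx⟩))
  have hlog : ∀ p : ℕ, 0 ≤ Real.log (p : ℝ) := Real.log_natCast_nonneg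
  have hsum := (Finset.sum_le_sum_of_subset_of_nonneg hsub fun p _ _ => hlog p).trans
    ((sum_union_le _ _ hlog).trans (add_le_add (sum_union_le _ _ hlog) (sum_union_le _ _ hlog)))
  rw [Finset.sum_singleton] at hsum
  have b1 := sum_primeFactors_formPrimes_le hx hxn hnx
  have b2 := sum_biUnion_badPrimes_filter_le z ht hxn
  have b3 := sum_biUnion_badPrimes_le (n := n) (by omega) hxn (by omega : 3 ≤ z) hzQ
  have b4 := Chebyshev.theta_le_log4_mul_x (x := (Q : ℝ)) (Nat.cast_nonneg _)
  have hl2 := Real.log_two_lt_d9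
  have hl4 : Real.log 4 = 2 * Real.log 2 := by
    rw [show (4 : ℝ) = 2 ^ 2 by norm_num, Real.log_pow]; norm_num
  have hX : (163000000 : ℝ) ≤ x := by exact_mod_cast hx
  have hlx := log_le_sqrt hX
  have huu := Real.mul_self_sqrt (by linarith : (0 : ℝ) ≤ x)
  have hu0 : (10000 : ℝ) ≤ √(x : ℝ) := Real.le_sqrt_of_sq_le (by linarith)
  have hul := mul_le_mul_of_nonneg_left hlx (Real.sqrt_nonneg (x : ℝ))
  have hzu : (z : ℝ) ≤ √(x : ℝ) / 8 := by
    have h1 : (z : ℝ) ≤ (Nat.sqrt x : ℝ) / (8 : ℕ) := Nat.cast_div_le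
    have h2 := Real.nat_sqrt_le_real_sqrt (a := x)
    push_cast at h1
    linarith
  have huz : √(x : ℝ) ≤ 8.1 * z := by
    have h1 : √(x : ℝ) ≤ Nat.sqrt x + 1 := Real.real_sqrt_le_nat_sqrt_succ
    have h2 : (Nat.sqrt x : ℝ) ≤ 8 * z + 7 := by exact_mod_cast (by omega : Nat.sqrt x ≤ 8 * z + 7)
    linarith
  have hQx : (Q : ℝ) ≤ x / 24 := Nat.cast_div_le
  have c1 : Real.log 4 * Q ≤ 1.38631 * (x / 24) :=
    mul_le_mul (by linarith) hQx (Nat.cast_nonneg _) (by norm_num)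
  have c2 : 48 * z * Real.log x ≤ 6 * (√(x : ℝ) * Real.log x) := by
    have := mul_le_mul_of_nonneg_right hzu (hlog x)
    linarith
  have c3 : x * Real.log x / z ≤ 8.1 * (√(x : ℝ) * Real.log x) := by
    have hz0 : (0 : ℝ) < z := by linarith
    rw [div_le_iff₀ hz0]
    have := mul_le_mul_of_nonneg_right huz (mul_nonneg (Real.sqrt_nonneg (x : ℝ)) (hlog x))
    rw [← mul_assoc, huu] at this
    linarith
  rw [thetaGood]
  push_cast at hsum
  linarith

theorem exists_of_gt {n : ℕ} (hn : 163000000 ^ 2 < n) (h4 : n % 4 ≠ 1) :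
    ∃ p, p.Prime ∧ p ^ 2 < n ∧ Squarefree (n - p ^ 2) := by
  by_contra! hns
  set x := Nat.sqrt (n - 1)
  have hx : 163000000 ≤ x := Nat.le_sqrt.2 (by omega)
  have h1 : x * x ≤ n - 1 := Nat.sqrt_le (n - 1)
  have h2 : n - 1 < (x + 1) * (x + 1) := Nat.lt_succ_sqrt (n - 1)
  have hX : (163000000 : ℝ) ≤ x := by exact_mod_cast hx
  obtain ⟨t, ht, htn⟩ : ∃ t, (t = 1 ∨ t = 4 ∨ t = 7) ∧ (n % 3 = 1 → t = n % 9) := by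
    by_cases h : n % 3 = 1
    · exact ⟨n % 9, by omega, fun _ => rfl⟩
    · exact ⟨1, Or.inl rfl, fun h' => absurd h' h⟩
  have := thetaGood_le h4 hx (by rw [pow_two]; omega) (by rw [pow_two]; omega) ht htn hns
  linarith [le_thetaGood ht hx]

theorem sum_prime_square_squarefree (n : ℕ) (hn : 10 ≤ n) (h4 : n % 4 ≠ 1) :
    ∃ p k : ℕ, p.Prime ∧ Squarefree k ∧ 0 < k ∧ n = p ^ 2 + k := by
  rcases lt_or_ge n 25000000 with hlt | hge
  · exact exists_of_lt hn hlt h4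
  obtain ⟨p, hp, hpn, hsf⟩ : ∃ p, p.Prime ∧ p ^ 2 < n ∧ Squarefree (n - p ^ 2) := by
    rcases le_or_gt n (163000000 ^ 2) with h | h
    · exact exists_of_le hge h h4
    · exact exists_of_gt h h4
  exact ⟨p, n - p ^ 2, hp, hsf, by omega, by omega⟩
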